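/- arXiv:1907.07534 — 3 statements merged into one kernel-verified Lean document; each statement's English description precedes it below -/
import Mathlib

section
/- Dual angle-sum relations: for every integer n ≥ 2, every k ∈ {1,…,n−1} and every real β ≥ −1, ∑_{s = 0,1,…, with n−s ≥ k} (−1)^s · 𝐉_{n,n−s}(β) · 𝐈_{n−s,k}(2β+n−1) = 0; and for every real β > (n−1)/2, ∑_{s = 0,1,…, with n−s ≥ k} (−1)^s · 𝐉̃_{n,n−s}(β) · 𝐈̃_{n−s,k}(2β−n+1) = 0. -/
open MeasureTheory Real

noncomputable section

/-- The uniform probability measure on the unit sphere of `ℝ^m`. -/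
def sphereUnif (m : ℕ) : Measure (Metric.sphere (0 : EuclideanSpace ℝ (Fin m)) 1) :=
  ((volume : Measure (EuclideanSpace ℝ (Fin m))).toSphere Set.univ)⁻¹ •
    (volume : Measure (EuclideanSpace ℝ (Fin m))).toSphere

/-- The internal angle of a set `P ⊆ ℝ^m` at a reference point `g₀` (a point in the
relative interior of the face of interest): the normalized spherical Lebesgue measure of
the set of directions `u` on the unit sphere with `g₀ + ε • u ∈ P` for some `ε > 0`. -/
def internalAngle {m : ℕ} (g₀ : EuclideanSpace ℝ (Fin m))
    (P : Set (EuclideanSpace ℝ (Fin m))) : ℝ :=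
  (sphereUnif m {u : Metric.sphere (0 : EuclideanSpace ℝ (Fin m)) 1 |
    ∃ ε : ℝ, 0 < ε ∧ g₀ + ε • (u : EuclideanSpace ℝ (Fin m)) ∈ P}).toReal

/-- The beta density `f_{d,β}` on `ℝ^d`. -/
def betaDensity (d : ℕ) (β : ℝ) (x : EuclideanSpace ℝ (Fin d)) : ℝ :=
  (Real.Gamma ((d : ℝ) / 2 + β + 1) / (Real.pi ^ ((d : ℝ) / 2) * Real.Gamma (β + 1))) *
    (if ‖x‖ < 1 then (1 - ‖x‖ ^ 2) ^ β else 0)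

/-- The beta distribution on `ℝ^d` with parameter `β > -1`; for `β = -1` it is
interpreted as the uniform distribution on the unit sphere `S^{d-1}`. -/
def betaMeasure (d : ℕ) (β : ℝ) : Measure (EuclideanSpace ℝ (Fin d)) :=
  if β = -1 then
    Measure.map
      (fun u : Metric.sphere (0 : EuclideanSpace ℝ (Fin d)) 1 => (u : EuclideanSpace ℝ (Fin d)))
      (sphereUnif d)
  else
    volume.withDensity fun x => ENNReal.ofReal (betaDensity d β x)

/-- `J n k β`: the expected internal angle of the beta simplex `[X_1,…,X_n]` at its face
`[X_1,…,X_k]`, where `X_1,…,X_n` are i.i.d. points in `ℝ^(n-1)` with beta density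
`f_{n-1,β}`. The reference point in the relative interior of the face is its centroid. -/
def J (n k : ℕ) (β : ℝ) : ℝ :=
  ∫ X : Fin n → EuclideanSpace ℝ (Fin (n - 1)),
    internalAngle
      ((k : ℝ)⁻¹ • ∑ i ∈ Finset.univ.filter (fun i : Fin n => (i : ℕ) < k), X i)
      (convexHull ℝ (Set.range X))
    ∂(Measure.pi fun _ : Fin n => betaMeasure (n - 1) β)

/-- `Jb n k β = binom(n,k) * J n k β`, the expected internal angle sum `𝐉_{n,k}(β)`. -/
def Jb (n k : ℕ) (β : ℝ) : ℝ := (n.choose k : ℝ) * J n k β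

/-- Normalizing constant of the one-dimensional beta density. -/
def c1 (β : ℝ) : ℝ := Real.Gamma (3 / 2 + β) / (Real.sqrt Real.pi * Real.Gamma (β + 1))

/-- The quantity `I_{n,k}(α)`. -/
def I (n k : ℕ) (α : ℝ) : ℝ :=
  ∫ φ in (-(Real.pi / 2))..(Real.pi / 2),
    c1 ((α * k - 1) / 2) * Real.cos φ ^ (α * k) *
      (∫ θ in (-(Real.pi / 2))..φ, c1 ((α - 1) / 2) * Real.cos θ ^ α) ^ (n - k)

/-- `Ib n k α = binom(n,k) * I n k α`, the expected external angle sum `𝐈_{n,k}(α)`. -/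
def Ib (n k : ℕ) (α : ℝ) : ℝ := (n.choose k : ℝ) * I n k α

/-- The beta' density `f̃_{d,β}` on `ℝ^d`. -/
def betaPrimeDensity (d : ℕ) (β : ℝ) (x : EuclideanSpace ℝ (Fin d)) : ℝ :=
  (Real.Gamma β / (Real.pi ^ ((d : ℝ) / 2) * Real.Gamma (β - (d : ℝ) / 2))) *
    (1 + ‖x‖ ^ 2) ^ (-β)

/-- The beta' distribution on `ℝ^d` with parameter `β > d/2`. -/
def betaPrimeMeasure (d : ℕ) (β : ℝ) : Measure (EuclideanSpace ℝ (Fin d)) :=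
  volume.withDensity fun x => ENNReal.ofReal (betaPrimeDensity d β x)

/-- `Jt n k β`: the expected internal angle of the beta' simplex `[X̃_1,…,X̃_n]` at its
face `[X̃_1,…,X̃_k]`; the reference point in the relative interior of the face is its
centroid. -/
def Jt (n k : ℕ) (β : ℝ) : ℝ :=
  ∫ X : Fin n → EuclideanSpace ℝ (Fin (n - 1)),
    internalAngle
      ((k : ℝ)⁻¹ • ∑ i ∈ Finset.univ.filter (fun i : Fin n => (i : ℕ) < k), X i)
      (convexHull ℝ (Set.range X))
    ∂(Measure.pi fun _ : Fin n => betaPrimeMeasure (n - 1) β)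

/-- `Jtb n k β = binom(n,k) * Jt n k β`, the expected internal angle sum `𝐉̃_{n,k}(β)`. -/
def Jtb (n k : ℕ) (β : ℝ) : ℝ := (n.choose k : ℝ) * Jt n k β

/-- Normalizing constant of the one-dimensional beta' density. -/
def c1t (β : ℝ) : ℝ := Real.Gamma β / (Real.sqrt Real.pi * Real.Gamma (β - 1 / 2))

/-- The quantity `Ĩ_{n,k}(α)`. -/
def It (n k : ℕ) (α : ℝ) : ℝ :=
  ∫ φ in (-(Real.pi / 2))..(Real.pi / 2),
    c1t ((α * k + 1) / 2) * Real.cos φ ^ (α * k - 1) *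
      (∫ θ in (-(Real.pi / 2))..φ, c1t ((α + 1) / 2) * Real.cos θ ^ (α - 1)) ^ (n - k)

/-- `Itb n k α = binom(n,k) * It n k α`, the expected external angle sum `𝐈̃_{n,k}(α)`. -/
def Itb (n k : ℕ) (α : ℝ) : ℝ := (n.choose k : ℝ) * It n k α

set_option linter.unusedSectionVars false

namespace BetaAngles

open scoped ENNReal
open Set Module

section Density

/-- The common profile of the beta (`σ = 1`) and beta' (`σ = -1`) densities as a function of the
squared norm. -/
def profile (σ s t : ℝ) : ℝ≥0∞ :=
  if 0 < 1 - σ * t then ENNReal.ofReal ((1 - σ * t) ^ s) else 0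

lemma measurable_profile (σ s : ℝ) : Measurable (profile σ s) := by
  unfold profile
  refine Measurable.ite (measurableSet_lt measurable_const (by fun_prop)) (by fun_prop)
    measurable_const

lemma profile_of_pos {σ s t : ℝ} (h : 0 < 1 - σ * t) :
    profile σ s t = ENNReal.ofReal ((1 - σ * t) ^ s) := if_pos h

lemma profile_add {σ s t u : ℝ} (h : 0 < 1 - σ * t) :
    profile σ s (t + u) = profile σ s t * profile σ s (u / (1 - σ * t)) := by
  have e : 1 - σ * (t + u) = (1 - σ * t) * (1 - σ * (u / (1 - σ * t))) := by
    field_simp; ring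
  unfold profile
  rw [e, if_pos h]
  by_cases h2 : 0 < 1 - σ * (u / (1 - σ * t))
  · rw [if_pos h2, if_pos (mul_pos h h2), Real.mul_rpow h.le h2.le,
      ENNReal.ofReal_mul (by positivity)]
  · rw [if_neg h2, if_neg (fun h3 => h2 (pos_of_mul_pos_right h3 h.le)), mul_zero]

lemma profile_add_eq_zero {σ s t u : ℝ} (ht : 0 ≤ t) (hu : 0 ≤ u) (h : ¬ 0 < 1 - σ * t) :
    profile σ s (t + u) = 0 := by
  unfold profile
  rw [if_neg]
  have : 0 < σ := by
    by_contra h'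
    nlinarith
  nlinarith

lemma profile_mul_profile (σ s s' t : ℝ) :
    profile σ s t * profile σ s' t = profile σ (s + s') t := by
  unfold profile
  split_ifs with h
  · rw [← ENNReal.ofReal_mul (by positivity), ← Real.rpow_add h]
  · simp

lemma profile_pow_mul {σ t : ℝ} (s s' : ℝ) (n : ℕ) (h : 0 < 1 - σ * t) :
    profile σ s t * profile σ s' t ^ n = profile σ (s + n * s') t := by
  rw [profile_of_pos h, profile_of_pos h, profile_of_pos h, ← ENNReal.ofReal_pow (by positivity),
    ← ENNReal.ofReal_mul (by positivity), ← Real.rpow_natCast, ← Real.rpow_mul h.le,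
    ← Real.rpow_add h, mul_comm s']

end Density

section SigmaCompact

lemma _root_.IsSigmaCompact.measurableSet' {X : Type*} [TopologicalSpace X] [T2Space X]
    [MeasurableSpace X] [OpensMeasurableSpace X] {s : Set X} (hs : IsSigmaCompact s) :
    MeasurableSet s := by
  obtain ⟨K, hK, rfl⟩ := hs
  exact MeasurableSet.iUnion fun n => (hK n).measurableSet

/-- In a proper metric space, the intersection of a closed and an open set is sigma-compact. -/
lemma isSigmaCompact_closed_inter_open {X : Type*} [MetricSpace X] [ProperSpace X] {s t : Set X}
    (hs : IsClosed s) (ht : IsOpen t) : IsSigmaCompact (s ∩ t) := by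
  obtain ⟨F, hF, -, hU, -⟩ := ht.exists_iUnion_isClosed
  have h2 : s ∩ t = ⋃ n, s ∩ F n := by rw [← hU, inter_iUnion]
  rw [h2]
  exact isSigmaCompact_iUnion _ fun n =>
    isSigmaCompact_univ.of_isClosed_subset (hs.inter (hF n)) (subset_univ _)

/-- A set defined by existentially quantifying, over a proper metric space, a closed and an open
condition is measurable. -/
lemma measurableSet_exists_closed_open {X Y : Type*} [MetricSpace X] [ProperSpace X]
    [MetricSpace Y] [ProperSpace Y] [MeasurableSpace X] [OpensMeasurableSpace X]
    {s t : Set (X × Y)} (hs : IsClosed s) (ht : IsOpen t) :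
    MeasurableSet {x : X | ∃ y, (x, y) ∈ s ∧ (x, y) ∈ t} := by
  have := (isSigmaCompact_closed_inter_open hs ht).image continuous_fst
  convert! this.measurableSet' using 1
  ext x
  simp

end SigmaCompact

section Slicing

variable {E V ι : Type*} [NormedAddCommGroup E] [InnerProductSpace ℝ E] [FiniteDimensional ℝ E]
  [MeasureSpace E] [BorelSpace E] [(volume : Measure E).IsAddHaarMeasure]
  [NormedAddCommGroup V] [InnerProductSpace ℝ V] [FiniteDimensional ℝ V]
  [MeasureSpace V] [BorelSpace V] [(volume : Measure V).IsAddHaarMeasure] [Fintype ι]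

variable (V) in
/-- The Jacobian factor of the coordinates `x = U p + ∑ i, c i • e i`. -/
def sliceFactor (e : ι → E) : ℝ≥0∞ :=
  volume (Metric.closedBall (0 : E) 1) /
    (volume : Measure (V × (ι → ℝ))) {z | ‖z.1‖ ^ 2 + ‖∑ i, z.2 i • e i‖ ^ 2 ≤ 1}

variable (V) in
lemma measurable_sliceFactor : Measurable (sliceFactor V : (ι → E) → ℝ≥0∞) := by
  unfold sliceFactor
  refine Measurable.div measurable_const ?_
  have hm : MeasurableSet {w : (ι → E) × (V × (ι → ℝ)) |
      ‖w.2.1‖ ^ 2 + ‖∑ i, w.2.2 i • w.1 i‖ ^ 2 ≤ 1} :=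
    (isClosed_le (by fun_prop) continuous_const).measurableSet
  exact measurable_measure_prodMk_left hm

/-- The linear map `(p, c) ↦ U p + ∑ i, c i • e i`. -/
def sliceMap (e : ι → E) (U : V →ₗᵢ[ℝ] E) : V × (ι → ℝ) →ₗ[ℝ] E :=
  LinearMap.coprod U.toLinearMap (Fintype.linearCombination ℝ e)

lemma sliceMap_apply (e : ι → E) (U : V →ₗᵢ[ℝ] E) (z : V × (ι → ℝ)) :
    sliceMap e U z = U z.1 + ∑ i, z.2 i • e i := by
  simp [sliceMap, Fintype.linearCombination_apply]

lemma inner_isometry_sum {e : ι → E} {U : V →ₗᵢ[ℝ] E} (hU : ∀ p i, inner ℝ (U p) (e i) = 0)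
    (p : V) (c : ι → ℝ) : inner ℝ (U p) (∑ i, c i • e i) = 0 := by
  simp [inner_sum, inner_smul_right, hU]

lemma norm_sq_slice {e : ι → E} {U : V →ₗᵢ[ℝ] E} (hU : ∀ p i, inner ℝ (U p) (e i) = 0)
    (p : V) (c : ι → ℝ) : ‖U p + ∑ i, c i • e i‖ ^ 2 = ‖p‖ ^ 2 + ‖∑ i, c i • e i‖ ^ 2 := by
  rw [norm_add_sq_real, inner_isometry_sum hU, U.norm_map]; ring

lemma sliceMap_bijective {e : ι → E} (he : LinearIndependent ℝ e) {U : V →ₗᵢ[ℝ] E}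
    (hU : ∀ p i, inner ℝ (U p) (e i) = 0)
    (hd : finrank ℝ V + Fintype.card ι = finrank ℝ E) :
    Function.Bijective (sliceMap e U) := by
  have hinj : Function.Injective (sliceMap e U) := by
    rw [← LinearMap.ker_eq_bot, LinearMap.ker_eq_bot']
    rintro ⟨p, c⟩ h
    rw [sliceMap_apply] at h
    have h2 := norm_sq_slice hU p c
    simp only [h, norm_zero] at h2
    have hp : p = 0 := by
      rw [← norm_eq_zero]; nlinarith [sq_nonneg ‖p‖, sq_nonneg ‖∑ i, c i • e i‖]
    have hc : ∑ i, c i • e i = 0 := by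
      rw [← norm_eq_zero]; nlinarith [sq_nonneg ‖p‖, sq_nonneg ‖∑ i, c i • e i‖]
    ext1
    · exact hp
    · exact funext fun i => Fintype.linearIndependent_iff.1 he c hc i
  refine ⟨hinj, ?_⟩
  rwa [← LinearMap.injective_iff_surjective_of_finrank_eq_finrank]
  simp [finrank_prod, hd]

lemma volume_eq_slice {e : ι → E} (he : LinearIndependent ℝ e) {U : V →ₗᵢ[ℝ] E}
    (hU : ∀ p i, inner ℝ (U p) (e i) = 0)
    (hd : finrank ℝ V + Fintype.card ι = finrank ℝ E) :
    (volume : Measure E) = sliceFactor V e • Measure.map (sliceMap e U) volume ∧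
      sliceFactor V e ≠ 0 ∧ sliceFactor V e ≠ ∞ := by
  let Φ : (V × (ι → ℝ)) ≃L[ℝ] E :=
    (LinearEquiv.ofBijective _ (sliceMap_bijective he hU hd)).toContinuousLinearEquiv
  have hΦ : ∀ z, Φ z = sliceMap e U z := fun z => rfl
  have hvp : (volume : Measure (V × (ι → ℝ))).IsAddHaarMeasure := by
    rw [Measure.volume_eq_prod]; infer_instance
  have hH : (Measure.map Φ (volume : Measure (V × (ι → ℝ)))).IsAddHaarMeasure :=
    Φ.isAddHaarMeasure_map _
  have h1 : (volume : Measure E) = _ :=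
    Measure.isAddLeftInvariant_eq_smul volume (Measure.map Φ (volume : Measure (V × (ι → ℝ))))
  set k := (volume : Measure E).addHaarScalarFactor
    (Measure.map Φ (volume : Measure (V × (ι → ℝ)))) with hk
  have hpre : Φ ⁻¹' Metric.closedBall (0 : E) 1 =
      {z | ‖z.1‖ ^ 2 + ‖∑ i, z.2 i • e i‖ ^ 2 ≤ 1} := by
    ext z
    simp only [mem_preimage, Metric.mem_closedBall, dist_zero_right, mem_ofPred_eq]
    rw [hΦ, sliceMap_apply, ← norm_sq_slice hU, sq_le_one_iff₀ (norm_nonneg _)]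
  have h2 : volume (Metric.closedBall (0 : E) 1) =
      k * (volume : Measure (V × (ι → ℝ))) {z | ‖z.1‖ ^ 2 + ‖∑ i, z.2 i • e i‖ ^ 2 ≤ 1} := by
    conv_lhs => rw [h1]
    rw [Measure.smul_apply, Measure.map_apply Φ.continuous.measurable
      Metric.isClosed_closedBall.measurableSet, hpre]
    rfl
  have hb0 : volume (Metric.closedBall (0 : E) 1) ≠ 0 :=
    (Metric.measure_closedBall_pos volume 0 one_pos).ne'
  have hbt : volume (Metric.closedBall (0 : E) 1) ≠ ∞ := measure_closedBall_lt_top.ne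
  have hm0 : (volume : Measure (V × (ι → ℝ))) {z | ‖z.1‖ ^ 2 + ‖∑ i, z.2 i • e i‖ ^ 2 ≤ 1} ≠ 0 := by
    intro h; rw [h, mul_zero] at h2; exact hb0 h2
  have hmt : (volume : Measure (V × (ι → ℝ))) {z | ‖z.1‖ ^ 2 + ‖∑ i, z.2 i • e i‖ ^ 2 ≤ 1} ≠ ∞ := by
    rw [← hpre]
    exact (Φ.toHomeomorph.isCompact_preimage.2 (isCompact_closedBall _ _)).measure_lt_top.ne
  have hkap : sliceFactor V e = k := by
    rw [sliceFactor, h2, ENNReal.mul_div_cancel_right hm0 hmt]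
  refine ⟨?_, ?_, ?_⟩
  · rw [hkap]; exact h1
  · rw [sliceFactor]; exact (ENNReal.div_pos hb0 hmt).ne'
  · rw [hkap]; exact ENNReal.coe_ne_top

lemma lintegral_slice {e : ι → E} (he : LinearIndependent ℝ e) {U : V →ₗᵢ[ℝ] E}
    (hU : ∀ p i, inner ℝ (U p) (e i) = 0)
    (hd : finrank ℝ V + Fintype.card ι = finrank ℝ E) {F : E → ℝ≥0∞} (hF : Measurable F) :
    ∫⁻ x, F x = sliceFactor V e * ∫⁻ p : V, ∫⁻ c : ι → ℝ, F (U p + ∑ i, c i • e i) := by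
  have hm : Measurable (sliceMap e U) :=
    (LinearMap.continuous_of_finiteDimensional (sliceMap e U)).measurable
  conv_lhs => rw [(volume_eq_slice he hU hd).1]
  rw [lintegral_smul_measure, lintegral_map hF hm, Measure.volume_eq_prod,
    lintegral_prod (fun z => F (sliceMap e U z)) (hF.comp hm).aemeasurable]
  simp only [sliceMap_apply, smul_eq_mul]

lemma lintegral_comp_smul_pos {W : Type*} [NormedAddCommGroup W] [NormedSpace ℝ W]
    [MeasurableSpace W] [BorelSpace W] [FiniteDimensional ℝ W] (μ : Measure W)
    [μ.IsAddHaarMeasure] {r : ℝ} (hr : 0 < r) (F : W → ℝ≥0∞) :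
    ∫⁻ x, F x ∂μ = ENNReal.ofReal (r ^ finrank ℝ W) * ∫⁻ x, F (r • x) ∂μ := by
  have h := Measure.map_addHaar_smul μ hr.ne'
  have h2 : ∫⁻ x, F (r • x) ∂μ = ∫⁻ x, F x ∂(Measure.map (fun x => r • x) μ) :=
    (lintegral_map_equiv F ((Homeomorph.smulOfNeZero r hr.ne').toMeasurableEquiv)).symm
  have h3 : 0 < r ^ finrank ℝ W := by positivity
  rw [h2, h, lintegral_smul_measure, smul_eq_mul, ← mul_assoc, ← ENNReal.ofReal_mul h3.le,
    abs_of_pos (by positivity), mul_inv_cancel₀ h3.ne', ENNReal.ofReal_one, one_mul]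

lemma sliceFactor_smul (e : ι → E) {r : ℝ} (hr : 0 < r) :
    sliceFactor V (r • e) = ENNReal.ofReal (r ^ Fintype.card ι) * sliceFactor V e := by
  have key : ∀ f : ι → E, (volume : Measure (V × (ι → ℝ)))
      {z | ‖z.1‖ ^ 2 + ‖∑ i, z.2 i • f i‖ ^ 2 ≤ 1} =
      ∫⁻ p : V, ∫⁻ c : ι → ℝ, indicator {c | ‖p‖ ^ 2 + ‖∑ i, c i • f i‖ ^ 2 ≤ 1} 1 c := by
    intro f
    rw [Measure.volume_eq_prod, Measure.prod_apply]
    · refine lintegral_congr fun p => ?_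
      rw [lintegral_indicator_one]
      · rfl
      · exact (isClosed_le (by fun_prop) continuous_const).measurableSet
    · exact (isClosed_le (by fun_prop) continuous_const).measurableSet
  have h3 : 0 < r ^ Fintype.card ι := by positivity
  unfold sliceFactor
  have : (volume : Measure (V × (ι → ℝ))) {z | ‖z.1‖ ^ 2 + ‖∑ i, z.2 i • e i‖ ^ 2 ≤ 1} =
      ENNReal.ofReal (r ^ Fintype.card ι) *
      (volume : Measure (V × (ι → ℝ))) {z | ‖z.1‖ ^ 2 + ‖∑ i, z.2 i • (r • e) i‖ ^ 2 ≤ 1} := by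
    rw [key, key, ← lintegral_const_mul' _ _ ENNReal.ofReal_ne_top]
    refine lintegral_congr fun p => ?_
    rw [lintegral_comp_smul_pos volume hr, finrank_fintype_fun_eq_card]
    congr 1
    refine lintegral_congr fun c => ?_
    simp only [indicator, mem_ofPred_eq, Pi.smul_apply, smul_eq_mul, smul_smul, mul_comm r,
      Pi.one_apply]
  have h5 : ENNReal.ofReal (r ^ Fintype.card ι) ≠ 0 := by simpa using h3
  rw [this, ENNReal.div_eq_inv_mul, ENNReal.div_eq_inv_mul,
    ENNReal.mul_inv (Or.inl h5) (Or.inl ENNReal.ofReal_ne_top), ← mul_assoc, ← mul_assoc,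
    ENNReal.mul_inv_cancel h5 ENNReal.ofReal_ne_top, one_mul]

end Slicing

section PiDensity

variable {ι X : Type*} [Fintype ι] [MeasurableSpace X] (μ : Measure X) [SigmaFinite μ]

lemma lintegral_pi_prod (f : ι → X → ℝ≥0∞) (hf : ∀ i, Measurable (f i)) :
    ∫⁻ x : ι → X, ∏ i, f i (x i) ∂(Measure.pi fun _ => μ) = ∏ i, ∫⁻ x, f i x ∂μ := by
  classical
  rcases isEmpty_or_nonempty X with hX | ⟨⟨x0⟩⟩
  · rcases isEmpty_or_nonempty ι with hι | ⟨⟨i0⟩⟩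
    · simp
    · have : μ = 0 := Subsingleton.elim _ _
      have h2 : IsEmpty (ι → X) := ⟨fun f => hX.elim (f i0)⟩
      rw [lintegral_of_isEmpty, eq_comm, Finset.prod_eq_zero (Finset.mem_univ i0)]
      exact lintegral_of_isEmpty _ _
  have key : ∀ (s : Finset ι) (c : ℝ≥0∞),
      (∫⋯∫⁻_s, (fun x : ι → X => c * ∏ i ∈ s, f i (x i)) ∂(fun _ => μ)) (fun _ => x0) =
        c * ∏ i ∈ s, ∫⁻ x, f i x ∂μ := by
    intro s
    induction s using Finset.induction with
    | empty => intro c; simp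
    | insert i s hi ih =>
      intro c
      rw [lmarginal_insert' _ (by fun_prop) hi]
      have : (fun x : ι → X => ∫⁻ xi, (fun x : ι → X => c * ∏ i ∈ insert i s, f i (x i))
          (Function.update x i xi) ∂μ) =
          fun x => (c * ∫⁻ x, f i x ∂μ) * ∏ j ∈ s, f j (x j) := by
        funext x
        have h3 : ∀ xi, c * ∏ j ∈ insert i s, f j (Function.update x i xi j) =
            c * (∏ j ∈ s, f j (x j)) * f i xi := by
          intro xi
          rw [Finset.prod_insert hi, Function.update_self, Finset.prod_congr rfl]
          · ring
          · intro j hj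
            rw [Function.update_of_ne (ne_of_mem_of_not_mem hj hi)]
        simp only [h3]
        rw [lintegral_const_mul _ (hf i)]
        ring
      rw [this, ih, Finset.prod_insert hi, mul_assoc]
  have := key Finset.univ 1
  simpa using this

lemma pi_withDensity (f : X → ℝ≥0∞) (hf : Measurable f) [SigmaFinite (μ.withDensity f)] :
    Measure.pi (fun _ : ι => μ.withDensity f) =
      (Measure.pi fun _ : ι => μ).withDensity (fun x => ∏ i, f (x i)) := by
  refine Measure.pi_eq (μ := fun _ : ι => μ.withDensity f) fun s hs => ?_
  rw [withDensity_apply _ (MeasurableSet.univ_pi hs)]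
  have h1 : ∀ i, μ.withDensity f (s i) = ∫⁻ x, (s i).indicator f x ∂μ := fun i => by
    rw [withDensity_apply _ (hs i), lintegral_indicator (hs i)]
  simp only [h1]
  rw [← lintegral_pi_prod μ _ (fun i => hf.indicator (hs i)),
    ← lintegral_indicator (MeasurableSet.univ_pi hs)]
  refine lintegral_congr fun x => ?_
  by_cases hx : x ∈ univ.pi s
  · rw [indicator_of_mem hx]
    exact Finset.prod_congr rfl fun i _ => (indicator_of_mem (hx i trivial) f).symm
  · rw [indicator_of_notMem hx]
    simp only [mem_univ_pi, not_forall] at hx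
    obtain ⟨i, hi⟩ := hx
    exact (Finset.prod_eq_zero (Finset.mem_univ i) (indicator_of_notMem hi f)).symm

lemma pi_smul_const (c : ℝ≥0∞) [SigmaFinite (c • μ)] :
    Measure.pi (fun _ : ι => c • μ) = c ^ Fintype.card ι • Measure.pi (fun _ : ι => μ) := by
  have : SigmaFinite (μ.withDensity fun _ => c) := by rwa [withDensity_const]
  have h := pi_withDensity (ι := ι) μ (fun _ => c) measurable_const
  simpa [withDensity_const] using h

end PiDensity

section Beta

variable (σ a : ℝ)
variable (E : Type*) [NormedAddCommGroup E] [InnerProductSpace ℝ E] [FiniteDimensional ℝ E]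
  [MeasureSpace E] [BorelSpace E] [(volume : Measure E).IsAddHaarMeasure]
variable {V : Type*} [NormedAddCommGroup V] [InnerProductSpace ℝ V] [FiniteDimensional ℝ V]
  [MeasureSpace V] [BorelSpace V] [(volume : Measure V).IsAddHaarMeasure]

/-- The unnormalized beta (`σ = 1`) or beta' (`σ = -1`) measure; the parameter `a` is invariant
under projections. -/
def nu : Measure E := volume.withDensity fun x => profile σ ((a - finrank ℝ E) / 2) (‖x‖ ^ 2)

/-- The normalization of `nu`. -/
def pn : Measure E := (nu σ a E univ)⁻¹ • nu σ a E

/-- The parameters for which `nu` can be normalized. -/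
def Normable : Prop := nu σ a E univ ≠ 0 ∧ nu σ a E univ ≠ ∞

variable {σ a E}

@[fun_prop]
lemma _root_.Measurable.profile {X : Type*} [MeasurableSpace X] {f : X → ℝ}
    (hf : Measurable f) (s : ℝ) : Measurable fun x => profile σ s (f x) :=
  (measurable_profile σ s).comp hf

lemma Normable.isProbabilityMeasure (h : Normable σ a E) : IsProbabilityMeasure (pn σ a E) := by
  refine ⟨?_⟩
  rw [pn, Measure.smul_apply, smul_eq_mul, ENNReal.inv_mul_cancel h.1 h.2]

lemma Normable.pn_ac (_ : Normable σ a E) : pn σ a E ≪ volume :=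
  (withDensity_absolutelyContinuous _ _).smul_left _

lemma Normable.isFiniteMeasure_nu (h : Normable σ a E) : IsFiniteMeasure (nu σ a E) :=
  ⟨lt_top_iff_ne_top.2 h.2⟩

/-- The adjoint of an isometric embedding, that is, the orthogonal projection on its range. -/
def coproj (U : V →ₗᵢ[ℝ] E) : E →ₗ[ℝ] V := LinearMap.adjoint U.toLinearMap

lemma coproj_apply_self (U : V →ₗᵢ[ℝ] E) (p : V) : coproj U (U p) = p := by
  refine ext_inner_right ℝ fun q => ?_
  rw [coproj, LinearMap.adjoint_inner_left]
  exact U.inner_map_map p q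

lemma coproj_eq_zero {U : V →ₗᵢ[ℝ] E} {x : E} (h : ∀ p, inner ℝ (U p) x = 0) :
    coproj U x = 0 := by
  refine ext_inner_left ℝ fun q => ?_
  rw [coproj, LinearMap.adjoint_inner_right, inner_zero_right]
  exact h q

lemma coproj_slice {ι : Type*} [Fintype ι] {U : V →ₗᵢ[ℝ] E} {e : ι → E}
    (h : ∀ p i, inner ℝ (U p) (e i) = 0) (p : V) (c : ι → ℝ) :
    coproj U (U p + ∑ i, c i • e i) = p := by
  rw [map_add, coproj_apply_self, map_sum, Finset.sum_eq_zero, add_zero]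
  intro i _
  rw [map_smul, coproj_eq_zero (fun p => h p i), smul_zero]

lemma measurable_coproj (U : V →ₗᵢ[ℝ] E) : Measurable (coproj U) :=
  (LinearMap.continuous_of_finiteDimensional (coproj U)).measurable

lemma exists_isometry_orthogonal {ι : Type*} [Fintype ι] {e : ι → E} (he : LinearIndependent ℝ e)
    (hd : finrank ℝ V + Fintype.card ι = finrank ℝ E) :
    ∃ U : V →ₗᵢ[ℝ] E, ∀ p i, inner ℝ (U p) (e i) = 0 := by
  have h1 : finrank ℝ (Submodule.span ℝ (range e))ᗮ = finrank ℝ V := by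
    have h2 := Submodule.finrank_add_finrank_orthogonal (Submodule.span ℝ (range e))
    rw [finrank_span_eq_card he] at h2
    omega
  let Φ : V ≃ₗᵢ[ℝ] (Submodule.span ℝ (range e))ᗮ :=
    ((stdOrthonormalBasis ℝ V).reindex (finCongr h1.symm)).equiv
      (stdOrthonormalBasis ℝ (Submodule.span ℝ (range e))ᗮ) (Equiv.refl _)
  refine ⟨(Submodule.subtypeₗᵢ _).comp Φ.toLinearIsometry, fun p i => ?_⟩
  have := (Φ p).2
  rw [Submodule.mem_orthogonal'] at this
  exact this _ (Submodule.subset_span (mem_range_self i))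

lemma exists_orthogonal_family (U : V →ₗᵢ[ℝ] E) :
    ∃ e : Fin (finrank ℝ E - finrank ℝ V) → E, LinearIndependent ℝ e ∧
      (∀ p i, inner ℝ (U p) (e i) = 0) ∧
      finrank ℝ V + Fintype.card (Fin (finrank ℝ E - finrank ℝ V)) = finrank ℝ E := by
  have h0 : finrank ℝ U.toLinearMap.range = finrank ℝ V :=
    LinearMap.finrank_range_of_inj U.injective
  have h2 := Submodule.finrank_add_finrank_orthogonal U.toLinearMap.range
  have h1 : finrank ℝ (U.toLinearMap.range)ᗮ = finrank ℝ E - finrank ℝ V := by omega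
  let b := (stdOrthonormalBasis ℝ (U.toLinearMap.range)ᗮ).reindex (finCongr h1)
  refine ⟨fun i => (b i : E), ?_, fun p i => ?_, ?_⟩
  · exact b.toBasis.linearIndependent.map' (Submodule.subtype _) (Submodule.ker_subtype _)
      |> fun h => by simpa [Function.comp_def] using h
  · exact (b i).2 (U p) (LinearMap.mem_range_self U.toLinearMap p)
  · rw [Fintype.card_fin]; omega

end Beta

section Projection

variable {σ a : ℝ}
variable {E : Type*} [NormedAddCommGroup E] [InnerProductSpace ℝ E] [FiniteDimensional ℝ E]
  [MeasureSpace E] [BorelSpace E] [(volume : Measure E).IsAddHaarMeasure]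
variable {V : Type*} [NormedAddCommGroup V] [InnerProductSpace ℝ V] [FiniteDimensional ℝ V]
  [MeasureSpace V] [BorelSpace V] [(volume : Measure V).IsAddHaarMeasure]

lemma ofReal_sqrt_pow {t : ℝ} (h : 0 < 1 - σ * t) (n : ℕ) :
    ENNReal.ofReal (√(1 - σ * t) ^ n) = profile σ (n / 2) t := by
  rw [profile_of_pos h, Real.sqrt_eq_rpow, ← Real.rpow_natCast, ← Real.rpow_mul h.le]
  congr 2; ring

lemma profile_add_sqrt_smul {s t : ℝ} (h : 0 < 1 - σ * t) (x : E) :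
    profile σ s (t + ‖√(1 - σ * t) • x‖ ^ 2) = profile σ s t * profile σ s (‖x‖ ^ 2) := by
  rw [profile_add h, norm_smul, mul_pow, Real.norm_eq_abs, sq_abs, Real.sq_sqrt h.le,
    mul_div_cancel_left₀ _ h.ne']

lemma lintegral_profile_fiber {ι : Type*} [Fintype ι] (e : ι → E) (s : ℝ) (p : V) :
    ∫⁻ c : ι → ℝ, profile σ s (‖p‖ ^ 2 + ‖∑ i, c i • e i‖ ^ 2) =
      profile σ (s + Fintype.card ι / 2) (‖p‖ ^ 2) *
        ∫⁻ c : ι → ℝ, profile σ s (‖∑ i, c i • e i‖ ^ 2) := by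
  by_cases h : 0 < 1 - σ * ‖p‖ ^ 2
  · rw [lintegral_comp_smul_pos volume (Real.sqrt_pos.2 h), finrank_fintype_fun_eq_card,
      ofReal_sqrt_pow h]
    have : ∀ c : ι → ℝ, ∑ i, (√(1 - σ * ‖p‖ ^ 2) • c) i • e i =
        √(1 - σ * ‖p‖ ^ 2) • ∑ i, c i • e i := fun c => by
      simp [Finset.smul_sum, smul_smul]
    simp only [this, profile_add_sqrt_smul h]
    rw [lintegral_const_mul _ (by fun_prop), ← mul_assoc, profile_mul_profile, add_comm]
  · simp only [profile_add_eq_zero (sq_nonneg _) (sq_nonneg _) h, lintegral_zero]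
    rw [profile, if_neg h, zero_mul]

/-- The projection of a beta-type measure is a multiple of a beta-type measure with the same
parameter. -/
lemma exists_map_coproj_nu (σ a : ℝ) (U : V →ₗᵢ[ℝ] E) :
    ∃ C : ℝ≥0∞, Measure.map (coproj U) (nu σ a E) = C • nu σ a V := by
  obtain ⟨e, he, hU, hd⟩ := exists_orthogonal_family U
  refine ⟨sliceFactor V e * ∫⁻ c : Fin (finrank ℝ E - finrank ℝ V) → ℝ,
    profile σ ((a - finrank ℝ E) / 2) (‖∑ i, c i • e i‖ ^ 2), ?_⟩
  refine Measure.ext_of_lintegral _ fun F hF => ?_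
  have hm := measurable_coproj U
  rw [lintegral_map hF hm, lintegral_smul_measure, nu, nu,
    lintegral_withDensity_eq_lintegral_mul _ (by fun_prop) (by fun_prop),
    lintegral_withDensity_eq_lintegral_mul _ (by fun_prop) (by fun_prop)]
  simp only [Pi.mul_apply]
  rw [lintegral_slice he hU hd (by fun_prop)]
  simp only [coproj_slice hU, norm_sq_slice hU]
  have h1 : ∀ p : V, ∫⁻ c : Fin (finrank ℝ E - finrank ℝ V) → ℝ,
      profile σ ((a - finrank ℝ E) / 2) (‖p‖ ^ 2 + ‖∑ i, c i • e i‖ ^ 2) * F p =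
      (∫⁻ c : Fin (finrank ℝ E - finrank ℝ V) → ℝ,
        profile σ ((a - finrank ℝ E) / 2) (‖∑ i, c i • e i‖ ^ 2)) *
      (profile σ ((a - finrank ℝ V) / 2) (‖p‖ ^ 2) * F p) := by
    intro p
    rw [lintegral_mul_const _ (by fun_prop),
      lintegral_profile_fiber]
    have : (a - finrank ℝ E) / 2 + (Fintype.card (Fin (finrank ℝ E - finrank ℝ V)) : ℝ) / 2 =
        (a - finrank ℝ V) / 2 := by
      have hd' : (finrank ℝ V : ℝ) + Fintype.card (Fin (finrank ℝ E - finrank ℝ V)) =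
        finrank ℝ E := mod_cast hd
      linarith
    rw [this]; ring
  simp only [h1]
  rw [lintegral_const_mul _ (by fun_prop), smul_eq_mul, mul_assoc]

lemma pn_eq_of_nu_map {F : Type*} [NormedAddCommGroup F] [InnerProductSpace ℝ F]
    [FiniteDimensional ℝ F] [MeasureSpace F] [BorelSpace F] {μ : Measure F}
    [IsProbabilityMeasure μ] {C : ℝ≥0∞} (h : μ = C • nu σ a F) :
    Normable σ a F ∧ μ = pn σ a F := by
  have h1 : C * nu σ a F univ = 1 := by
    have := measure_univ (μ := μ)
    rwa [h, Measure.smul_apply, smul_eq_mul] at this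
  have hn : Normable σ a F := by
    constructor
    · intro h0; simp [h0] at h1
    · intro h0
      rw [h0] at h1
      rcases eq_or_ne C 0 with hC | hC
      · simp [hC] at h1
      · simp [ENNReal.mul_top hC] at h1
  refine ⟨hn, ?_⟩
  rw [h, pn, ENNReal.eq_inv_of_mul_eq_one_left h1]

lemma Normable.map_coproj (h : Normable σ a E) (U : V →ₗᵢ[ℝ] E) :
    Normable σ a V ∧ Measure.map (coproj U) (pn σ a E) = pn σ a V := by
  have := h.isProbabilityMeasure
  have : IsProbabilityMeasure (Measure.map (coproj U) (pn σ a E)) :=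
    Measure.isProbabilityMeasure_map (measurable_coproj U).aemeasurable
  obtain ⟨C, hC⟩ := exists_map_coproj_nu σ a U
  refine pn_eq_of_nu_map (C := (nu σ a E univ)⁻¹ * C) ?_
  rw [pn, Measure.map_smul, hC, smul_smul]

end Projection

section GeneralPosition

variable {E : Type*} [NormedAddCommGroup E] [InnerProductSpace ℝ E] [FiniteDimensional ℝ E]
  [MeasurableSpace E] [BorelSpace E]

/-- A measure which does not charge proper affine subspaces. -/
def NullOnHyperplanes (μ : Measure E) : Prop := ∀ A : AffineSubspace ℝ E, A ≠ ⊤ → μ A = 0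

lemma NullOnHyperplanes.of_ac {μ ν : Measure E} (h : NullOnHyperplanes ν) (h2 : μ ≪ ν) :
    NullOnHyperplanes μ := fun A hA => h2 (h A hA)

lemma nullOnHyperplanes_addHaar (μ : Measure E) [μ.IsAddHaarMeasure] : NullOnHyperplanes μ :=
  fun A hA => Measure.addHaar_affineSubspace μ A hA

lemma isOpen_linearIndependent_sub {ι : Type*} [Finite ι] :
    IsOpen {z : E × (ι → E) | LinearIndependent ℝ fun i => z.2 i - z.1} :=
  isOpen_setOfPred_linearIndependent.preimage (f := fun z : E × (ι → E) => fun i => z.2 i - z.1)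
    (by fun_prop)

lemma ae_linearIndependent_fin (μ : Measure E) [SigmaFinite μ] (hμ : NullOnHyperplanes μ)
    (x0 : E) (m : ℕ) (hm : m ≤ finrank ℝ E) :
    ∀ᵐ x ∂(Measure.pi fun _ : Fin m => μ), LinearIndependent ℝ fun i => x i - x0 := by
  induction m with
  | zero => exact Filter.Eventually.of_forall fun x => linearIndependent_empty_type
  | succ m ih =>
    have mp := (measurePreserving_piFinSuccAbove (fun _ : Fin (m + 1) => μ) 0)
    have hms : MeasurableSet {z : E × (Fin m → E) | LinearIndependent ℝ
        (Fin.cons (z.1 - x0) fun i => z.2 i - x0 : Fin (m + 1) → E)} := by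
      refine (isOpen_setOfPred_linearIndependent.preimage (f := fun z : E × (Fin m → E) =>
        (Fin.cons (z.1 - x0) fun i => z.2 i - x0 : Fin (m + 1) → E)) ?_).measurableSet
      refine continuous_pi fun i => ?_
      refine Fin.cases ?_ (fun j => ?_) i
      · simp only [Fin.cons_zero]; fun_prop
      · simp only [Fin.cons_succ]; fun_prop
    have key : ∀ᵐ z ∂(μ.prod (Measure.pi fun _ : Fin m => μ)), LinearIndependent ℝ
        (Fin.cons (z.1 - x0) fun i => z.2 i - x0 : Fin (m + 1) → E) := by
      rw [ae_iff]
      change μ.prod _ {z : E × (Fin m → E) | LinearIndependent ℝ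
        (Fin.cons (z.1 - x0) fun i => z.2 i - x0 : Fin (m + 1) → E)}ᶜ = 0
      rw [Measure.prod_apply_symm hms.compl, lintegral_eq_zero_iff
        (measurable_measure_prodMk_right hms.compl)]
      filter_upwards [ih (by omega)] with v hv
      simp only [Pi.zero_apply]
      set K := Submodule.span ℝ (range fun i => v i - x0)
      have hK : (AffineSubspace.mk' x0 K) ≠ ⊤ := by
        intro h
        have h2 : (AffineSubspace.mk' x0 K).direction = ⊤ := by
          rw [h, AffineSubspace.direction_top]
        rw [AffineSubspace.direction_mk'] at h2
        have h3 := finrank_span_eq_card hv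
        change finrank ℝ K = _ at h3
        rw [h2, finrank_top, Fintype.card_fin] at h3
        omega
      refine measure_mono_null ?_ (hμ _ hK)
      intro x hx
      simp only [mem_preimage, mem_compl_iff, mem_ofPred_eq, linearIndependent_finCons, not_and,
        not_not] at hx
      exact (AffineSubspace.mem_mk').2 (hx hv)
    have := mp.quasiMeasurePreserving.ae key
    filter_upwards [this] with x hx
    convert! hx using 1
    funext i
    refine Fin.cases ?_ (fun j => ?_) i <;> simp [MeasurableEquiv.piFinSuccAbove, Fin.tail]

lemma ae_linearIndependent_pi {ι : Type*} [Fintype ι] (μ : Measure E) [SigmaFinite μ]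
    (hμ : NullOnHyperplanes μ) (x0 : E) (hm : Fintype.card ι ≤ finrank ℝ E) :
    ∀ᵐ x ∂(Measure.pi fun _ : ι => μ), LinearIndependent ℝ fun i => x i - x0 := by
  have mp := measurePreserving_piCongrLeft (fun _ : Fin (Fintype.card ι) => μ)
    (Fintype.equivFin ι)
  filter_upwards [mp.quasiMeasurePreserving.ae (ae_linearIndependent_fin μ hμ x0 _ hm)] with x hx
  rw [← linearIndependent_equiv (Fintype.equivFin ι)] at hx
  convert! hx using 1
  funext i
  simp [MeasurableEquiv.piCongrLeft, Equiv.piCongrLeft_apply]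

end GeneralPosition

section Merge

variable {E : Type*} [NormedAddCommGroup E] [InnerProductSpace ℝ E] [FiniteDimensional ℝ E]
  [MeasureSpace E] [BorelSpace E] [(volume : Measure E).IsAddHaarMeasure]
variable {V : Type*} [NormedAddCommGroup V] [InnerProductSpace ℝ V] [FiniteDimensional ℝ V]
  [MeasureSpace V] [BorelSpace V] [(volume : Measure V).IsAddHaarMeasure]
variable {ι κ : Type*} [Fintype ι] [Fintype κ]

/-- The joint density of a point `∑ i, c i • e i` and of its translates by the `e i`, at squared
distance `t` from the origin. -/
def jointProfile (σ γ₀ γ t : ℝ) (e : ι → E) (c : ι → ℝ) : ℝ≥0∞ :=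
  profile σ γ₀ (t + ‖∑ j, c j • e j‖ ^ 2) * ∏ i, profile σ γ (t + ‖∑ j, c j • e j + e i‖ ^ 2)

@[fun_prop]
lemma measurable_jointProfile {σ γ₀ γ : ℝ} {X : Type*} [MeasurableSpace X] {t : X → ℝ}
    {e : X → ι → E} {c : X → ι → ℝ} (ht : Measurable t) (he : Measurable e) (hc : Measurable c) :
    Measurable fun x => jointProfile σ γ₀ γ (t x) (e x) (c x) := by
  unfold jointProfile
  fun_prop

lemma jointProfile_eq_zero {σ γ₀ γ t : ℝ} (ht : 0 ≤ t) (h : ¬ 0 < 1 - σ * t) (e : ι → E)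
    (c : ι → ℝ) : jointProfile σ γ₀ γ t e c = 0 := by
  rw [jointProfile, profile_add_eq_zero ht (sq_nonneg _) h, zero_mul]

lemma jointProfile_smul {σ γ₀ γ t : ℝ} (h : 0 < 1 - σ * t) (e : ι → E) (c : ι → ℝ) :
    jointProfile σ γ₀ γ t (√(1 - σ * t) • e) c =
      profile σ (γ₀ + Fintype.card ι * γ) t * jointProfile σ γ₀ γ 0 e c := by
  have h1 : ∑ j, c j • (√(1 - σ * t) • e) j = √(1 - σ * t) • ∑ j, c j • e j := by
    rw [Finset.smul_sum]
    exact Finset.sum_congr rfl fun j _ => by rw [Pi.smul_apply, smul_comm]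
  have h2 : ∀ i, √(1 - σ * t) • ∑ j, c j • e j + (√(1 - σ * t) • e) i =
      √(1 - σ * t) • (∑ j, c j • e j + e i) := fun i => by rw [smul_add, Pi.smul_apply]
  simp only [jointProfile, h1, h2, profile_add_sqrt_smul h, Finset.prod_mul_distrib, zero_add]
  rw [Finset.prod_const, Finset.card_univ, ← profile_pow_mul _ _ _ h]
  ring

lemma lintegral_jointProfile_smul {σ γ₀ γ : ℝ} {R : (ι → E) → ℝ≥0∞} (hR : Measurable R)
    (hRs : ∀ r : ℝ, 0 < r → ∀ e, R (r • e) = R e) (p : V) :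
    ∫⁻ e : ι → E, R e * sliceFactor V e * ∫⁻ c, jointProfile σ γ₀ γ (‖p‖ ^ 2) e c =
      profile σ (γ₀ + Fintype.card ι * γ + (Fintype.card ι * (finrank ℝ E + 1) : ℕ) / 2)
        (‖p‖ ^ 2) *
      ∫⁻ e : ι → E, R e * sliceFactor V e * ∫⁻ c, jointProfile σ γ₀ γ 0 e c := by
  have hsf := measurable_sliceFactor (E := E) V (ι := ι)
  by_cases h : 0 < 1 - σ * ‖p‖ ^ 2
  · rw [lintegral_comp_smul_pos volume (Real.sqrt_pos.2 h), finrank_pi_fintype]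
    simp only [hRs _ (Real.sqrt_pos.2 h), sliceFactor_smul _ (Real.sqrt_pos.2 h),
      jointProfile_smul h, Finset.sum_const, Finset.card_univ, smul_eq_mul]
    have : ∀ e : ι → E, R e * (ENNReal.ofReal (√(1 - σ * ‖p‖ ^ 2) ^ Fintype.card ι) *
        sliceFactor V e) * ∫⁻ c, profile σ (γ₀ + Fintype.card ι * γ) (‖p‖ ^ 2) *
          jointProfile σ γ₀ γ 0 e c =
        (ENNReal.ofReal (√(1 - σ * ‖p‖ ^ 2) ^ Fintype.card ι) *
          profile σ (γ₀ + Fintype.card ι * γ) (‖p‖ ^ 2)) * (R e * sliceFactor V e *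
            ∫⁻ c, jointProfile σ γ₀ γ 0 e c) := by
      intro e
      rw [lintegral_const_mul _ (by fun_prop)]
      ring
    simp only [this]
    rw [lintegral_const_mul, ofReal_sqrt_pow h, ofReal_sqrt_pow h, ← mul_assoc, ← mul_assoc,
      profile_mul_profile, profile_mul_profile]
    · congr 2; push_cast; ring
    · refine (hR.mul hsf).mul ?_
      exact Measurable.lintegral_prod_right' (f := fun z : (ι → E) × (ι → ℝ) =>
        jointProfile σ γ₀ γ 0 z.1 z.2) (by fun_prop)
  · simp only [jointProfile_eq_zero (sq_nonneg _) h, lintegral_zero, mul_zero]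
    rw [profile, if_neg h, zero_mul]

lemma exists_lintegral_merge (σ a₀ a : ℝ) [IsFiniteMeasure (nu σ a E)]
    (hd : finrank ℝ V + Fintype.card ι = finrank ℝ E) {R : (ι → E) → ℝ≥0∞}
    (hR : Measurable R) (hRs : ∀ r : ℝ, 0 < r → ∀ e, R (r • e) = R e) :
    ∃ A : ℝ≥0∞, ∀ (G : E → (ι → E) → ℝ≥0∞) (H : V → ℝ≥0∞), Measurable (Function.uncurry G) →
      Measurable H → (∀ e, LinearIndependent ℝ e → ∀ U : V →ₗᵢ[ℝ] E,
        (∀ p i, inner ℝ (U p) (e i) = 0) → ∀ x, G x e = H (coproj U x)) →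
      ∫⁻ x₀, ∫⁻ x : ι → E, R (fun i => x i - x₀) * G x₀ (fun i => x i - x₀)
        ∂(Measure.pi fun _ => nu σ a E) ∂(nu σ a₀ E) =
        A * ∫⁻ p, H p ∂(nu σ (a₀ + Fintype.card ι * a) V) := by
  have hsf := measurable_sliceFactor (E := E) V (ι := ι)
  set γ₀ := (a₀ - finrank ℝ E) / 2
  set γ := (a - finrank ℝ E) / 2
  refine ⟨∫⁻ e : ι → E, R e * sliceFactor V e * ∫⁻ c, jointProfile σ γ₀ γ 0 e c,
    fun G H hG hH hGH => ?_⟩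
  have hG' : ∀ {X : Type _} [MeasurableSpace X] {f : X → E} {g : X → ι → E}, Measurable f →
      Measurable g → Measurable fun x => G (f x) (g x) := fun hf hg => hG.comp (hf.prodMk hg)
  have hfin : SigmaFinite (volume.withDensity fun x : E => profile σ γ (‖x‖ ^ 2)) := by
    change SigmaFinite (nu σ a E); infer_instance
  have step1 : ∫⁻ x₀, ∫⁻ x : ι → E, R (fun i => x i - x₀) * G x₀ (fun i => x i - x₀)
        ∂(Measure.pi fun _ => nu σ a E) ∂(nu σ a₀ E) =
      ∫⁻ x₀ : E, ∫⁻ e : ι → E, R e * (profile σ γ₀ (‖x₀‖ ^ 2) *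
        (∏ i, profile σ γ (‖x₀ + e i‖ ^ 2)) * G x₀ e) := by
    have hRG : Measurable fun z : E × (ι → E) =>
        R (fun i => z.2 i - z.1) * G z.1 (fun i => z.2 i - z.1) :=
      (hR.comp (by fun_prop)).mul (hG' (by fun_prop) (by fun_prop))
    unfold nu
    rw [pi_withDensity _ _ (by fun_prop), lintegral_withDensity_eq_lintegral_mul _ (by fun_prop)]
    swap
    · refine Measurable.lintegral_prod_right' hRG
    refine lintegral_congr fun x₀ => ?_
    have hx : Measurable fun x : ι → E =>
        R (fun i => x i - x₀) * G x₀ (fun i => x i - x₀) :=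
      (hR.comp (by fun_prop)).mul (hG' (by fun_prop) (by fun_prop))
    simp only [Pi.mul_apply]
    rw [lintegral_withDensity_eq_lintegral_mul _ (by fun_prop) hx, ← volume_pi,
      ← lintegral_add_right_eq_self _ (fun _ : ι => x₀), ← lintegral_const_mul]
    · refine lintegral_congr fun e => ?_
      simp only [Pi.mul_apply, Pi.add_apply, add_sub_cancel_right, add_comm x₀]
      ring
    · simp only [Pi.mul_apply, Pi.add_apply, add_sub_cancel_right]
      have := hG' (measurable_const (a := x₀)) (measurable_id (α := ι → E))
      simp only [id] at this
      have h2 : Measurable fun e : ι → E => R fun i => e i := hR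
      fun_prop
  have step2 : ∀ᵐ e : ι → E, ∫⁻ x₀ : E, R e * (profile σ γ₀ (‖x₀‖ ^ 2) *
        (∏ i, profile σ γ (‖x₀ + e i‖ ^ 2)) * G x₀ e) =
      ∫⁻ p : V, H p * (R e * sliceFactor V e * ∫⁻ c, jointProfile σ γ₀ γ (‖p‖ ^ 2) e c) := by
    have hli := ae_linearIndependent_pi (ι := ι) (volume : Measure E)
      (nullOnHyperplanes_addHaar _) 0 (by omega)
    rw [← volume_pi] at hli
    filter_upwards [hli] with e he
    simp only [sub_zero] at he
    obtain ⟨U, hU⟩ := exists_isometry_orthogonal (V := V) he hd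
    have hGe : Measurable fun x => G x e := hG.comp (measurable_id.prodMk measurable_const)
    rw [lintegral_const_mul _ (by fun_prop), lintegral_slice he hU hd (by fun_prop)]
    simp only [hGH e he U hU, coproj_slice hU]
    have h1 : ∀ (p : V) (c : ι → ℝ), profile σ γ₀ (‖U p + ∑ i, c i • e i‖ ^ 2) *
        (∏ i, profile σ γ (‖U p + ∑ j, c j • e j + e i‖ ^ 2)) =
        jointProfile σ γ₀ γ (‖p‖ ^ 2) e c := by
      intro p c
      classical
      have h2 : ∀ i, ∑ j, c j • e j + e i = ∑ j, (c + Pi.single i (1 : ℝ) : ι → ℝ) j • e j := by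
        intro i
        simp [add_smul, Finset.sum_add_distrib, Pi.single_apply]
      unfold jointProfile
      rw [norm_sq_slice hU]
      congr 1
      refine Finset.prod_congr rfl fun i _ => ?_
      rw [add_assoc, h2, norm_sq_slice hU]
    simp only [h1]
    rw [← mul_assoc, ← lintegral_const_mul]
    · refine lintegral_congr fun p => ?_
      rw [lintegral_mul_const _ (by fun_prop)]
      ring
    · refine Measurable.lintegral_prod_right' (f := fun z : V × (ι → ℝ) =>
        jointProfile σ γ₀ γ (‖z.1‖ ^ 2) e z.2 * H z.1) (by fun_prop)
  rw [step1, lintegral_lintegral_swap, lintegral_congr_ae step2, lintegral_lintegral_swap]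
  · have h1 : ∀ p : V, ∫⁻ e : ι → E, H p * (R e * sliceFactor V e *
        ∫⁻ c, jointProfile σ γ₀ γ (‖p‖ ^ 2) e c) =
        (∫⁻ e : ι → E, R e * sliceFactor V e * ∫⁻ c, jointProfile σ γ₀ γ 0 e c) *
          (profile σ ((a₀ + Fintype.card ι * a - finrank ℝ V) / 2) (‖p‖ ^ 2) * H p) := by
      intro p
      rw [lintegral_const_mul, lintegral_jointProfile_smul hR hRs]
      · have : γ₀ + Fintype.card ι * γ + (Fintype.card ι * (finrank ℝ E + 1) : ℕ) / 2 =
            (a₀ + Fintype.card ι * a - finrank ℝ V) / 2 := by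
          have hd' : (finrank ℝ V : ℝ) + Fintype.card ι = finrank ℝ E := mod_cast hd
          simp only [γ₀, γ]
          push_cast
          rw [← hd']
          ring
        rw [this]
        ring
      · refine (hR.mul hsf).mul ?_
        exact Measurable.lintegral_prod_right' (f := fun z : (ι → E) × (ι → ℝ) =>
          jointProfile σ γ₀ γ (‖p‖ ^ 2) z.1 z.2) (by fun_prop)
    simp only [h1]
    unfold nu
    rw [lintegral_const_mul _ (by fun_prop),
      lintegral_withDensity_eq_lintegral_mul _ (by fun_prop) hH]
    simp only [Pi.mul_apply]
  · have h2 : Measurable fun z : (ι → E) × V => ∫⁻ c, jointProfile σ γ₀ γ (‖z.2‖ ^ 2) z.1 c :=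
      Measurable.lintegral_prod_right' (f := fun z : ((ι → E) × V) × (ι → ℝ) =>
        jointProfile σ γ₀ γ (‖z.1.2‖ ^ 2) z.1.1 z.2) (by fun_prop)
    have h3 : Measurable fun z : (ι → E) × V => R z.1 := hR.comp measurable_fst
    have h4 : Measurable fun z : (ι → E) × V => sliceFactor V z.1 := hsf.comp measurable_fst
    refine Measurable.aemeasurable ?_
    change Measurable fun z : (ι → E) × V => H z.2 * (R z.1 * sliceFactor V z.1 *
      ∫⁻ c, jointProfile σ γ₀ γ (‖z.2‖ ^ 2) z.1 c)
    fun_prop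
  · have h3 : Measurable fun z : E × (ι → E) => R z.2 := hR.comp measurable_snd
    refine Measurable.aemeasurable ?_
    change Measurable fun z : E × (ι → E) => R z.2 * (profile σ γ₀ (‖z.1‖ ^ 2) *
        (∏ i, profile σ γ (‖z.1 + z.2 i‖ ^ 2)) * G z.1 z.2)
    have := hG' (measurable_fst (α := E) (β := ι → E)) measurable_snd
    fun_prop

lemma lintegral_pi_pn {σ a₀ a : ℝ} (ha : Normable σ a E)
    (F : E → (ι → E) → ℝ≥0∞) (hF : Measurable (Function.uncurry F)) :
    ∫⁻ x₀, ∫⁻ x, F x₀ x ∂(Measure.pi fun _ => pn σ a E) ∂(pn σ a₀ E) =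
      ((nu σ a₀ E univ)⁻¹ * (nu σ a E univ)⁻¹ ^ Fintype.card ι) *
        ∫⁻ x₀, ∫⁻ x, F x₀ x ∂(Measure.pi fun _ => nu σ a E) ∂(nu σ a₀ E) := by
  have := ha.isFiniteMeasure_nu
  have hp := ha.isProbabilityMeasure
  have : SigmaFinite ((nu σ a E univ)⁻¹ • nu σ a E) := by
    change SigmaFinite (pn σ a E); infer_instance
  have h : Measurable fun x₀ => ∫⁻ x, F x₀ x ∂(Measure.pi fun _ => nu σ a E) :=
    Measurable.lintegral_prod_right' hF
  unfold pn
  rw [pi_smul_const]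
  simp only [lintegral_smul_measure, smul_eq_mul]
  rw [lintegral_const_mul _ h, mul_assoc]

lemma lintegral_merge_aux {σ a₀ a : ℝ} (h₀ : Normable σ a₀ E) (ha : Normable σ a E)
    (hd : finrank ℝ V + Fintype.card ι = finrank ℝ E) {R : (ι → E) → ℝ≥0∞}
    (hR : Measurable R) (hRs : ∀ r : ℝ, 0 < r → ∀ e, R (r • e) = R e)
    (G : E → (ι → E) → ℝ≥0∞) (H : V → ℝ≥0∞) (hG : Measurable (Function.uncurry G))
    (hH : Measurable H) (hGH : ∀ e, LinearIndependent ℝ e → ∀ U : V →ₗᵢ[ℝ] E,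
        (∀ p i, inner ℝ (U p) (e i) = 0) → ∀ x, G x e = H (coproj U x)) :
    Normable σ (a₀ + Fintype.card ι * a) V ∧
    ∫⁻ x₀, ∫⁻ x : ι → E, R (fun i => x i - x₀) * G x₀ (fun i => x i - x₀)
        ∂(Measure.pi fun _ => pn σ a E) ∂(pn σ a₀ E) =
      (∫⁻ x₀, ∫⁻ x : ι → E, R (fun i => x i - x₀)
        ∂(Measure.pi fun _ => pn σ a E) ∂(pn σ a₀ E)) *
      ∫⁻ p, H p ∂(pn σ (a₀ + Fintype.card ι * a) V) := by
  have := ha.isFiniteMeasure_nu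
  have hp := ha.isProbabilityMeasure
  have hp0 := h₀.isProbabilityMeasure
  have hm : Measurable fun z : E × (ι → E) => (fun i => z.2 i - z.1) := by fun_prop
  have hRm : Measurable fun z : E × (ι → E) => R (fun i => z.2 i - z.1) := hR.comp hm
  have hGm : Measurable fun z : E × (ι → E) => G z.1 (fun i => z.2 i - z.1) :=
    hG.comp (measurable_fst.prodMk hm)
  obtain ⟨A, hA⟩ := exists_lintegral_merge (V := V) σ a₀ a hd hR hRs
  obtain ⟨B, hB⟩ := exists_lintegral_merge (V := V) σ a₀ a hd (R := fun _ : ι → E => 1)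
    measurable_const (fun _ _ _ => rfl)
  have h1 := hB (fun _ _ => 1) (fun _ => 1) measurable_const measurable_const
    (fun _ _ _ _ _ => rfl)
  have h2 := hA (fun _ _ => 1) (fun _ => 1) measurable_const measurable_const
    (fun _ _ _ _ _ => rfl)
  have h3 := hA G H hG hH hGH
  set k := (nu σ a₀ E univ)⁻¹ * (nu σ a E univ)⁻¹ ^ Fintype.card ι
  have p1 := lintegral_pi_pn (ι := ι) (a₀ := a₀) ha (fun _ _ => 1) measurable_const
  have p2 := lintegral_pi_pn (ι := ι) (a₀ := a₀) ha (fun x₀ x => R (fun i => x i - x₀)) hRm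
  have p3 := lintegral_pi_pn (ι := ι) (a₀ := a₀) ha
    (fun x₀ x => R (fun i => x i - x₀) * G x₀ (fun i => x i - x₀)) (hRm.mul hGm)
  simp only [mul_one] at h1 h2
  rw [h1] at p1
  rw [h2] at p2
  rw [h3] at p3
  simp only [lintegral_one, measure_univ] at p1 p2
  have hN : Normable σ (a₀ + Fintype.card ι * a) V := by
    constructor
    · intro h0; simp [h0] at p1
    · intro h0
      rw [h0, ← mul_assoc] at p1
      change 1 = k * B * ∞ at p1
      rcases eq_or_ne (k * B) 0 with hC | hC
      · simp [hC] at p1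
      · simp [ENNReal.mul_top hC] at p1
  refine ⟨hN, ?_⟩
  rw [p3, p2, pn, lintegral_smul_measure, smul_eq_mul]
  set N := nu σ (a₀ + Fintype.card ι * a) V univ
  have : N * N⁻¹ = 1 := ENNReal.mul_inv_cancel hN.1 hN.2
  calc _ = k * (A * ∫⁻ p, H p ∂(nu σ (a₀ + Fintype.card ι * a) V)) * 1 := by rw [mul_one]
    _ = _ := by rw [← this]; ring

lemma Normable.pi_map_coproj {σ a : ℝ} (ha : Normable σ a E) (U : V →ₗᵢ[ℝ] E) :
    Measure.map (fun w : κ → E => coproj U ∘ w) (Measure.pi fun _ => pn σ a E) =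
      Measure.pi fun _ => pn σ a V := by
  obtain ⟨hV, hmap⟩ := ha.map_coproj U
  have hp := ha.isProbabilityMeasure
  have hpV := hV.isProbabilityMeasure
  have : SigmaFinite (Measure.map (coproj U) (pn σ a E)) := by rw [hmap]; infer_instance
  have h := Measure.pi_map_pi (μ := fun _ : κ => pn σ a E) (f := fun _ => coproj U)
    (fun _ => (measurable_coproj U).aemeasurable)
  simp only [hmap] at h
  exact h

/-- Merging: beta-type points `x₀` and `x i` are, as far as their orthogonal complement is
concerned, replaced by a single beta-type point with the summed parameter, which is independent
of the shape of the configuration. -/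
theorem lintegral_merge {σ a₀ a : ℝ} (h₀ : Normable σ a₀ E) (ha : Normable σ a E)
    (hd : finrank ℝ V + Fintype.card ι = finrank ℝ E) {R : (ι → E) → ℝ≥0∞}
    (hR : Measurable R) (hRs : ∀ r : ℝ, 0 < r → ∀ e, R (r • e) = R e)
    (S : E → (ι → E) → (κ → E) → ℝ≥0∞) (S' : V → (κ → V) → ℝ≥0∞)
    (hS : Measurable fun z : (E × (ι → E)) × (κ → E) => S z.1.1 z.1.2 z.2)
    (hS' : Measurable fun z : V × (κ → V) => S' z.1 z.2)
    (hSS : ∀ e, LinearIndependent ℝ e → ∀ U : V →ₗᵢ[ℝ] E,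
        (∀ p i, inner ℝ (U p) (e i) = 0) → ∀ x w, S x e w = S' (coproj U x) (coproj U ∘ w)) :
    Normable σ (a₀ + Fintype.card ι * a) V ∧
    ∫⁻ x₀, ∫⁻ x : ι → E, R (fun i => x i - x₀) * ∫⁻ w, S x₀ (fun i => x i - x₀) w
        ∂(Measure.pi fun _ => pn σ a E) ∂(Measure.pi fun _ => pn σ a E) ∂(pn σ a₀ E) =
      (∫⁻ x₀, ∫⁻ x : ι → E, R (fun i => x i - x₀)
        ∂(Measure.pi fun _ => pn σ a E) ∂(pn σ a₀ E)) *
      ∫⁻ p, ∫⁻ w, S' p w ∂(Measure.pi fun _ => pn σ a V)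
        ∂(pn σ (a₀ + Fintype.card ι * a) V) := by
  have hp := ha.isProbabilityMeasure
  have hV : Normable σ a V := by
    have hli := ae_linearIndependent_pi (ι := ι) (pn σ a E)
      ((nullOnHyperplanes_addHaar _).of_ac ha.pn_ac) 0 (by omega)
    obtain ⟨e, he⟩ := hli.exists
    obtain ⟨U, -⟩ := exists_isometry_orthogonal (V := V) he hd
    exact (ha.map_coproj U).1
  have hpV := hV.isProbabilityMeasure
  refine lintegral_merge_aux h₀ ha hd hR hRs
    (fun x e => ∫⁻ w, S x e w ∂(Measure.pi fun _ => pn σ a E))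
    (fun p => ∫⁻ w, S' p w ∂(Measure.pi fun _ => pn σ a V))
    hS.lintegral_prod_right' hS'.lintegral_prod_right' fun e he U hU x => ?_
  have hm : Measurable fun w : κ → E => coproj U ∘ w :=
    measurable_pi_lambda _ fun i => (measurable_coproj U).comp (measurable_pi_apply i)
  have hS'm : Measurable fun w => S' (coproj U x) w := hS'.comp measurable_prodMk_left
  rw [← ha.pi_map_coproj U, lintegral_map hS'm hm]
  exact lintegral_congr fun w => hSS e he U hU x w

end Merge

section Dependence

variable {E : Type*} [NormedAddCommGroup E] [InnerProductSpace ℝ E] [FiniteDimensional ℝ E]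
variable {V : Type*} [NormedAddCommGroup V] [InnerProductSpace ℝ V] [FiniteDimensional ℝ V]
variable {ι κ τ : Type*} [Fintype ι] [Fintype κ] [Fintype τ] [DecidableEq τ]

/-- There is a linear dependency between the vectors `e` and `u` with positive coefficients
on `u`. -/
def PosDep (e : ι → E) (u : κ → E) : Prop :=
  ∃ (c : ι → ℝ) (l : κ → ℝ), ∑ i, c i • e i + ∑ j, l j • u j = 0 ∧ ∀ j, 0 < l j

/-- There is a linear dependency between the vectors `u` with positive coefficients. -/
def StrictDep (u : κ → E) : Prop := ∃ l : κ → ℝ, ∑ j, l j • u j = 0 ∧ ∀ j, 0 < l j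

lemma posDep_iff_coproj [MeasureSpace E] [BorelSpace E] [(volume : Measure E).IsAddHaarMeasure]
    [MeasureSpace V] [BorelSpace V] [(volume : Measure V).IsAddHaarMeasure]
    {e : ι → E} (he : LinearIndependent ℝ e) {U : V →ₗᵢ[ℝ] E}
    (hU : ∀ p i, inner ℝ (U p) (e i) = 0)
    (hd : finrank ℝ V + Fintype.card ι = finrank ℝ E) (u : κ → E) :
    PosDep e u ↔ StrictDep (coproj U ∘ u) := by
  constructor
  · rintro ⟨c, l, h, hl⟩
    refine ⟨l, ?_, hl⟩
    have h2 := congrArg (coproj U) h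
    have h3 := coproj_slice hU 0 c
    rw [map_zero, zero_add] at h3
    simpa [h3] using h2
  · rintro ⟨l, h, hl⟩
    obtain ⟨z, hz⟩ := (sliceMap_bijective he hU hd).2 (∑ j, l j • u j)
    rw [sliceMap_apply] at hz
    have h2 := coproj_slice hU z.1 z.2
    have h3 : coproj U (∑ j, l j • u j) = 0 := by simpa using h
    rw [hz, h3] at h2
    refine ⟨-z.2, l, ?_, hl⟩
    rw [← hz, ← h2]
    simp

lemma measurableSet_posDep [MeasurableSpace E] [BorelSpace E] :
    MeasurableSet {z : (E × (ι → E)) × (κ → E) | PosDep z.1.2 (fun j => z.2 j - z.1.1)} := by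
  have : SecondCountableTopology E := inferInstance
  have : BorelSpace (ι → E) := inferInstance
  have : BorelSpace (κ → E) := inferInstance
  have : BorelSpace (E × (ι → E)) := inferInstance
  have : SecondCountableTopology (E × (ι → E)) := inferInstance
  have : SecondCountableTopology (κ → E) := inferInstance
  have : OpensMeasurableSpace ((E × (ι → E)) × (κ → E)) := Prod.opensMeasurableSpace
  have := measurableSet_exists_closed_open (X := (E × (ι → E)) × (κ → E))
    (Y := (ι → ℝ) × (κ → ℝ))
    (s := {z | ∑ i, z.2.1 i • z.1.1.2 i + ∑ j, z.2.2 j • (z.1.2 j - z.1.1.1) = 0})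
    (t := {z | ∀ j, 0 < z.2.2 j})
    (isClosed_eq (by fun_prop) continuous_const) (by
      simp only [ofPred_forall]
      exact isOpen_iInter_of_finite fun j => isOpen_lt continuous_const (by fun_prop))
  convert! this using 1
  ext z
  simp [PosDep]

lemma measurableSet_strictDep [MeasurableSpace E] [BorelSpace E] :
    MeasurableSet {z : E × (κ → E) | StrictDep (fun j => z.2 j - z.1)} := by
  have := measurableSet_exists_closed_open (X := E × (κ → E)) (Y := κ → ℝ)
    (s := {z | ∑ j, z.2 j • (z.1.2 j - z.1.1) = 0}) (t := {z | ∀ j, 0 < z.2 j})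
    (isClosed_eq (by fun_prop) continuous_const) (by
      simp only [ofPred_forall]
      exact isOpen_iInter_of_finite fun j => isOpen_lt continuous_const (by fun_prop))
  convert! this using 1

/-- Every family obtained by omitting one of the vectors is linearly independent. -/
def GenPos (y : τ → E) : Prop := ∀ j₀, LinearIndependent ℝ fun j : {j // j ≠ j₀} => y j.1

lemma GenPos.eq_zero {y : τ → E} (h : GenPos y) {l : τ → ℝ} (hl : ∑ j, l j • y j = 0) {j₀ : τ}
    (h0 : l j₀ = 0) : l = 0 := by
  have h1 : ∑ j : {j // j ≠ j₀}, l j • y j = 0 := by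
    rw [Fintype.sum_eq_add_sum_subtype_ne _ j₀, h0, zero_smul, zero_add] at hl
    exact hl
  have h2 := Fintype.linearIndependent_iff.1 (h j₀) (fun j => l j) h1
  funext j
  by_cases hj : j = j₀
  · rw [hj, h0]; rfl
  · exact h2 ⟨j, hj⟩

lemma GenPos.span_eq_top {y : τ → E} (h : GenPos y) (hd : finrank ℝ E + 1 = Fintype.card τ) :
    Submodule.span ℝ (range y) = ⊤ := by
  have : 0 < Fintype.card τ := by omega
  obtain ⟨j₀⟩ := Fintype.card_pos_iff.1 this
  have h2 := (h j₀).span_eq_top_of_card_eq_finrank' (by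
    rw [Fintype.card_subtype_compl, Fintype.card_subtype_eq]; omega)
  rw [eq_top_iff, ← h2]
  refine Submodule.span_mono ?_
  rintro _ ⟨j, rfl⟩
  exact mem_range_self _

lemma exists_dependency (y : τ → E) (hd : finrank ℝ E + 1 = Fintype.card τ) :
    ∃ l : τ → ℝ, ∑ j, l j • y j = 0 ∧ l ≠ 0 := by
  have : ¬ LinearIndependent ℝ y := fun h => by
    have := h.fintype_card_le_finrank
    omega
  rw [Fintype.linearIndependent_iff] at this
  push Not at this
  obtain ⟨l, h1, i, hi⟩ := this
  exact ⟨l, h1, fun h => hi (by rw [h]; rfl)⟩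

/-- Positive dependency on the complement of a set of indices. -/
def PosDepOff (B : Finset τ) (y : τ → E) : Prop :=
  PosDep (fun j : {j // j ∈ B} => y j) (fun j : {j // j ∉ B} => y j)

lemma posDepOff_iff (B : Finset τ) (y : τ → E) :
    PosDepOff B y ↔ ∃ l : τ → ℝ, ∑ j, l j • y j = 0 ∧ ∀ j ∉ B, 0 < l j := by
  constructor
  · rintro ⟨c, l, h, hl⟩
    refine ⟨fun j => if hj : j ∈ B then c ⟨j, hj⟩ else l ⟨j, hj⟩, ?_, fun j hj => ?_⟩
    · rw [← h, ← Fintype.sum_subtype_add_sum_subtype (fun j => j ∈ B)]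
      congr 1
      · refine Finset.sum_congr (by ext; simp) fun j _ => ?_
        dsimp only
        rw [dif_pos j.2]
      · refine Finset.sum_congr (by ext; simp) fun j _ => ?_
        dsimp only
        rw [dif_neg j.2]
    · dsimp only
      rw [dif_neg hj]; exact hl _
  · rintro ⟨l, h, hl⟩
    refine ⟨fun j => l j, fun j => l j, ?_, fun j => hl j j.2⟩
    rw [← h, ← Fintype.sum_subtype_add_sum_subtype (fun j => j ∈ B)]
    congr 1
    exact Finset.sum_congr (by ext; simp) fun j _ => rfl

lemma GenPos.posDepOff_iff {y : τ → E} (h : GenPos y) {l : τ → ℝ} (hl : ∑ j, l j • y j = 0)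
    (h0 : l ≠ 0) (B : Finset τ) (hB : ∃ j, j ∉ B) :
    PosDepOff B y ↔ (∀ j ∉ B, 0 < l j) ∨ (∀ j ∉ B, l j < 0) := by
  rw [BetaAngles.posDepOff_iff]
  constructor
  · rintro ⟨m, hm, hp⟩
    obtain ⟨j₀, hj₀⟩ := hB
    have hne : l j₀ ≠ 0 := fun h1 => h0 (h.eq_zero hl h1)
    have key : m - (m j₀ / l j₀) • l = 0 := by
      refine h.eq_zero (j₀ := j₀) ?_ ?_
      · simp only [Pi.sub_apply, Pi.smul_apply, smul_eq_mul, sub_smul, Finset.sum_sub_distrib, hm,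
          mul_smul, ← Finset.smul_sum, hl, smul_zero, sub_zero]
      · simp [hne]
    have key2 : ∀ j, m j = m j₀ / l j₀ * l j := fun j => by
      have := congrFun key j
      simp only [Pi.sub_apply, Pi.smul_apply, smul_eq_mul, Pi.zero_apply] at this
      linarith
    rcases lt_or_gt_of_ne hne with hneg | hpos
    · right
      intro j hj
      have h1 := hp j hj
      rw [key2] at h1
      exact neg_of_mul_pos_right h1 (div_neg_of_pos_of_neg (hp _ hj₀) hneg).le
    · left
      intro j hj
      have h1 := hp j hj
      rw [key2] at h1
      exact pos_of_mul_pos_right h1 (div_pos (hp _ hj₀) hpos).le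
  · rintro (h1 | h1)
    · exact ⟨l, hl, h1⟩
    · exact ⟨-l, by simp [hl], fun j hj => by simpa using h1 j hj⟩

open Classical in
lemma prod_sub_indicator_eq_zero {y : τ → E} (h : GenPos y)
    (hd : finrank ℝ E + 1 = Fintype.card τ) {l : τ → ℝ} (hl : ∑ j, l j • y j = 0) (h0 : l ≠ 0)
    {v : E} (hv : v ≠ 0) :
    ∏ j, ((if inner ℝ v (y j) < 0 then (1 : ℝ) else 0) + -(if 0 < l j then 1 else 0)) = 0 := by
  by_contra hne
  rw [← ne_eq, Finset.prod_ne_zero_iff] at hne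
  have hsum : ∑ j, l j * inner ℝ v (y j) = 0 := by
    have := congrArg (inner ℝ v) hl
    simpa [inner_sum, inner_smul_right] using this
  have hcase : ∀ j, (inner ℝ v (y j) < 0 ∧ l j < 0) ∨ (0 ≤ inner ℝ v (y j) ∧ 0 < l j) := by
    intro j
    have h1 := hne j (Finset.mem_univ j)
    have h2 : l j ≠ 0 := fun h1 => h0 (h.eq_zero hl h1)
    by_cases hi : inner ℝ v (y j) < 0
    · left
      refine ⟨hi, lt_of_le_of_ne (not_lt.1 fun hlt => h1 ?_) h2⟩
      simp [hi, hlt]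
    · right
      refine ⟨not_lt.1 hi, lt_of_le_of_ne (not_lt.1 fun hlt => h1 ?_) h2.symm⟩
      simp [hi, hlt.le]
  have hnn : ∀ j ∈ Finset.univ, 0 ≤ l j * inner ℝ v (y j) := fun j _ => by
    rcases hcase j with ⟨h1, h2⟩ | ⟨h1, h2⟩
    · exact (mul_pos_of_neg_of_neg h2 h1).le
    · positivity
  have hz := (Finset.sum_eq_zero_iff_of_nonneg hnn).1 hsum
  have horth : ∀ j, inner ℝ v (y j) = 0 := fun j => by
    have h2 : l j ≠ 0 := fun h1 => h0 (h.eq_zero hl h1)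
    exact (mul_eq_zero.1 (hz j (Finset.mem_univ j))).resolve_left h2
  have hmem : v ∈ (Submodule.span ℝ (range y))ᗮ := by
    rw [Submodule.mem_orthogonal']
    intro u hu
    induction hu using Submodule.span_induction with
    | mem x hx => obtain ⟨j, rfl⟩ := hx; exact horth j
    | zero => simp
    | add x z _ _ hx hz => rw [inner_add_right, hx, hz, add_zero]
    | smul c x _ hx => rw [inner_smul_right, hx, mul_zero]
  rw [h.span_eq_top hd, Submodule.top_orthogonal_eq_bot] at hmem
  exact hv hmem

open Classical in
/-- The pointwise relation behind the angle-sum relations. -/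
theorem sum_posDepOff_eq_zero {y : τ → E} (h : GenPos y)
    (hd : finrank ℝ E + 1 = Fintype.card τ) {v : E} (hv : v ≠ 0) :
    ∑ B : Finset τ, (-1 : ℝ) ^ (Fintype.card τ - B.card) * (if B = Finset.univ then 2 else 1) *
      (if (∀ j ∈ B, inner ℝ v (y j) < 0) ∧ PosDepOff B y then 1 else 0) = 0 := by
  obtain ⟨l, hl, h0⟩ := exists_dependency y hd
  have h1 := prod_sub_indicator_eq_zero h hd hl h0 hv
  have h2 := prod_sub_indicator_eq_zero h hd (l := -l) (by simp [hl]) (neg_ne_zero.2 h0) hv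
  rw [Finset.prod_add] at h1 h2
  have h3 := congrArg₂ (· + ·) h1 h2
  simp only [add_zero, ← Finset.sum_add_distrib] at h3
  refine Eq.trans ?_ h3
  rw [Finset.powerset_univ]
  refine Finset.sum_congr rfl fun B _ => ?_
  have hneg : ∀ m : τ → ℝ, ∏ j ∈ Finset.univ \ B, -(if 0 < m j then (1 : ℝ) else 0) =
      (-1) ^ (Fintype.card τ - B.card) * (if ∀ j ∉ B, 0 < m j then 1 else 0) := by
    intro m
    rw [Finset.prod_neg, Finset.card_sdiff_of_subset (Finset.subset_univ _), Finset.card_univ,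
      Finset.prod_ite_zero]
    simp
  rw [hneg, hneg, Finset.prod_ite_zero, Finset.prod_const_one]
  by_cases hin : ∀ j ∈ B, inner ℝ v (y j) < 0
  swap
  · simp [hin]
  by_cases hB : B = Finset.univ
  · subst hB
    have : PosDepOff Finset.univ y := (BetaAngles.posDepOff_iff _ _).2 ⟨0, by simp, by simp⟩
    rw [if_pos rfl, if_pos ⟨hin, this⟩, if_pos hin]
    simp
    norm_num
  · have hB' : ∃ j, j ∉ B := by
      by_contra hcon
      push Not at hcon
      exact hB (Finset.eq_univ_iff_forall.2 hcon)
    simp only [h.posDepOff_iff hl h0 B hB', if_neg hB, Pi.neg_apply, Left.neg_pos_iff]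
    have hexcl : ¬ ((∀ j ∉ B, 0 < l j) ∧ (∀ j ∉ B, l j < 0)) := by
      rintro ⟨h4, h5⟩
      obtain ⟨j, hj⟩ := hB'
      exact lt_asymm (h4 j hj) (h5 j hj)
    by_cases h4 : ∀ j ∉ B, 0 < l j
    · have h5 : ¬ ∀ j ∉ B, l j < 0 := fun h5 => hexcl ⟨h4, h5⟩
      rw [if_pos h4, if_neg h5, if_pos ⟨hin, Or.inl h4⟩, if_pos hin]; ring
    · by_cases h5 : ∀ j ∉ B, l j < 0
      · rw [if_neg h4, if_pos h5, if_pos ⟨hin, Or.inr h5⟩, if_pos hin]; ring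
      · rw [if_neg h4, if_neg h5, if_neg (fun h6 => h6.2.elim h4 h5)]; ring

end Dependence

section Relation

variable {E : Type*} [NormedAddCommGroup E] [InnerProductSpace ℝ E] [FiniteDimensional ℝ E]
  [MeasureSpace E] [BorelSpace E] [(volume : Measure E).IsAddHaarMeasure]
variable {ι κ τ : Type*} [Fintype ι] [Fintype κ] [Fintype τ] [DecidableEq τ]
variable {σ a₀ a : ℝ}

open Classical in
/-- The probability that `r` points in `ℝ^(r-1)` and an additional point with another
parameter are such that the latter is in positive dependency with the former. -/
def simplexProb (σ a₀ a : ℝ) (r : ℕ) : ℝ≥0∞ :=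
  ∫⁻ p, ∫⁻ w : Fin r → EuclideanSpace ℝ (Fin (r - 1)),
    (if StrictDep (fun j => w j - p) then 1 else 0)
    ∂(Measure.pi fun _ => pn σ a _) ∂(pn σ a₀ (EuclideanSpace ℝ (Fin (r - 1))))

/-- The probability that `b` points on the real line lie to the left of an additional point with
another parameter. -/
def leftProb (σ a₀ a : ℝ) (b : ℕ) : ℝ≥0∞ :=
  ∫⁻ t, (pn σ a ℝ (Iio t)) ^ b ∂(pn σ a₀ ℝ)

lemma StrictDep.comp_equiv {u : κ → E} (h : StrictDep u) (f : ι ≃ κ) :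
    StrictDep (u ∘ f) := by
  obtain ⟨l, hl, hp⟩ := h
  refine ⟨l ∘ f, ?_, fun j => hp _⟩
  rw [← hl]
  exact f.sum_comp fun j => l j • u j

open Classical in
lemma lintegral_strictDep_reindex (p : E) (f : ι ≃ κ) [SigmaFinite (pn σ a E)] :
    ∫⁻ w : κ → E, (if StrictDep (fun j => w j - p) then (1 : ℝ≥0∞) else 0)
      ∂(Measure.pi fun _ => pn σ a E) =
    ∫⁻ w : ι → E, (if StrictDep (fun j => w j - p) then (1 : ℝ≥0∞) else 0)
      ∂(Measure.pi fun _ => pn σ a E) := by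
  have mp := measurePreserving_piCongrLeft (fun _ : κ => pn σ a E) f
  rw [← mp.lintegral_comp_emb (MeasurableEquiv.measurableEmbedding _)]
  refine lintegral_congr fun w => ?_
  have h1 : ∀ i, MeasurableEquiv.piCongrLeft (fun _ => E) f w (f i) = w i := fun i => by
    simp [MeasurableEquiv.piCongrLeft]
  refine if_congr ⟨fun h => ?_, fun h => ?_⟩ rfl rfl
  · have := h.comp_equiv f
    convert! this using 1
    funext i
    simp [h1]
  · have := h.comp_equiv f.symm
    convert! this using 1
    funext i
    obtain ⟨k, rfl⟩ := f.surjective i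
    simp [h1]

open Classical in
lemma lintegral_strictDep_eq [SigmaFinite (pn σ a
    (EuclideanSpace ℝ (Fin (Fintype.card κ - 1))))] :
    ∫⁻ p, ∫⁻ w : κ → EuclideanSpace ℝ (Fin (Fintype.card κ - 1)),
      (if StrictDep (fun j => w j - p) then (1 : ℝ≥0∞) else 0)
      ∂(Measure.pi fun _ => pn σ a _) ∂(pn σ a₀ _) = simplexProb σ a₀ a (Fintype.card κ) :=
  lintegral_congr fun p => lintegral_strictDep_reindex p (Fintype.equivFin κ).symm

lemma coproj_toSpanSingleton {v : E} (hv : ‖v‖ = 1) (x : E) :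
    coproj (LinearIsometry.toSpanSingleton ℝ E hv) x = inner ℝ v x := by
  have : inner ℝ (1 : ℝ) (coproj (LinearIsometry.toSpanSingleton ℝ E hv) x) = inner ℝ v x := by
    rw [coproj, LinearMap.adjoint_inner_right]
    simp
  simpa using this

open Classical in
lemma lintegral_left (h₀ : Normable σ a₀ E) (ha : Normable σ a E) {v : E} (hv : ‖v‖ = 1) :
    ∫⁻ x₀, ∫⁻ x : ι → E, (if ∀ i, inner ℝ v (x i - x₀) < 0 then (1 : ℝ≥0∞) else 0)
      ∂(Measure.pi fun _ => pn σ a E) ∂(pn σ a₀ E) = leftProb σ a₀ a (Fintype.card ι) := by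
  have hp := ha.isProbabilityMeasure
  set U := LinearIsometry.toSpanSingleton ℝ E hv
  have hU : ∀ x, coproj U x = inner ℝ v x := coproj_toSpanSingleton hv
  have hanti : Monotone fun t => pn σ a ℝ (Iio t) := fun s t h =>
    measure_mono (Iio_subset_Iio h)
  rw [leftProb, ← (h₀.map_coproj U).2,
    lintegral_map (hanti.measurable.pow_const _) (measurable_coproj U)]
  refine lintegral_congr fun x₀ => ?_
  rw [← (ha.map_coproj U).2, Measure.map_apply (measurable_coproj U) measurableSet_Iio]
  have h1 : ∀ x : ι → E, (if ∀ i, inner ℝ v (x i - x₀) < 0 then (1 : ℝ≥0∞) else 0) =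
      (univ.pi fun _ => coproj U ⁻¹' Iio (coproj U x₀)).indicator 1 x := fun x => by
    simp [indicator_apply, hU, inner_sub_right]
  simp_rw [h1]
  rw [lintegral_indicator_one (MeasurableSet.univ_pi fun _ =>
    measurable_coproj U measurableSet_Iio), Measure.pi_pi]
  simp

open Classical in
lemma lintegral_cone_posDepOff (h₀ : Normable σ a₀ E) (ha : Normable σ a E) {K : Set E}
    (hK : MeasurableSet K) (hKs : ∀ r : ℝ, 0 < r → ∀ x, r • x ∈ K ↔ x ∈ K)
    (hd : finrank ℝ E + 1 = Fintype.card τ) (B : Finset τ) (hB : B ≠ Finset.univ) :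
    ∫⁻ x₀, ∫⁻ x : τ → E, (if (∀ j ∈ B, x j - x₀ ∈ K) ∧
        PosDepOff B (fun j => x j - x₀) then (1 : ℝ≥0∞) else 0)
      ∂(Measure.pi fun _ => pn σ a E) ∂(pn σ a₀ E) =
    (∫⁻ x₀, ∫⁻ x : {j // j ∈ B} → E, (if ∀ j, x j - x₀ ∈ K then (1 : ℝ≥0∞) else 0)
      ∂(Measure.pi fun _ => pn σ a E) ∂(pn σ a₀ E)) *
      simplexProb σ (a₀ + B.card * a) a (Fintype.card τ - B.card) := by
  have hp := ha.isProbabilityMeasure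
  have hcard : B.card < Fintype.card τ := (Finset.card_lt_iff_ne_univ B).2 hB
  have hι : Fintype.card {j // j ∈ B} = B.card := Fintype.card_coe B
  have hκ : Fintype.card {j // j ∉ B} = Fintype.card τ - B.card := by
    rw [Fintype.card_subtype_compl, Fintype.card_coe]
  set V := EuclideanSpace ℝ (Fin (Fintype.card {j // j ∉ B} - 1))
  have hdV : finrank ℝ V + Fintype.card {j // j ∈ B} = finrank ℝ E := by
    rw [finrank_euclideanSpace_fin]; omega
  let R : ({j // j ∈ B} → E) → ℝ≥0∞ := fun e => if ∀ j, e j ∈ K then 1 else 0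
  let S : E → ({j // j ∈ B} → E) → ({j // j ∉ B} → E) → ℝ≥0∞ :=
    fun x e w => if PosDep e (fun j => w j - x) then 1 else 0
  let S' : V → ({j // j ∉ B} → V) → ℝ≥0∞ :=
    fun p w => if StrictDep (fun j => w j - p) then 1 else 0
  have hR : Measurable R := by
    refine Measurable.ite ?_ measurable_const measurable_const
    simp only [ofPred_forall]
    exact MeasurableSet.iInter fun j => measurable_pi_apply j hK
  have hRs : ∀ r : ℝ, 0 < r → ∀ e, R (r • e) = R e := fun r hr e => by
    exact if_congr (forall_congr' fun j => hKs r hr _) rfl rfl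
  have hS : Measurable fun z : (E × ({j // j ∈ B} → E)) × ({j // j ∉ B} → E) =>
      if PosDep z.1.2 (fun j => z.2 j - z.1.1) then (1 : ℝ≥0∞) else 0 :=
    Measurable.ite measurableSet_posDep measurable_const measurable_const
  have hS' : Measurable fun z : V × ({j // j ∉ B} → V) => S' z.1 z.2 :=
    Measurable.ite measurableSet_strictDep measurable_const measurable_const
  obtain ⟨hV, hmerge⟩ := lintegral_merge h₀ ha hdV hR hRs S S' hS hS' fun e he U hU x w => by
    refine if_congr ?_ rfl rfl
    rw [posDep_iff_coproj he hU hdV]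
    have : (coproj U ∘ fun j => w j - x) = fun j => (coproj U ∘ w) j - coproj U x := by
      funext j; simp
    rw [this]
  have hVa : Normable σ a V := by
    have hli := ae_linearIndependent_pi (ι := {j // j ∈ B}) (pn σ a E)
      ((nullOnHyperplanes_addHaar _).of_ac ha.pn_ac) 0 (by omega)
    obtain ⟨e, he⟩ := hli.exists
    obtain ⟨U, -⟩ := exists_isometry_orthogonal (V := V) he hdV
    exact (ha.map_coproj U).1
  have hpV := hVa.isProbabilityMeasure
  rw [← hκ, ← lintegral_strictDep_eq (σ := σ) (a := a) (κ := {j // j ∉ B}), ← hι]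
  refine Eq.trans (lintegral_congr fun x₀ => ?_) hmerge
  have mp := measurePreserving_piEquivPiSubtypeProd (fun _ : τ => pn σ a E) (fun j => j ∈ B)
  have hSx : Measurable fun z : ({j // j ∈ B} → E) × ({j // j ∉ B} → E) =>
      S x₀ (fun j => z.1 j - x₀) z.2 := by
    have hf : Measurable fun z : ({j // j ∈ B} → E) × ({j // j ∉ B} → E) =>
        (((x₀, fun j => z.1 j - x₀), z.2) : (E × ({j // j ∈ B} → E)) × ({j // j ∉ B} → E)) := by
      fun_prop
    exact hS.comp hf
  have hRx : Measurable fun z : ({j // j ∈ B} → E) × ({j // j ∉ B} → E) =>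
      R (fun j => z.1 j - x₀) := hR.comp (by fun_prop)
  calc _ = ∫⁻ x, (fun z : ({j // j ∈ B} → E) × ({j // j ∉ B} → E) =>
            R (fun j => z.1 j - x₀) * S x₀ (fun j => z.1 j - x₀) z.2)
            (MeasurableEquiv.piEquivPiSubtypeProd (fun _ => E) (fun j => j ∈ B) x)
            ∂(Measure.pi fun _ => pn σ a E) := by
        refine lintegral_congr fun x => ?_
        have h1 : (∀ j ∈ B, x j - x₀ ∈ K) ↔ ∀ j : {j // j ∈ B}, x j - x₀ ∈ K := by simp
        simp only [R, S, ite_mul, one_mul, zero_mul, ite_and, h1]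
        rfl
    _ = _ := by
        refine (mp.lintegral_comp (hRx.mul hSx)).trans ?_
        refine Eq.trans ?_ (lintegral_prod (μ := Measure.pi fun _ : {j // j ∈ B} => pn σ a E)
          (ν := Measure.pi fun _ : {j // j ∉ B} => pn σ a E) _
          (hRx.mul hSx).aemeasurable) |>.trans ?_
        · congr!
        refine lintegral_congr fun x => ?_
        have hm : Measurable fun w => S x₀ (fun j => x j - x₀) w :=
          hSx.comp measurable_prodMk_left
        simp only [Pi.mul_apply]
        rw [lintegral_const_mul _ hm]

open Classical in
lemma lintegral_left_posDepOff (h₀ : Normable σ a₀ E) (ha : Normable σ a E) {v : E}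
    (hv : ‖v‖ = 1) (hd : finrank ℝ E + 1 = Fintype.card τ) (B : Finset τ)
    (hB : B ≠ Finset.univ) :
    ∫⁻ x₀, ∫⁻ x : τ → E, (if (∀ j ∈ B, inner ℝ v (x j - x₀) < 0) ∧
        PosDepOff B (fun j => x j - x₀) then (1 : ℝ≥0∞) else 0)
      ∂(Measure.pi fun _ => pn σ a E) ∂(pn σ a₀ E) =
    leftProb σ a₀ a B.card *
      simplexProb σ (a₀ + B.card * a) a (Fintype.card τ - B.card) := by
  have hι : Fintype.card {j // j ∈ B} = B.card := Fintype.card_coe B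
  rw [← hι, ← lintegral_left h₀ ha hv, hι]
  refine lintegral_cone_posDepOff h₀ ha (K := {y | inner ℝ v y < 0})
    (measurableSet_lt (by fun_prop) measurable_const) (fun r hr x => ?_) hd B hB
  rw [mem_ofPred_eq, mem_ofPred_eq, inner_smul_right, mul_neg_iff]
  simp [hr, hr.not_gt]

open Classical in
lemma lintegral_posDepOff (h₀ : Normable σ a₀ E) (ha : Normable σ a E)
    (hd : finrank ℝ E + 1 = Fintype.card τ) (B : Finset τ) (hB : B ≠ Finset.univ) :
    ∫⁻ x₀, ∫⁻ x : τ → E, (if PosDepOff B (fun j => x j - x₀) then (1 : ℝ≥0∞) else 0)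
      ∂(Measure.pi fun _ => pn σ a E) ∂(pn σ a₀ E) =
    simplexProb σ (a₀ + B.card * a) a (Fintype.card τ - B.card) := by
  have hp := ha.isProbabilityMeasure
  have hp₀ := h₀.isProbabilityMeasure
  simpa using lintegral_cone_posDepOff h₀ ha MeasurableSet.univ (by simp) hd B hB

lemma ae_genPos (ha : Normable σ a E) (hd : finrank ℝ E + 1 = Fintype.card τ) (x₀ : E) :
    ∀ᵐ x ∂(Measure.pi fun _ : τ => pn σ a E), GenPos fun j => x j - x₀ := by
  have hp := ha.isProbabilityMeasure
  unfold GenPos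
  rw [ae_all_iff]
  intro j₀
  have mp := measurePreserving_piEquivPiSubtypeProd (fun _ : τ => pn σ a E) (fun j => j ≠ j₀)
  have h1 := ae_linearIndependent_pi (ι := {j // j ≠ j₀}) (pn σ a E)
      ((nullOnHyperplanes_addHaar _).of_ac ha.pn_ac) x₀ (by
        rw [Fintype.card_subtype_compl, Fintype.card_subtype_eq]; omega)
  have h2 := (Measure.quasiMeasurePreserving_fst.comp mp.quasiMeasurePreserving).ae h1
  filter_upwards [h2] with x hx
  exact hx

lemma measurableSet_genPos : MeasurableSet {z : E × (τ → E) | GenPos fun j => z.2 j - z.1} := by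
  have : {z : E × (τ → E) | GenPos fun j => z.2 j - z.1} =
    ⋂ j₀ : τ, (fun z : E × (τ → E) => (z.1, fun j : {j // j ≠ j₀} => z.2 j)) ⁻¹'
      {z | LinearIndependent ℝ fun i => z.2 i - z.1} := by
    ext z; simp [GenPos]
  rw [this]
  exact MeasurableSet.iInter fun j₀ =>
    (isOpen_linearIndependent_sub.preimage (by fun_prop)).measurableSet

lemma measurableSet_left_posDepOff (v : E) (B : Finset τ) :
    MeasurableSet {z : E × (τ → E) | (∀ j ∈ B, inner ℝ v (z.2 j - z.1) < 0) ∧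
      PosDepOff B (fun j => z.2 j - z.1)} := by
  have hf : Measurable fun z : E × (τ → E) => (((z.1, fun j => z.2 j - z.1), fun j => z.2 j) :
    (E × ({j // j ∈ B} → E)) × ({j // j ∉ B} → E)) := by fun_prop
  have := hf measurableSet_posDep
  refine MeasurableSet.inter (s₁ := {z | ∀ j ∈ B, inner ℝ v (z.2 j - z.1) < 0}) ?_ this
  have h2 : MeasurableSet (⋂ j, ⋂ _ : j ∈ B,
      {z : E × (τ → E) | inner ℝ v (z.2 j - z.1) < 0}) :=
    MeasurableSet.iInter fun j => MeasurableSet.iInter fun _ =>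
      measurableSet_lt (by fun_prop) measurable_const
  convert! h2 using 1
  ext z
  simp

open Classical in
theorem sum_leftProb_simplexProb_eq_zero (h₀ : Normable σ a₀ E) (ha : Normable σ a E)
    (hd : finrank ℝ E + 1 = Fintype.card τ) (hE : 0 < finrank ℝ E) :
    ∑ B : Finset τ, (-1 : ℝ) ^ (Fintype.card τ - B.card) * (leftProb σ a₀ a B.card).toReal *
      (if B = Finset.univ then 2 else
        (simplexProb σ (a₀ + B.card * a) a (Fintype.card τ - B.card)).toReal) = 0 := by
  have : Nontrivial E := finrank_pos_iff.1 hE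
  obtain ⟨v, hv⟩ := exists_norm_eq E (zero_le_one (α := ℝ))
  have hv0 : v ≠ 0 := by rintro rfl; simp at hv
  have hp := ha.isProbabilityMeasure
  have hp₀ := h₀.isProbabilityMeasure
  set μ := (pn σ a₀ E).prod (Measure.pi fun _ : τ => pn σ a E)
  let A : Finset τ → Set (E × (τ → E)) := fun B => {z | (∀ j ∈ B, inner ℝ v (z.2 j - z.1) < 0) ∧
      PosDepOff B (fun j => z.2 j - z.1)}
  have hA : ∀ B, MeasurableSet (A B) := measurableSet_left_posDepOff v
  have hμA : ∀ B, μ (A B) = ∫⁻ x₀, ∫⁻ x : τ → E, (if (∀ j ∈ B, inner ℝ v (x j - x₀) < 0) ∧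
        PosDepOff B (fun j => x j - x₀) then (1 : ℝ≥0∞) else 0)
      ∂(Measure.pi fun _ => pn σ a E) ∂(pn σ a₀ E) := fun B => by
    rw [← lintegral_indicator_one (hA B),
      lintegral_prod _ (measurable_one.indicator (hA B)).aemeasurable]
    simp only [indicator_apply, A, mem_ofPred_eq, Pi.one_apply]
  have hterm : ∀ B : Finset τ, (leftProb σ a₀ a B.card).toReal *
      (if B = Finset.univ then 2 else
        (simplexProb σ (a₀ + B.card * a) a (Fintype.card τ - B.card)).toReal) =
      (if B = Finset.univ then 2 else 1) * ∫ z, (A B).indicator 1 z ∂μ := fun B => by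
    rw [integral_indicator_one (hA B), Measure.real, hμA]
    split_ifs with hB
    · have h1 : ∀ y : τ → E, PosDepOff B y := fun y =>
        (BetaAngles.posDepOff_iff _ _).2 ⟨0, by simp, by simp [hB]⟩
      have h2 := lintegral_left (ι := τ) h₀ ha hv
      rw [hB, Finset.card_univ, ← h2, mul_comm]
      simp only [← hB, h1, and_true]
      simp [hB]
    · rw [lintegral_left_posDepOff h₀ ha hv hd B hB, ENNReal.toReal_mul, one_mul]
  simp_rw [mul_assoc, hterm, ← integral_const_mul]
  rw [← integral_finsetSum]
  · refine integral_eq_zero_of_ae ?_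
    have hgen : ∀ᵐ z ∂μ, GenPos fun j => z.2 j - z.1 := by
      exact (Measure.ae_prod_iff_ae_ae measurableSet_genPos).2
        (ae_of_all _ fun x₀ => ae_genPos ha hd x₀)
    filter_upwards [hgen] with z hz
    have := sum_posDepOff_eq_zero hz hd hv0
    simp only [Pi.zero_apply]
    rw [← this]
    refine Finset.sum_congr rfl fun B _ => ?_
    simp [indicator_apply, A]
  · intro B _
    exact (((integrable_const (1 : ℝ)).indicator (hA B)).const_mul _).const_mul _

end Relation

section Normable

variable {E : Type*} [NormedAddCommGroup E] [InnerProductSpace ℝ E] [FiniteDimensional ℝ E]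
  [MeasureSpace E] [BorelSpace E] [(volume : Measure E).IsAddHaarMeasure]

lemma nu_univ (σ a : ℝ) : nu σ a E univ =
    ∫⁻ x : E, profile σ ((a - finrank ℝ E) / 2) (‖x‖ ^ 2) := by
  rw [nu, withDensity_apply _ MeasurableSet.univ, Measure.restrict_univ]

lemma nu_univ_ne_zero {σ : ℝ} (hσ : σ ≤ 1) (a : ℝ) : nu σ a E univ ≠ 0 := by
  rw [nu_univ]
  intro h
  rw [lintegral_eq_zero_iff (by fun_prop)] at h
  have h1 : volume (Metric.ball (0 : E) 1) = 0 := by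
    refine measure_mono_null (fun x hx => ?_) (ae_iff.1 h)
    rw [mem_ball_zero_iff] at hx
    have h2 : 0 < 1 - σ * ‖x‖ ^ 2 := by nlinarith [norm_nonneg x]
    have h3 : profile σ ((a - finrank ℝ E) / 2) (‖x‖ ^ 2) ≠ 0 := by
      rw [profile_of_pos h2]
      simp [rpow_pos_of_pos h2]
    exact h3
  exact (Metric.measure_ball_pos volume (0 : E) one_pos).ne' h1

lemma normable_neg_one {a : ℝ} (ha : a < 0) : Normable (-1) a E := by
  refine ⟨nu_univ_ne_zero (by norm_num) a, ?_⟩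
  have h := integrable_rpow_neg_one_add_norm_sq (E := E) (μ := volume)
    (r := finrank ℝ E - a) (by linarith)
  have h2 := h.lintegral_lt_top
  rw [nu_univ]
  refine ne_of_lt (lt_of_eq_of_lt (lintegral_congr fun x => ?_) h2)
  rw [profile_of_pos (by nlinarith [sq_nonneg ‖x‖])]
  congr 2 <;> ring

lemma integrableOn_one_sub_rpow {s : ℝ} (hs : -1 < s) :
    IntegrableOn (fun y : ℝ => 1 + (1 - y) ^ s) (Ioo 0 1) := by
  have h := (intervalIntegral.intervalIntegrable_rpow' (a := 0) (b := 1) hs).comp_sub_left 1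
  have h2 : IntegrableOn (fun y : ℝ => (1 - y) ^ s) (Ioo 0 1) := by
    have := h.symm
    simp only [sub_self, sub_zero] at this
    rwa [intervalIntegrable_iff_integrableOn_Ioo_of_le zero_le_one] at this
  exact (integrableOn_const (by simp)).add h2

lemma normable_one {a : ℝ} (ha : (finrank ℝ E : ℝ) - 2 < a) : Normable 1 a E := by
  refine ⟨nu_univ_ne_zero le_rfl a, ?_⟩
  rw [nu_univ]
  rcases Nat.eq_zero_or_pos (finrank ℝ E) with h0 | h0
  · have := finrank_zero_iff.1 h0
    have h1 : ∀ x : E, profile 1 ((a - finrank ℝ E) / 2) (‖x‖ ^ 2) = 1 := fun x => by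
      rw [Subsingleton.elim x 0, profile_of_pos (by simp)]
      simp
    simp only [h1, lintegral_one]
    exact (toFinite (univ : Set E)).isCompact.measure_lt_top.ne
  have : Nontrivial E := finrank_pos_iff.1 h0
  set s := (a - finrank ℝ E) / 2 with hs
  have hs1 : -1 < s := by rw [hs]; linarith
  have h1 : IntegrableOn (fun x : E => (fun y : ℝ => (1 - y ^ 2) ^ s) ‖x‖)
      (Metric.ball 0 1) := by
    rw [integrableOn_fun_norm_addHaar volume (f := fun y : ℝ => (1 - y ^ 2) ^ s)]
    refine (integrableOn_one_sub_rpow hs1).mono' (by fun_prop) ?_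
    filter_upwards [self_mem_ae_restrict measurableSet_Ioo] with y hy
    have h3 : 0 < 1 - y := by linarith [hy.2]
    have h4 : 1 - y ≤ 1 - y ^ 2 := by nlinarith [hy.1, hy.2]
    have h5 : (1 - y ^ 2) ^ s ≤ 1 + (1 - y) ^ s := by
      rcases le_total 0 s with h | h
      · have := rpow_le_one (h3.le.trans h4) (by nlinarith [hy.1]) h
        have := rpow_nonneg h3.le s
        linarith
      · have := rpow_le_rpow_of_nonpos h3 h4 h
        linarith
    have h6 : 0 ≤ (1 - y ^ 2) ^ s := rpow_nonneg (h3.le.trans h4) s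
    rw [norm_smul, norm_of_nonneg h6, norm_pow, norm_of_nonneg hy.1.le]
    exact (mul_le_of_le_one_left h6 (pow_le_one₀ hy.1.le hy.2.le)).trans h5
  refine ne_of_lt (lt_of_eq_of_lt ?_ h1.lintegral_lt_top)
  rw [← lintegral_indicator Metric.isOpen_ball.measurableSet]
  refine lintegral_congr fun x => ?_
  by_cases hx : ‖x‖ < 1
  · rw [profile_of_pos (by nlinarith [norm_nonneg x]), one_mul, indicator_of_mem (by simpa)]
  · rw [profile, if_neg (by nlinarith [norm_nonneg x]), indicator_of_notMem (by simpa using hx)]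

end Normable

section Circle

/-- The measure with density `cos ^ e` on the interval `(-π/2, π/2)`. -/
def cosMeasure (e : ℝ) : Measure ℝ :=
  (volume.restrict (Ioo (-(π / 2)) (π / 2))).withDensity fun φ => ENNReal.ofReal (cos φ ^ e)

lemma measurable_cos_rpow (e : ℝ) : Measurable fun φ : ℝ => ENNReal.ofReal (cos φ ^ e) := by
  fun_prop

lemma lintegral_cosMeasure (e : ℝ) {H : ℝ → ℝ≥0∞} (hH : Measurable H) :
    ∫⁻ φ, H φ ∂cosMeasure e =
      ∫⁻ φ in Ioo (-(π / 2)) (π / 2), ENNReal.ofReal (cos φ ^ e) * H φ := by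
  rw [cosMeasure, lintegral_withDensity_eq_lintegral_mul _ (measurable_cos_rpow e) hH]
  rfl

lemma lintegral_nu_real (σ a : ℝ) {H : ℝ → ℝ≥0∞} (hH : Measurable H) :
    ∫⁻ t, H t ∂nu σ a ℝ = ∫⁻ t, profile σ ((a - 1) / 2) (t ^ 2) * H t := by
  rw [nu, lintegral_withDensity_eq_lintegral_mul _ (by fun_prop) hH]
  simp

lemma sq_rpow_div_two {c : ℝ} (hc : 0 < c) (e : ℝ) : (c ^ 2) ^ (e / 2) = c ^ e := by
  rw [← rpow_natCast, ← rpow_mul hc.le]; congr 1; push_cast; ring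

lemma image_sin_Ioo : sin '' Ioo (-(π / 2)) (π / 2) = Ioo (-1) 1 := by
  ext t
  constructor
  · rintro ⟨φ, hφ, rfl⟩
    have h := strictMonoOn_sin
    have h1 := h (left_mem_Icc.2 (by linarith [pi_pos])) ⟨hφ.1.le, hφ.2.le⟩ hφ.1
    have h2 := h ⟨hφ.1.le, hφ.2.le⟩ (right_mem_Icc.2 (by linarith [pi_pos])) hφ.2
    rw [sin_neg, sin_pi_div_two] at h1
    rw [sin_pi_div_two] at h2
    exact ⟨h1, h2⟩
  · intro ht
    exact ⟨arcsin t, ⟨neg_pi_div_two_lt_arcsin.2 ht.1, arcsin_lt_pi_div_two.2 ht.2⟩,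
      sin_arcsin ht.1.le ht.2.le⟩

lemma lintegral_profile_one (s : ℝ) (H : ℝ → ℝ≥0∞) :
    ∫⁻ t, profile 1 s (t ^ 2) * H t = ∫⁻ t in Ioo (-1) 1, profile 1 s (t ^ 2) * H t := by
  refine (setLIntegral_eq_of_support_subset fun t ht => ?_).symm
  rw [Function.mem_support] at ht
  have h2 := left_ne_zero_of_mul ht
  rw [profile] at h2
  have h3 : 0 < 1 - 1 * t ^ 2 := by
    by_contra h; rw [if_neg h] at h2; exact h2 rfl
  exact abs_lt.1 ((sq_lt_one_iff_abs_lt_one t).1 (by linarith))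

lemma lintegral_nu_sin (a : ℝ) {H : ℝ → ℝ≥0∞} (hH : Measurable H) :
    ∫⁻ t, H t ∂nu 1 a ℝ = ∫⁻ φ, H (sin φ) ∂cosMeasure a := by
  rw [lintegral_nu_real _ _ hH, lintegral_cosMeasure a (H := fun φ => H (sin φ))
    (hH.comp measurable_sin)]
  rw [lintegral_profile_one, ← image_sin_Ioo,
    lintegral_image_eq_lintegral_abs_deriv_mul measurableSet_Ioo
    (fun φ _ => (hasDerivAt_sin φ).hasDerivWithinAt)
    (strictMonoOn_sin.injOn.mono Ioo_subset_Icc_self)]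
  refine setLIntegral_congr_fun measurableSet_Ioo fun φ hφ => ?_
  have hc : 0 < cos φ := cos_pos_of_mem_Ioo hφ
  have h4 : 1 - 1 * sin φ ^ 2 = cos φ ^ 2 := by rw [cos_sq']; ring
  have h5 : 0 < 1 - 1 * sin φ ^ 2 := by rw [h4]; positivity
  rw [profile_of_pos h5, h4, sq_rpow_div_two hc, ← mul_assoc, ← ENNReal.ofReal_mul (abs_nonneg _),
    abs_of_pos hc, mul_comm (cos φ), ← rpow_add_one hc.ne', sub_add_cancel]

lemma lintegral_nu_tan (a : ℝ) {H : ℝ → ℝ≥0∞} (hH : Measurable H) :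
    ∫⁻ t, H t ∂nu (-1) (-a) ℝ = ∫⁻ φ, H (tan φ) ∂cosMeasure (a - 1) := by
  have htan : Measurable tan := by
    have : tan = fun x => sin x / cos x := funext tan_eq_sin_div_cos
    rw [this]; fun_prop
  rw [lintegral_nu_real _ _ hH,
    lintegral_cosMeasure (a - 1) (H := fun φ => H (tan φ)) (hH.comp htan),
    ← setLIntegral_univ,
    ← image_tan_Ioo, lintegral_image_eq_lintegral_abs_deriv_mul measurableSet_Ioo
    (fun φ hφ => (hasDerivAt_tan (cos_pos_of_mem_Ioo hφ).ne').hasDerivWithinAt)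
    strictMonoOn_tan.injOn]
  refine setLIntegral_congr_fun measurableSet_Ioo fun φ hφ => ?_
  have hc : 0 < cos φ := cos_pos_of_mem_Ioo hφ
  have h4 : 1 - (-1) * tan φ ^ 2 = (cos φ ^ 2)⁻¹ := by
    rw [← inv_one_add_tan_sq hc.ne', inv_inv]; ring
  have h5 : 0 < 1 - (-1) * tan φ ^ 2 := by rw [h4]; positivity
  rw [profile_of_pos h5, h4, ← mul_assoc, ← ENNReal.ofReal_mul (abs_nonneg _)]
  congr 2
  rw [inv_rpow (by positivity), sq_rpow_div_two hc, ← rpow_neg hc.le, abs_of_pos (by positivity),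
    one_div, ← rpow_natCast, ← rpow_neg hc.le, ← rpow_add hc]
  congr 1; push_cast; ring

lemma image_two_mul_sub_one_Ioo : (fun x : ℝ => 2 * x - 1) '' Ioo 0 1 = Ioo (-1) 1 := by
  ext t
  constructor
  · rintro ⟨x, hx, rfl⟩
    exact ⟨by linarith [hx.1], by linarith [hx.2]⟩
  · intro ht
    exact ⟨(t + 1) / 2, ⟨by linarith [ht.1], by linarith [ht.2]⟩, by ring⟩

lemma nu_real_univ_eq_beta {e : ℝ} (he : -1 < e) : nu 1 e ℝ univ =
    ENNReal.ofReal (2 ^ e * ProbabilityTheory.beta ((e + 1) / 2) ((e + 1) / 2)) := by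
  have hpos : 0 < (e + 1) / 2 := by linarith
  have hB := ProbabilityTheory.beta_pos hpos hpos
  have h0 := ProbabilityTheory.lintegral_betaPDF_eq_one hpos hpos
  rw [ProbabilityTheory.lintegral_betaPDF] at h0
  rw [← lintegral_one, lintegral_nu_real 1 e (H := fun _ => 1) measurable_const]
  have hder : ∀ x ∈ Ioo (0 : ℝ) 1,
      HasDerivWithinAt (fun x : ℝ => 2 * x - 1) ((fun _ => (2 : ℝ)) x) (Ioo (0 : ℝ) 1) x :=
    fun x _ => by
    simpa using (((hasDerivAt_id x).const_mul (2 : ℝ)).sub_const 1).hasDerivWithinAt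
  have hinj : InjOn (fun x : ℝ => 2 * x - 1) (Ioo 0 1) := fun x _ y _ h => by simpa using h
  rw [lintegral_profile_one, ← image_two_mul_sub_one_Ioo,
    lintegral_image_eq_lintegral_abs_deriv_mul (measurableSet_Ioo (a := (0 : ℝ)) (b := 1))
      hder hinj]
  simp only [mul_one]
  rw [← mul_one (ENNReal.ofReal (2 ^ e * _)), ← h0, ← lintegral_const_mul _ (by fun_prop)]
  refine setLIntegral_congr_fun (measurableSet_Ioo (a := (0 : ℝ)) (b := 1)) fun x hx => ?_
  have hx0 := hx.1
  have hx1 : 0 < 1 - x := by linarith [hx.2]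
  have h4 : 1 - 1 * (2 * x - 1) ^ 2 = 2 ^ 2 * (x * (1 - x)) := by ring
  have h5 : 0 < 1 - 1 * (2 * x - 1) ^ 2 := by rw [h4]; positivity
  have h6 : (e - 1) / 2 = (e + 1) / 2 - 1 := by ring
  rw [profile_of_pos h5, h4, ← ENNReal.ofReal_mul (by positivity),
    ← ENNReal.ofReal_mul (by positivity), mul_rpow (by positivity) (by positivity),
    sq_rpow_div_two two_pos, mul_rpow hx0.le hx1.le, abs_of_pos two_pos, ← h6]
  congr 1
  have h7 : (2 : ℝ) ^ e = 2 * 2 ^ (e - 1) := by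
    rw [rpow_sub_one two_ne_zero]; ring
  rw [h7]
  field_simp

lemma cosMeasure_univ {e : ℝ} (he : -1 < e) : cosMeasure e univ =
    ENNReal.ofReal (√π * Gamma ((e + 1) / 2) / Gamma (1 + e / 2)) := by
  have h := lintegral_nu_sin e measurable_one
  simp only [Pi.one_apply, lintegral_one] at h
  rw [← h, nu_real_univ_eq_beta he]
  congr 1
  have h1 := Gamma_mul_Gamma_add_half ((e + 1) / 2)
  have hpos : 0 < Gamma ((e + 1) / 2) := Gamma_pos_of_pos (by linarith)
  have hpos' : 0 < Gamma (1 + e / 2) := Gamma_pos_of_pos (by linarith)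
  have hpos'' : 0 < Gamma (e + 1) := Gamma_pos_of_pos (by linarith)
  have e1 : (e + 1) / 2 + 1 / 2 = 1 + e / 2 := by ring
  have e2 : 2 * ((e + 1) / 2) = e + 1 := by ring
  have e3 : 1 - (e + 1) = -e := by ring
  rw [e1, e2, e3, rpow_neg two_pos.le] at h1
  rw [ProbabilityTheory.beta, ← add_div, add_self_div_two]
  have h2 : (0 : ℝ) < 2 ^ e := by positivity
  generalize Gamma ((e + 1) / 2) = A at *
  generalize Gamma (1 + e / 2) = B at *
  field_simp at h1 ⊢
  linear_combination h1

end Circle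

section ExternalAngles

lemma cosMeasure_Iio (e : ℝ) {φ : ℝ} (hφ : φ ∈ Ioo (-(π / 2)) (π / 2)) :
    cosMeasure e (Iio φ) = ∫⁻ θ in Ioc (-(π / 2)) φ, ENNReal.ofReal (cos θ ^ e) := by
  rw [cosMeasure, withDensity_apply _ measurableSet_Iio,
    Measure.restrict_restrict measurableSet_Iio,
    ← setLIntegral_congr Ioo_ae_eq_Ioc]
  congr 2
  ext θ
  simp only [mem_inter_iff, mem_Iio, mem_Ioo]
  constructor
  · rintro ⟨h1, h2, -⟩; exact ⟨h2, h1⟩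
  · rintro ⟨h1, h2⟩; exact ⟨h2, h1, h2.trans hφ.2⟩

lemma intervalIntegral_cos_rpow (e C : ℝ) {φ : ℝ} (hφ : φ ∈ Ioo (-(π / 2)) (π / 2)) :
    ∫ θ in (-(π / 2))..φ, C * cos θ ^ e = C * (cosMeasure e (Iio φ)).toReal := by
  rw [intervalIntegral.integral_const_mul, intervalIntegral.integral_of_le hφ.1.le,
    cosMeasure_Iio e hφ, integral_eq_lintegral_of_nonneg_ae]
  · refine (ae_restrict_iff' measurableSet_Ioc).2 (.of_forall fun θ hθ => ?_)
    exact rpow_nonneg (cos_nonneg_of_mem_Icc ⟨hθ.1.le, hθ.2.trans hφ.2.le⟩) _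
  · have : Measurable fun θ : ℝ => cos θ ^ e := by fun_prop
    exact this.aestronglyMeasurable

lemma integral_eq_leftProb {σ a₀ a e₀ e C₀ C : ℝ} {g : ℝ → ℝ} (hgm : Measurable g)
    (hg : StrictMonoOn g (Ioo (-(π / 2)) (π / 2))) (h₀ : Normable σ a₀ ℝ) (ha : Normable σ a ℝ)
    (hcov₀ : ∀ H : ℝ → ℝ≥0∞, Measurable H → ∫⁻ t, H t ∂nu σ a₀ ℝ = ∫⁻ φ, H (g φ) ∂cosMeasure e₀)
    (hcov : ∀ H : ℝ → ℝ≥0∞, Measurable H → ∫⁻ t, H t ∂nu σ a ℝ = ∫⁻ φ, H (g φ) ∂cosMeasure e)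
    (hC : C * (cosMeasure e univ).toReal = 1) (b : ℕ) :
    ∫ φ in (-(π / 2))..(π / 2), C₀ * cos φ ^ e₀ *
        (∫ θ in (-(π / 2))..φ, C * cos θ ^ e) ^ b =
      C₀ * (cosMeasure e₀ univ).toReal * (leftProb σ a₀ a b).toReal := by
  have hZ₀ : nu σ a₀ ℝ univ = cosMeasure e₀ univ := by
    simpa using hcov₀ 1 measurable_one
  have hZ : nu σ a ℝ univ = cosMeasure e univ := by
    simpa using hcov 1 measurable_one
  have hCZ : C = ((cosMeasure e univ)⁻¹).toReal := by
    rw [ENNReal.toReal_inv]; exact eq_inv_of_mul_eq_one_left hC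
  have hIio : ∀ φ ∈ Ioo (-(π / 2)) (π / 2), nu σ a ℝ (Iio (g φ)) = cosMeasure e (Iio φ) := by
    intro φ hφ
    have h1 := hcov ((Iio (g φ)).indicator 1) (measurable_one.indicator measurableSet_Iio)
    rw [lintegral_indicator_one measurableSet_Iio] at h1
    rw [h1, ← lintegral_indicator_one measurableSet_Iio, lintegral_cosMeasure,
      lintegral_cosMeasure _ (measurable_one.indicator measurableSet_Iio)]
    · refine setLIntegral_congr_fun measurableSet_Ioo fun θ hθ => ?_
      simp only [indicator, mem_Iio, hg.lt_iff_lt hθ hφ, Pi.one_apply]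
    · exact (measurable_one.indicator measurableSet_Iio).comp hgm
  have hmono : Monotone fun t => (pn σ a ℝ (Iio t)) ^ b := fun s t hst =>
    pow_le_pow_left' (measure_mono (Iio_subset_Iio hst)) b
  have hL : cosMeasure e₀ univ * leftProb σ a₀ a b =
      ∫⁻ φ in Ioo (-(π / 2)) (π / 2),
        ENNReal.ofReal (cos φ ^ e₀) * ((cosMeasure e univ)⁻¹ * cosMeasure e (Iio φ)) ^ b := by
    rw [leftProb]
    conv_lhs => rw [pn, lintegral_smul_measure, smul_eq_mul, hZ₀, ← mul_assoc]
    rw [ENNReal.mul_inv_cancel (hZ₀ ▸ h₀.1) (hZ₀ ▸ h₀.2), one_mul, hcov₀ _ hmono.measurable,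
      lintegral_cosMeasure _ (H := fun φ => pn σ a ℝ (Iio (g φ)) ^ b) (hmono.measurable.comp hgm)]
    refine setLIntegral_congr_fun measurableSet_Ioo fun φ hφ => ?_
    simp only [pn, Measure.smul_apply, smul_eq_mul]
    rw [hIio φ hφ, hZ]
  have hle : -(π / 2) ≤ π / 2 := by linarith [pi_pos]
  have hmonoc : Monotone fun φ => ((cosMeasure e univ)⁻¹ * cosMeasure e (Iio φ)) ^ b :=
    fun s t hst =>
    pow_le_pow_left' (mul_le_mul_right (measure_mono (Iio_subset_Iio hst)) _) b
  rw [intervalIntegral.integral_of_le hle, integral_Ioc_eq_integral_Ioo, mul_assoc,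
    ← ENNReal.toReal_mul, hL]
  have h3 : ∀ φ ∈ Ioo (-(π / 2)) (π / 2), C₀ * cos φ ^ e₀ *
        (∫ θ in (-(π / 2))..φ, C * cos θ ^ e) ^ b = C₀ * (ENNReal.ofReal (cos φ ^ e₀) *
          ((cosMeasure e univ)⁻¹ * cosMeasure e (Iio φ)) ^ b).toReal := by
    intro φ hφ
    rw [intervalIntegral_cos_rpow e C hφ, ENNReal.toReal_mul, ENNReal.toReal_pow,
      ENNReal.toReal_mul, ← hCZ, ENNReal.toReal_ofReal (rpow_nonneg (cos_pos_of_mem_Ioo hφ).le _)]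
    ring
  rw [setIntegral_congr_fun measurableSet_Ioo h3, integral_const_mul, integral_toReal]
  · exact ((measurable_cos_rpow e₀).mul hmonoc.measurable).aemeasurable
  · refine .of_forall fun φ => ENNReal.mul_lt_top ENNReal.ofReal_lt_top (ENNReal.pow_lt_top ?_)
    refine ENNReal.mul_lt_top ?_ ?_
    · rw [ENNReal.inv_lt_top, ← hZ]; exact ha.1.bot_lt
    · exact (measure_mono (subset_univ _)).trans_lt (hZ ▸ ha.2.lt_top)

lemma c1_mul_cosMeasure_univ {α : ℝ} (hα : -1 < α) :
    c1 ((α - 1) / 2) * (cosMeasure α univ).toReal = 1 := by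
  have h1 : 0 < Gamma ((α + 1) / 2) := Gamma_pos_of_pos (by linarith)
  have h2 : 0 < Gamma (1 + α / 2) := Gamma_pos_of_pos (by linarith)
  have h3 : 0 < √π := by positivity
  rw [cosMeasure_univ hα, ENNReal.toReal_ofReal (by positivity), c1]
  have e1 : 3 / 2 + (α - 1) / 2 = 1 + α / 2 := by ring
  have e2 : (α - 1) / 2 + 1 = (α + 1) / 2 := by ring
  rw [e1, e2]
  generalize Gamma ((α + 1) / 2) = A at *
  generalize Gamma (1 + α / 2) = B at *
  field_simp

lemma c1t_mul_cosMeasure_univ {α : ℝ} (hα : 0 < α) :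
    c1t ((α + 1) / 2) * (cosMeasure (α - 1) univ).toReal = 1 := by
  have h := c1_mul_cosMeasure_univ (α := α - 1) (by linarith)
  have e1 : 3 / 2 + (α - 1 - 1) / 2 = (α + 1) / 2 := by ring
  have e2 : (α - 1 - 1) / 2 + 1 = (α + 1) / 2 - 1 / 2 := by ring
  rwa [c1, e1, e2] at h

lemma I_eq_leftProb (m k : ℕ) {α : ℝ} (hα : -1 < α) (hk : -1 < α * k) :
    I m k α = c1 ((α * k - 1) / 2) * (cosMeasure (α * k) univ).toReal *
      (leftProb 1 (α * k) α (m - k)).toReal := by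
  refine integral_eq_leftProb measurable_sin (strictMonoOn_sin.mono Ioo_subset_Icc_self)
    (normable_one (by simpa using by linarith)) (normable_one (by simpa using by linarith))
    (fun H hH => lintegral_nu_sin _ hH) (fun H hH => lintegral_nu_sin _ hH)
    (c1_mul_cosMeasure_univ hα) _

lemma It_eq_leftProb (m k : ℕ) {α : ℝ} (hα : 0 < α) (hk : 0 < α * k) :
    It m k α = c1t ((α * k + 1) / 2) * (cosMeasure (α * k - 1) univ).toReal *
      (leftProb (-1) (-(α * k)) (-α) (m - k)).toReal := by
  have htan : Measurable tan := by
    have : tan = fun x => sin x / cos x := funext tan_eq_sin_div_cos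
    rw [this]; fun_prop
  exact integral_eq_leftProb htan strictMonoOn_tan
    (normable_neg_one (by linarith)) (normable_neg_one (by linarith))
    (fun H hH => lintegral_nu_tan _ hH) (fun H hH => lintegral_nu_tan _ hH)
    (c1t_mul_cosMeasure_univ hα) _

end ExternalAngles

section FaceCone

variable {E : Type*} [NormedAddCommGroup E] [InnerProductSpace ℝ E] [FiniteDimensional ℝ E]
variable {V : Type*} [NormedAddCommGroup V] [InnerProductSpace ℝ V] [FiniteDimensional ℝ V]
variable {τ : Type*} [Fintype τ] [DecidableEq τ]

/-- `u` is a linear combination of the vectors `y` with nonnegative coefficients outside `B`. -/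
def InCone (B : Finset τ) (y : τ → E) (u : E) : Prop :=
  ∃ l : τ → ℝ, ∑ j, l j • y j = u ∧ ∀ j ∉ B, 0 ≤ l j

lemma measurableSet_inCone [MeasurableSpace E] [BorelSpace E] (B : Finset τ) :
    MeasurableSet {z : (E × (τ → E)) × E | InCone B (fun j => z.1.2 j - z.1.1) z.2} := by
  have : SecondCountableTopology E := inferInstance
  have : BorelSpace (τ → E) := inferInstance
  have : BorelSpace (E × (τ → E)) := inferInstance
  have : SecondCountableTopology (E × (τ → E)) := inferInstance
  have : OpensMeasurableSpace ((E × (τ → E)) × E) := Prod.opensMeasurableSpace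
  have := measurableSet_exists_closed_open (X := (E × (τ → E)) × E) (Y := τ → ℝ)
    (s := {z | ∑ j, z.2 j • (z.1.1.2 j - z.1.1.1) = z.1.2} ∩ {z | ∀ j ∉ B, 0 ≤ z.2 j})
    (t := univ)
    ((isClosed_eq (by fun_prop) (by fun_prop)).inter (by
      simp only [ofPred_forall]
      exact isClosed_iInter fun j => isClosed_iInter fun _ =>
        isClosed_le continuous_const (by fun_prop))) isOpen_univ
  convert! this using 1
  ext z
  simp [InCone]

lemma InCone.map {B : Finset τ} {y : τ → E} {u : E} (h : InCone B y u) (L : E →ₗ[ℝ] V) :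
    InCone B (fun j => L (y j)) (L u) := by
  obtain ⟨l, hl, hp⟩ := h
  exact ⟨l, by simp [← hl], hp⟩

lemma inCone_indicator_add [MeasureSpace E] [BorelSpace E] [(volume : Measure E).IsAddHaarMeasure]
    [MeasureSpace V] [BorelSpace V] [(volume : Measure V).IsAddHaarMeasure]
    {y : τ → E} (hy : LinearIndependent ℝ y) (hd : Fintype.card τ = finrank ℝ E) {e : E}
    (he : e ≠ 0) {U : V →ₗᵢ[ℝ] E} (hU : coproj U e = 0) (hgp : GenPos fun j => coproj U (y j))
    {B : Finset τ} (hB : B ≠ Finset.univ) [Decidable (InCone B y e)] [Decidable (InCone B y (-e))]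
    [Decidable (PosDepOff B fun j => coproj U (y j))] :
    (if InCone B y e then (1 : ℝ≥0∞) else 0) + (if InCone B y (-e) then 1 else 0) =
      if PosDepOff B fun j => coproj U (y j) then 1 else 0 := by
  have hspan := hy.span_eq_top_of_card_eq_finrank' hd
  obtain ⟨l, hl⟩ : ∃ l : τ → ℝ, ∑ j, l j • y j = e := by
    have : e ∈ Submodule.span ℝ (range y) := hspan ▸ Submodule.mem_top
    exact (Submodule.mem_span_range_iff_exists_fun ℝ).1 this
  have hl0 : l ≠ 0 := by rintro rfl; simp at hl; exact he hl.symm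
  have hly : ∑ j, l j • coproj U (y j) = 0 := by
    rw [← hU, ← hl]; simp
  have huniq : ∀ l' : τ → ℝ, ∑ j, l' j • y j = e → l' = l := fun l' h => by
    have := Fintype.linearIndependent_iff.1 hy (l' - l) (by
      simp [sub_smul, Finset.sum_sub_distrib, h, hl])
    exact funext fun j => sub_eq_zero.1 (this j)
  have hne : ∀ j, l j ≠ 0 := fun j h => hl0 (hgp.eq_zero hly h)
  have hB' : ∃ j, j ∉ B := by
    by_contra! h; exact hB (Finset.eq_univ_of_forall h)
  have h1 : InCone B y e ↔ ∀ j ∉ B, 0 < l j := by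
    constructor
    · rintro ⟨l', h, hp⟩ j hj
      rw [huniq l' h] at hp
      exact lt_of_le_of_ne (hp j hj) (hne j).symm
    · exact fun h => ⟨l, hl, fun j hj => (h j hj).le⟩
  have h2 : InCone B y (-e) ↔ ∀ j ∉ B, l j < 0 := by
    constructor
    · rintro ⟨l', h, hp⟩ j hj
      have h3 := huniq (-l') (by simp [h])
      have h4 := hp j hj
      have h5 : l j = - l' j := by rw [← h3]; rfl
      exact lt_of_le_of_ne (by linarith) (hne j)
    · exact fun h => ⟨-l, by simp [hl], fun j hj => by simpa using (h j hj).le⟩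
  have h3 := hgp.posDepOff_iff hly hl0 B hB'
  obtain ⟨j₀, hj₀⟩ := hB'
  by_cases hp : ∀ j ∉ B, 0 < l j
  · have hn : ¬ ∀ j ∉ B, l j < 0 := fun h => (hp j₀ hj₀).not_gt (h j₀ hj₀)
    rw [if_pos (h1.2 hp), if_neg (mt h2.1 hn), if_pos (h3.2 (Or.inl hp)), add_zero]
  · by_cases hn : ∀ j ∉ B, l j < 0
    · rw [if_neg (mt h1.1 hp), if_pos (h2.2 hn), if_pos (h3.2 (Or.inr hn)), zero_add]
    · rw [if_neg (mt h1.1 hp), if_neg (mt h2.1 hn), if_neg (by rw [h3]; tauto), zero_add]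

lemma exists_weights_of_mem_convexHull_range {ι : Type*} [Fintype ι] {X : ι → E} {x : E}
    (h : x ∈ convexHull ℝ (range X)) :
    ∃ w : ι → ℝ, (∀ i, 0 ≤ w i) ∧ ∑ i, w i = 1 ∧ ∑ i, w i • X i = x := by
  classical
  have hr : range X = Fintype.linearCombination ℝ X ''
      range fun i j : ι => if i = j then (1 : ℝ) else 0 := by
    rw [← range_comp]
    congr 1
    funext i
    simp [Fintype.linearCombination_apply]
  rw [hr, ← LinearMap.image_convexHull, convexHull_basis_eq_stdSimplex] at h
  obtain ⟨w, ⟨h0, h1⟩, rfl⟩ := h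
  exact ⟨w, h0, h1, rfl⟩

lemma exists_mem_convexHull_iff_inCone {d b : ℕ} (X : Fin (d + 1) → E) (hb : b ≤ d) (u : E) :
    (∃ ε : ℝ, 0 < ε ∧
      (((b + 1 : ℕ) : ℝ)⁻¹ • ∑ i ∈ Finset.univ.filter (fun i : Fin (d + 1) => (i : ℕ) < b + 1), X i)
        + ε • u ∈ convexHull ℝ (range X)) ↔
    InCone (Finset.univ.filter fun j : Fin d => (j : ℕ) < b) (fun j => X j.succ - X 0) u := by
  set c : ℝ := ((b + 1 : ℕ) : ℝ)⁻¹
  have hc : 0 < c := by positivity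
  set w₀ : Fin (d + 1) → ℝ := fun i => if (i : ℕ) < b + 1 then c else 0
  have hw₀ : ∑ i, w₀ i = 1 := by
    have : (Finset.univ.filter fun i : Fin (d + 1) => (i : ℕ) < b + 1).card = b + 1 := by
      rw [Fin.card_filter_val_lt]; omega
    rw [← Finset.sum_filter, Finset.sum_const, this, nsmul_eq_mul]
    exact mul_inv_cancel₀ (by positivity)
  have hg : c • ∑ i ∈ Finset.univ.filter (fun i : Fin (d + 1) => (i : ℕ) < b + 1), X i =
      ∑ i, w₀ i • X i := by
    rw [Finset.smul_sum, Finset.sum_filter]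
    exact Finset.sum_congr rfl fun i _ => by simp only [w₀]; split_ifs <;> simp
  rw [hg]
  have hdiff : ∀ l : Fin (d + 1) → ℝ, ∑ i, l i = 0 →
      ∑ j : Fin d, l j.succ • (X j.succ - X 0) = ∑ i, l i • X i := fun l h => by
    rw [Fin.sum_univ_succ] at h
    rw [Fin.sum_univ_succ, eq_neg_of_add_eq_zero_left h]
    simp only [smul_sub, Finset.sum_sub_distrib, neg_smul, Finset.sum_smul]
    abel
  constructor
  · rintro ⟨ε, hε, hmem⟩
    obtain ⟨w, hw, hw1, hws⟩ := exists_weights_of_mem_convexHull_range hmem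
    have hl0 : ∑ i, ε⁻¹ * (w i - w₀ i) = 0 := by
      rw [← Finset.mul_sum, Finset.sum_sub_distrib, hw1, hw₀, sub_self, mul_zero]
    refine ⟨fun j => ε⁻¹ * (w j.succ - w₀ j.succ), ?_, fun j hj => ?_⟩
    · rw [hdiff (fun i => ε⁻¹ * (w i - w₀ i)) hl0]
      simp_rw [mul_smul, ← Finset.smul_sum, sub_smul, Finset.sum_sub_distrib, hws]
      rw [add_sub_cancel_left, inv_smul_smul₀ hε.ne']
    · have : w₀ j.succ = 0 := by
        simp only [Finset.mem_filter_univ, not_lt] at hj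
        exact if_neg (by rw [Fin.val_succ]; omega)
      beta_reduce
      rw [this, sub_zero]
      exact mul_nonneg (inv_nonneg.2 hε.le) (hw _)
  · rintro ⟨l, hl, hp⟩
    let l' : Fin (d + 1) → ℝ := Fin.cons (-∑ j, l j) l
    have hl'0 : ∑ i, l' i = 0 := by rw [Fin.sum_univ_succ]; simp [l']
    have hl' := hdiff l' hl'0
    have : ∀ᶠ ε in nhdsWithin (0 : ℝ) (Ioi 0), ∀ i, 0 ≤ w₀ i + ε * l' i := by
      rw [Filter.eventually_all]
      intro i
      by_cases hi : (i : ℕ) < b + 1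
      · have hcont : Filter.Tendsto (fun ε => w₀ i + ε * l' i) (nhds 0) (nhds (w₀ i + 0 * l' i)) :=
          Continuous.tendsto (by fun_prop) 0
        have : 0 < w₀ i + 0 * l' i := by rw [zero_mul, add_zero]; simp only [w₀, if_pos hi, hc]
        exact ((hcont.eventually (lt_mem_nhds this)).filter_mono nhdsWithin_le_nhds).mono
          fun ε h => h.le
      · filter_upwards [self_mem_nhdsWithin] with ε hε
        have hw : w₀ i = 0 := if_neg hi
        obtain ⟨j, rfl⟩ := Fin.exists_succ_eq.2 (show i ≠ 0 by rintro rfl; simp at hi)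
        rw [hw, zero_add]
        refine mul_nonneg (le_of_lt hε) ?_
        simp only [l', Fin.cons_succ]
        refine hp j ?_
        simp at hi ⊢
        omega
    obtain ⟨ε, hε, hε0⟩ := (this.and self_mem_nhdsWithin).exists
    refine ⟨ε, hε0, ?_⟩
    have hu : ∑ i, l' i • X i = u := by rw [← hl', ← hl]; simp [l']
    have hsum : ∑ i, (w₀ i + ε * l' i) = 1 := by
      rw [Finset.sum_add_distrib, hw₀, ← Finset.mul_sum, hl'0]; simp
    have := (convex_convexHull ℝ (range X)).sum_mem (t := Finset.univ) (fun i _ => hε i) hsum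
      (fun i _ => subset_convexHull ℝ _ (mem_range_self i))
    convert! this using 1
    rw [← hu, Finset.smul_sum, ← Finset.sum_add_distrib]
    exact Finset.sum_congr rfl fun i _ => by rw [add_smul, mul_smul]

end FaceCone

section ConeProbability

variable {E : Type*} [NormedAddCommGroup E] [InnerProductSpace ℝ E] [FiniteDimensional ℝ E]
  [MeasureSpace E] [BorelSpace E] [(volume : Measure E).IsAddHaarMeasure]
variable {V : Type*} [NormedAddCommGroup V] [InnerProductSpace ℝ V] [FiniteDimensional ℝ V]
  [MeasureSpace V] [BorelSpace V] [(volume : Measure V).IsAddHaarMeasure]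
variable {τ : Type*} [Fintype τ] [DecidableEq τ]

/-- The measure is invariant under linear isometries. -/
def RotInvariant (ρ : Measure E) : Prop := ∀ L : E ≃ₗᵢ[ℝ] E, Measure.map L ρ = ρ

lemma measurableSet_inCone_left (B : Finset τ) (u : E) :
    MeasurableSet {z : E × (τ → E) | InCone B (fun j => z.2 j - z.1) u} :=
  (measurableSet_inCone B).preimage (measurable_id.prodMk measurable_const)

lemma RotInvariant.cone_prob {ρ : Measure E} [SigmaFinite ρ] (h : RotInvariant ρ) (B : Finset τ)
    {u v : E} (huv : ‖u‖ = ‖v‖) :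
    (ρ.prod (Measure.pi fun _ : τ => ρ)) {z | InCone B (fun j => z.2 j - z.1) u} =
    (ρ.prod (Measure.pi fun _ : τ => ρ)) {z | InCone B (fun j => z.2 j - z.1) v} := by
  have key : ∀ u v : E, ‖u‖ = ‖v‖ →
      (ρ.prod (Measure.pi fun _ : τ => ρ)) {z | InCone B (fun j => z.2 j - z.1) u} ≤
      (ρ.prod (Measure.pi fun _ : τ => ρ)) {z | InCone B (fun j => z.2 j - z.1) v} := by
    intro u v huv
    set L := Submodule.reflection (ℝ ∙ (u - v))ᗮ
    have hL : L u = v := Submodule.reflection_sub huv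
    have hLm : Measurable L := L.continuous.measurable
    have hS : SigmaFinite (Measure.map L ρ) := by rw [h L]; infer_instance
    have hpi : Measure.map (fun x : τ → E => fun j => L (x j)) (Measure.pi fun _ => ρ) =
        Measure.pi fun _ => ρ := by
      rw [Measure.pi_map_pi (fun _ => hLm.aemeasurable)]
      simp_rw [h L]
    have hm2 : Measurable (fun x : τ → E => fun j => L (x j)) := by fun_prop
    have hprod := Measure.map_prod_map ρ (Measure.pi fun _ : τ => ρ) hLm hm2
    rw [h L, hpi] at hprod
    conv_rhs => rw [hprod, Measure.map_apply (hLm.prodMap hm2) (measurableSet_inCone_left B v)]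
    refine measure_mono fun z hz => ?_
    have := InCone.map hz L.toLinearEquiv.toLinearMap
    simpa [hL] using this
  exact (key u v huv).antisymm (key v u huv.symm)

open Classical in
theorem two_mul_cone_prob {σ a : ℝ} {ρ : Measure E} [IsFiniteMeasure ρ] (hrot : RotInvariant ρ)
    (hnull : NullOnHyperplanes ρ) (ha : Normable σ a V)
    (hproj : ∀ U : V →ₗᵢ[ℝ] E, Measure.map (coproj U) ρ = ρ univ • pn σ a V)
    (hd : Fintype.card τ = finrank ℝ E) (hV : finrank ℝ V + 1 = finrank ℝ E) {B : Finset τ}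
    (hB : B ≠ Finset.univ) {e : E} (he : e ≠ 0) :
    2 * (ρ.prod (Measure.pi fun _ : τ => ρ)) {z | InCone B (fun j => z.2 j - z.1) e} =
      ρ univ ^ (Fintype.card τ + 1) *
        simplexProb σ (a + B.card * a) a (Fintype.card τ - B.card) := by
  have hp := ha.isProbabilityMeasure
  set μ := ρ.prod (Measure.pi fun _ : τ => ρ)
  have hli : LinearIndependent ℝ fun _ : Unit => e := by
    rw [linearIndependent_unique_iff]; exact he
  obtain ⟨U, hU⟩ := exists_isometry_orthogonal (V := V) hli (by simpa using hV)
  have hUe : coproj U e = 0 := coproj_eq_zero fun p => hU p ()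
  have hUm := measurable_coproj U
  have hUm2 : Measurable (fun x : τ → E => fun j => coproj U (x j)) :=
    measurable_pi_lambda _ fun j => hUm.comp (measurable_pi_apply j)
  have hS : SigmaFinite (Measure.map (coproj U) ρ) := inferInstance
  have hS' : IsFiniteMeasure (ρ univ • pn σ a V) := by rw [← hproj U]; infer_instance
  have hpi : Measure.map (fun x : τ → E => fun j => coproj U (x j)) (Measure.pi fun _ => ρ) =
      ρ univ ^ Fintype.card τ • Measure.pi fun _ => pn σ a V := by
    rw [Measure.pi_map_pi (fun _ => hUm.aemeasurable)]
    simp_rw [hproj U]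
    exact pi_smul_const _ _
  have hmap : Measure.map (Prod.map (coproj U) fun x : τ → E => fun j => coproj U (x j)) μ =
      ρ univ ^ (Fintype.card τ + 1) • (pn σ a V).prod (Measure.pi fun _ : τ => pn σ a V) := by
    rw [← Measure.map_prod_map ρ _ hUm hUm2, hproj U, hpi, Measure.prod_smul_left,
      Measure.prod_smul_right, smul_smul, pow_succ']
  have hcard : finrank ℝ V + 1 = Fintype.card τ := by omega
  have hgenV : ∀ᵐ z ∂(pn σ a V).prod (Measure.pi fun _ : τ => pn σ a V),
      GenPos fun j => z.2 j - z.1 :=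
    (Measure.ae_prod_iff_ae_ae measurableSet_genPos).2
      (ae_of_all _ fun x₀ => ae_genPos ha hcard x₀)
  have hgen : ∀ᵐ z ∂μ, GenPos fun j => coproj U (z.2 j - z.1) := by
    have h1 : ∀ᵐ z ∂Measure.map (Prod.map (coproj U) fun x : τ → E => fun j => coproj U (x j)) μ,
        GenPos fun j => z.2 j - z.1 := by
      rw [hmap]
      exact (Measure.smul_absolutelyContinuous).ae_le hgenV
    filter_upwards [ae_of_ae_map (hUm.prodMap hUm2).aemeasurable h1] with z hz
    simpa using hz
  have hind : ∀ᵐ z ∂μ, LinearIndependent ℝ fun j => z.2 j - z.1 :=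
    (Measure.ae_prod_iff_ae_ae isOpen_linearIndependent_sub.measurableSet).2
      (ae_of_all _ fun x₀ => ae_linearIndependent_pi ρ hnull x₀ hd.le)
  have hneg : μ {z | InCone B (fun j => z.2 j - z.1) (-e)} =
      μ {z | InCone B (fun j => z.2 j - z.1) e} := hrot.cone_prob B (norm_neg e)
  have hPm : MeasurableSet {z : V × (τ → V) | PosDepOff B fun j => z.2 j - z.1} := by
    have hf : Measurable fun z : V × (τ → V) => (((z.1, fun j => z.2 j - z.1), fun j => z.2 j) :
      (V × ({j // j ∈ B} → V)) × ({j // j ∉ B} → V)) := by fun_prop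
    exact hf measurableSet_posDep
  have hPi : Measurable fun z : V × (τ → V) =>
      if PosDepOff B (fun j => z.2 j - z.1) then (1 : ℝ≥0∞) else 0 :=
    Measurable.ite hPm measurable_const measurable_const
  have hind1 : ∀ u, μ {z | InCone B (fun j => z.2 j - z.1) u} =
      ∫⁻ z, (if InCone B (fun j => z.2 j - z.1) u then 1 else 0) ∂μ := fun u => by
    rw [← lintegral_indicator_one (measurableSet_inCone_left B u)]
    simp [indicator_apply]
  have hadd : μ {z | InCone B (fun j => z.2 j - z.1) e} +
      μ {z | InCone B (fun j => z.2 j - z.1) (-e)} =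
      ∫⁻ z, (if PosDepOff B (fun j => coproj U (z.2 j - z.1)) then 1 else 0) ∂μ := by
    rw [hind1, hind1, ← lintegral_add_left
      (Measurable.ite (measurableSet_inCone_left B e) measurable_const measurable_const)]
    refine lintegral_congr_ae ?_
    filter_upwards [hgen, hind] with z hz1 hz2
    exact inCone_indicator_add hz2 hd he hUe hz1 hB
  rw [hneg, ← two_mul] at hadd
  rw [hadd, ← lintegral_posDepOff ha ha hcard B hB]
  calc _ = ∫⁻ z, (if PosDepOff B (fun j => z.2 j - z.1) then 1 else 0)
        ∂Measure.map (Prod.map (coproj U) fun x : τ → E => fun j => coproj U (x j)) μ := by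
        rw [lintegral_map hPi (hUm.prodMap hUm2)]
        simp
    _ = _ := by
        rw [hmap, lintegral_smul_measure, lintegral_prod _ hPi.aemeasurable, smul_eq_mul]

end ConeProbability

section MeanAngle

instance isFiniteMeasure_sphereUnif (d : ℕ) : IsFiniteMeasure (sphereUnif d) := by
  rcases Nat.eq_zero_or_pos d with rfl | hd
  · refine ⟨?_⟩
    have : (univ : Set (Metric.sphere (0 : EuclideanSpace ℝ (Fin 0)) 1)) = ∅ := by
      ext x
      have := x.2
      rw [mem_sphere_zero_iff_norm, Subsingleton.elim (x : EuclideanSpace ℝ (Fin 0)) 0] at this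
      simp at this
    simp [this]
  · have : Nonempty (Fin d) := ⟨⟨0, hd⟩⟩
    refine ⟨?_⟩
    rw [sphereUnif, Measure.smul_apply, smul_eq_mul, ENNReal.inv_mul_cancel]
    · exact ENNReal.one_lt_top
    · rw [ne_eq, Measure.measure_univ_eq_zero]
      exact Measure.toSphere_ne_zero _
    · exact measure_ne_top _ _

lemma sphereUnif_univ {d : ℕ} (hd : 0 < d) : sphereUnif d univ = 1 := by
  have : Nonempty (Fin d) := ⟨⟨0, hd⟩⟩
  rw [sphereUnif, Measure.smul_apply, smul_eq_mul, ENNReal.inv_mul_cancel]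
  · rw [ne_eq, Measure.measure_univ_eq_zero]
    exact Measure.toSphere_ne_zero _
  · exact measure_ne_top _ _

/-- The mean internal angle at the face spanned by the first `m` vertices. -/
def meanAngle {d : ℕ} (ρ : Measure (EuclideanSpace ℝ (Fin d))) (m : ℕ) : ℝ :=
  ∫ X : Fin (d + 1) → EuclideanSpace ℝ (Fin d),
    internalAngle ((m : ℝ)⁻¹ • ∑ i ∈ Finset.univ.filter (fun i : Fin (d + 1) => (i : ℕ) < m), X i)
      (convexHull ℝ (Set.range X)) ∂(Measure.pi fun _ => ρ)

variable {d : ℕ} {ρ : Measure (EuclideanSpace ℝ (Fin d))} [IsFiniteMeasure ρ]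

lemma meanAngle_eq_cone_prob (hrot : RotInvariant ρ) {b : ℕ} (hb : b ≤ d)
    {e : EuclideanSpace ℝ (Fin d)} (he : ‖e‖ = 1) :
    meanAngle ρ (b + 1) = ((ρ.prod (Measure.pi fun _ : Fin d => ρ))
      {z | InCone (Finset.univ.filter fun j : Fin d => (j : ℕ) < b) (fun j => z.2 j - z.1)
        e}).toReal := by
  have hd : 0 < d := by
    rcases Nat.eq_zero_or_pos d with rfl | h
    · rw [Subsingleton.elim e 0] at he; simp at he
    · exact h
  set B : Finset (Fin d) := Finset.univ.filter fun j : Fin d => (j : ℕ) < b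
  set S : Set ((Fin (d + 1) → EuclideanSpace ℝ (Fin d)) ×
      Metric.sphere (0 : EuclideanSpace ℝ (Fin d)) 1) :=
    {z | InCone B (fun j : Fin d => z.1 j.succ - z.1 0) (z.2 : EuclideanSpace ℝ (Fin d))}
  have hS : MeasurableSet S := by
    have hf : Measurable fun z : (Fin (d + 1) → EuclideanSpace ℝ (Fin d)) ×
      Metric.sphere (0 : EuclideanSpace ℝ (Fin d)) 1 =>
        (((z.1 0, fun j => z.1 j.succ), (z.2 : EuclideanSpace ℝ (Fin d))) :
          (EuclideanSpace ℝ (Fin d) × (Fin d → EuclideanSpace ℝ (Fin d))) ×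
            EuclideanSpace ℝ (Fin d)) := by fun_prop
    exact hf (measurableSet_inCone B)
  have h1 : ∀ X : Fin (d + 1) → EuclideanSpace ℝ (Fin d),
      internalAngle (((b + 1 : ℕ) : ℝ)⁻¹ •
        ∑ i ∈ Finset.univ.filter (fun i : Fin (d + 1) => (i : ℕ) < b + 1), X i)
        (convexHull ℝ (Set.range X)) = (sphereUnif d (Prod.mk X ⁻¹' S)).toReal := fun X => by
    rw [internalAngle]
    congr 2
    ext u
    exact exists_mem_convexHull_iff_inCone X hb _
  have hc : ∀ u : Metric.sphere (0 : EuclideanSpace ℝ (Fin d)) 1,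
      (Measure.pi fun _ : Fin (d + 1) => ρ) ((fun X => (X, u)) ⁻¹' S) =
      (ρ.prod (Measure.pi fun _ : Fin d => ρ)) {z | InCone B (fun j => z.2 j - z.1) e} := by
    intro u
    have hu : ‖(u : EuclideanSpace ℝ (Fin d))‖ = ‖e‖ := by
      rw [he]; exact mem_sphere_zero_iff_norm.1 u.2
    rw [← hrot.cone_prob B hu]
    rw [← (measurePreserving_piFinSuccAbove (fun _ : Fin (d + 1) => ρ) 0).measure_preimage
      (measurableSet_inCone_left B _).nullMeasurableSet]
    congr 1
  rw [meanAngle]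
  simp_rw [h1]
  rw [integral_toReal (measurable_measure_prodMk_left hS).aemeasurable
    (ae_of_all _ fun X => measure_lt_top _ _), ← Measure.prod_apply hS, Measure.prod_apply_symm hS]
  simp_rw [hc]
  rw [lintegral_const, sphereUnif_univ hd, mul_one]

lemma finrank_euclidean_pred (hd : 0 < d) :
    finrank ℝ (EuclideanSpace ℝ (Fin (d - 1))) + 1 = finrank ℝ (EuclideanSpace ℝ (Fin d)) := by
  rw [finrank_euclideanSpace_fin, finrank_euclideanSpace_fin]; omega

lemma card_filter_lt {b : ℕ} (hb : b ≤ d) :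
    (Finset.univ.filter fun j : Fin d => (j : ℕ) < b).card = b := by
  rw [Fin.card_filter_val_lt, min_eq_right hb]

open Classical in
theorem meanAngle_eq_simplexProb {σ a : ℝ} (hd : 0 < d) (hrot : RotInvariant ρ)
    (hnull : NullOnHyperplanes ρ) (ha : Normable σ a (EuclideanSpace ℝ (Fin (d - 1))))
    (hproj : ∀ U : EuclideanSpace ℝ (Fin (d - 1)) →ₗᵢ[ℝ] EuclideanSpace ℝ (Fin d),
      Measure.map (coproj U) ρ = ρ univ • pn σ a (EuclideanSpace ℝ (Fin (d - 1))))
    {b : ℕ} (hb : b < d) :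
    meanAngle ρ (b + 1) = (ρ univ ^ (d + 1)).toReal *
      (simplexProb σ (a + b * a) a (d - b)).toReal / 2 := by
  set e : EuclideanSpace ℝ (Fin d) := EuclideanSpace.single ⟨0, hd⟩ 1
  have he : ‖e‖ = 1 := by simp [e]
  rw [meanAngle_eq_cone_prob hrot hb.le he]
  have := two_mul_cone_prob (B := Finset.univ.filter fun j : Fin d => (j : ℕ) < b)
    hrot hnull ha hproj (by simp) (finrank_euclidean_pred hd) (e := e) ?_ ?_
  · rw [card_filter_lt hb.le, Fintype.card_fin] at this
    rw [← ENNReal.toReal_mul, ← this, ENNReal.toReal_mul]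
    simp
  · intro h
    have := Finset.mem_univ (⟨b, hb⟩ : Fin d)
    rw [← h] at this
    simp at this
  · rintro h; simp [h] at he

theorem meanAngle_self (hd : 0 < d) (hrot : RotInvariant ρ) (hnull : NullOnHyperplanes ρ) :
    meanAngle ρ (d + 1) = (ρ univ ^ (d + 1)).toReal := by
  set e : EuclideanSpace ℝ (Fin d) := EuclideanSpace.single ⟨0, hd⟩ 1
  have he : ‖e‖ = 1 := by simp [e]
  rw [meanAngle_eq_cone_prob hrot le_rfl he]
  have hind : ∀ᵐ z ∂ρ.prod (Measure.pi fun _ : Fin d => ρ),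
      LinearIndependent ℝ fun j => z.2 j - z.1 :=
    (Measure.ae_prod_iff_ae_ae isOpen_linearIndependent_sub.measurableSet).2
      (ae_of_all _ fun x₀ => ae_linearIndependent_pi ρ hnull x₀ (by simp))
  have : {z : EuclideanSpace ℝ (Fin d) × (Fin d → EuclideanSpace ℝ (Fin d)) |
      InCone (Finset.univ.filter fun j : Fin d => (j : ℕ) < d) (fun j => z.2 j - z.1) e}
      =ᵐ[ρ.prod (Measure.pi fun _ : Fin d => ρ)] univ := by
    rw [ae_eq_univ_iff_measure_eq]
    swap
    · exact (measurableSet_inCone_left _ _).nullMeasurableSet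
    refine measure_congr ?_
    filter_upwards [hind] with z hz
    have hspan := hz.span_eq_top_of_card_eq_finrank' (by simp)
    obtain ⟨l, hl⟩ := (Submodule.mem_span_range_iff_exists_fun ℝ).1
      (hspan ▸ Submodule.mem_top : e ∈ Submodule.span ℝ (range fun j => z.2 j - z.1))
    refine propext ⟨fun _ => trivial, fun _ => ⟨l, hl, fun j hj => ?_⟩⟩
    simp at hj
  rw [measure_congr this, Measure.prod_apply MeasurableSet.univ]
  simp [Measure.pi_univ, pow_succ, mul_comm]

end MeanAngle

section AngleLaw

variable {d : ℕ}

/-- The properties of the law of the vertices which determine the mean angles. -/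
structure AngleLaw (σ a : ℝ) (ρ : Measure (EuclideanSpace ℝ (Fin d))) : Prop where
  finite : IsFiniteMeasure ρ
  rot : RotInvariant ρ
  null : NullOnHyperplanes ρ
  normable : Normable σ a (EuclideanSpace ℝ (Fin (d - 1)))
  proj : ∀ U : EuclideanSpace ℝ (Fin (d - 1)) →ₗᵢ[ℝ] EuclideanSpace ℝ (Fin d),
    Measure.map (coproj U) ρ = ρ univ • pn σ a (EuclideanSpace ℝ (Fin (d - 1)))

lemma rotInvariant_nu (σ a : ℝ) : RotInvariant (nu σ a (EuclideanSpace ℝ (Fin d))) := by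
  intro L
  refine Measure.ext_of_lintegral _ fun F hF => ?_
  have hL : Measurable L := L.continuous.measurable
  rw [lintegral_map hF hL, nu,
    lintegral_withDensity_eq_lintegral_mul _ (by fun_prop)
      (show Measurable fun x => F (L x) from hF.comp hL),
    lintegral_withDensity_eq_lintegral_mul _ (by fun_prop) hF]
  conv_rhs => rw [← L.measurePreserving.lintegral_comp (by fun_prop)]
  simp

lemma Normable.angleLaw_smul_nu {σ a : ℝ} (ha : Normable σ a (EuclideanSpace ℝ (Fin d)))
    (ha' : Normable σ a (EuclideanSpace ℝ (Fin (d - 1)))) {C : ℝ≥0∞} (hC : C ≠ ∞) :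
    AngleLaw σ a (C • nu σ a (EuclideanSpace ℝ (Fin d))) := by
  have := ha.isFiniteMeasure_nu
  refine ⟨Measure.smul_finite _ hC, fun L => ?_, ?_, ha', fun U => ?_⟩
  · rw [Measure.map_smul, rotInvariant_nu σ a L]
  · exact (nullOnHyperplanes_addHaar volume).of_ac
      (Measure.smul_absolutelyContinuous.trans (withDensity_absolutelyContinuous _ _))
  · have h1 : nu σ a (EuclideanSpace ℝ (Fin d)) =
        nu σ a (EuclideanSpace ℝ (Fin d)) univ • pn σ a (EuclideanSpace ℝ (Fin d)) := by
      rw [pn, smul_smul, ENNReal.mul_inv_cancel ha.1 ha.2, one_smul]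
    conv_lhs => rw [h1]
    rw [Measure.map_smul, Measure.map_smul, (ha.map_coproj U).2, smul_smul, Measure.smul_apply,
      smul_eq_mul]

lemma withDensity_eq_smul_nu {σ a c : ℝ} (hc : 0 ≤ c) {f : EuclideanSpace ℝ (Fin d) → ℝ}
    (hf : ∀ x, ENNReal.ofReal (f x) = profile σ ((a - d) / 2) (‖x‖ ^ 2)) :
    (volume.withDensity fun x => ENNReal.ofReal (c * f x)) =
      ENNReal.ofReal c • nu σ a (EuclideanSpace ℝ (Fin d)) := by
  rw [nu, ← withDensity_smul _ (by fun_prop)]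
  congr 1
  ext x
  rw [ENNReal.ofReal_mul hc, hf, finrank_euclideanSpace_fin]
  rfl

lemma angleLaw_betaPrimeMeasure {β : ℝ} (hβ : (d : ℝ) / 2 < β) :
    AngleLaw (-1) (-(2 * β - d)) (betaPrimeMeasure d β) := by
  have h0 : 0 < β - d / 2 := by linarith
  have hβ0 : 0 < β := lt_of_le_of_lt (by positivity) hβ
  have := withDensity_eq_smul_nu (d := d) (σ := -1) (a := -(2 * β - d))
    (c := Real.Gamma β / (Real.pi ^ ((d : ℝ) / 2) * Real.Gamma (β - (d : ℝ) / 2)))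
    (f := fun x => (1 + ‖x‖ ^ 2) ^ (-β))
    (div_nonneg (Real.Gamma_pos_of_pos hβ0).le
      (mul_nonneg (by positivity) (Real.Gamma_pos_of_pos h0).le)) (fun x => by
      have : 0 < 1 - (-1) * ‖x‖ ^ 2 := by nlinarith [sq_nonneg ‖x‖]
      rw [profile_of_pos this]
      congr 2 <;> ring)
  unfold betaPrimeMeasure betaPrimeDensity
  rw [this]
  exact (normable_neg_one (by linarith)).angleLaw_smul_nu (normable_neg_one (by linarith))
    ENNReal.ofReal_ne_top

lemma angleLaw_betaMeasure_of_neg_one_lt {β : ℝ} (hd : 0 < d) (hβ : -1 < β) :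
    AngleLaw 1 (2 * β + d) (betaMeasure d β) := by
  have h0 : 0 < (d : ℝ) / 2 + β + 1 := by
    have : (0 : ℝ) ≤ d / 2 := by positivity
    linarith
  have := withDensity_eq_smul_nu (d := d) (σ := 1) (a := 2 * β + d)
    (c := Real.Gamma ((d : ℝ) / 2 + β + 1) / (Real.pi ^ ((d : ℝ) / 2) * Real.Gamma (β + 1)))
    (f := fun x => if ‖x‖ < 1 then (1 - ‖x‖ ^ 2) ^ β else 0)
    (div_nonneg (Real.Gamma_pos_of_pos h0).le
      (mul_nonneg (by positivity) (Real.Gamma_pos_of_pos (by linarith)).le)) (fun x => by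
      have hiff : 0 < 1 - 1 * ‖x‖ ^ 2 ↔ ‖x‖ < 1 := by
        rw [one_mul, sub_pos, sq_lt_one_iff₀ (norm_nonneg x)]
      unfold profile
      simp only [hiff]
      split_ifs
      · congr 2 <;> ring
      · simp)
  unfold betaMeasure betaDensity
  rw [if_neg hβ.ne', this]
  refine (normable_one ?_).angleLaw_smul_nu (normable_one ?_) ENNReal.ofReal_ne_top
  · rw [finrank_euclideanSpace_fin]; linarith
  · rw [finrank_euclideanSpace_fin, Nat.cast_sub hd]; push_cast; linarith

end AngleLaw

section Sphere

variable {d : ℕ}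

lemma lintegral_eq_two_mul_Ioi {g : ℝ → ℝ≥0∞} (hg : ∀ c, g (-c) = g c) :
    ∫⁻ c, g c = 2 * ∫⁻ c in Ioi 0, g c := by
  have h1 : ∫⁻ c in Iio 0, g c = ∫⁻ c in Ioi 0, g c := by
    rw [← (Measure.measurePreserving_neg (volume : Measure ℝ)).setLIntegral_comp_preimage_emb
      (MeasurableEquiv.neg ℝ).measurableEmbedding]
    simp [hg]
  rw [← lintegral_add_compl g (measurableSet_Ioi (a := (0 : ℝ))), compl_Ioi,
    setLIntegral_congr Iio_ae_eq_Iic.symm, h1, two_mul]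

lemma image_sqrt_sq_sub {q : ℝ} (hq : 0 ≤ q) :
    (fun r : ℝ => √(r ^ 2 - q ^ 2)) '' Ioi q = Ioi 0 := by
  ext c
  simp only [mem_image, mem_Ioi]
  constructor
  · rintro ⟨r, hr, rfl⟩
    exact Real.sqrt_pos.2 (by nlinarith)
  · intro hc
    refine ⟨√(q ^ 2 + c ^ 2), Real.lt_sqrt_of_sq_lt (by nlinarith), ?_⟩
    rw [Real.sq_sqrt (by positivity), add_sub_cancel_left, Real.sqrt_sq hc.le]

lemma profile_neg_half {q r : ℝ} (hr : 0 < r) (hq : 0 ≤ q) :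
    profile 1 (-1 / 2) ((r⁻¹ * q) ^ 2) =
      if q < r then ENNReal.ofReal (r / √(r ^ 2 - q ^ 2)) else 0 := by
  have h1 : 1 - 1 * (r⁻¹ * q) ^ 2 = (r ^ 2 - q ^ 2) / r ^ 2 := by field_simp
  unfold profile
  rw [h1]
  by_cases h : q < r
  · have h2 : 0 < r ^ 2 - q ^ 2 := by nlinarith
    rw [if_pos (by positivity), if_pos h, neg_div, Real.rpow_neg (by positivity),
      ← Real.sqrt_eq_rpow, Real.sqrt_div h2.le, Real.sqrt_sq hr.le, inv_div]
  · rw [if_neg, if_neg h]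
    rw [not_lt]
    exact div_nonpos_of_nonpos_of_nonneg (by nlinarith) (by positivity)

lemma lintegral_sqrt_add_sq {q : ℝ} (hq : 0 ≤ q) (F : ℝ → ℝ≥0∞) :
    ∫⁻ c : ℝ, F √(q ^ 2 + c ^ 2) =
      2 * ∫⁻ r in Ioi 0, F r * profile 1 (-1 / 2) ((r⁻¹ * q) ^ 2) := by
  rw [lintegral_eq_two_mul_Ioi (by simp), ← image_sqrt_sq_sub hq,
    lintegral_image_eq_lintegral_abs_deriv_mul (f' := fun r => r / √(r ^ 2 - q ^ 2))
      measurableSet_Ioi]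
  · congr 1
    rw [image_sqrt_sq_sub hq]
    have : ∫⁻ r in Ioi 0, F r * profile 1 (-1 / 2) ((r⁻¹ * q) ^ 2) =
        ∫⁻ r in Ioi 0, (Ioi q).indicator
          (fun r => F r * ENNReal.ofReal (r / √(r ^ 2 - q ^ 2))) r := by
      refine setLIntegral_congr_fun measurableSet_Ioi fun r hr => ?_
      simp only [profile_neg_half hr hq, indicator_apply, mem_Ioi]
      split_ifs <;> simp
    rw [this, setLIntegral_indicator measurableSet_Ioi, inter_eq_left.2 (Ioi_subset_Ioi hq)]
    refine setLIntegral_congr_fun measurableSet_Ioi fun r (hr : q < r) => ?_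
    have h2 : 0 < r ^ 2 - q ^ 2 := by nlinarith
    have h3 : 0 < r := hq.trans_lt hr
    rw [Real.sq_sqrt h2.le, add_sub_cancel, Real.sqrt_sq h3.le, abs_of_nonneg (by positivity),
      mul_comm]
  · intro r (hr : q < r)
    have h2 : 0 < r ^ 2 - q ^ 2 := by nlinarith
    have := (((hasDerivAt_pow 2 r).sub_const (q ^ 2)).sqrt h2.ne').hasDerivWithinAt (s := Ioi q)
    convert! this using 1
    push_cast
    field_simp
  · intro r (hr : q < r) s (hs : q < s) h
    have h2 : 0 < r ^ 2 - q ^ 2 := by nlinarith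
    have h3 : 0 < s ^ 2 - q ^ 2 := by nlinarith
    have h4 := (Real.sqrt_inj h2.le h3.le).1 h
    have h5 : r ^ 2 = s ^ 2 := by linarith
    exact (sq_eq_sq₀ (hq.trans hr.le) (hq.trans hs.le)).1 h5

/-- The radial projection to the unit sphere. -/
def radial (x : EuclideanSpace ℝ (Fin d)) : EuclideanSpace ℝ (Fin d) := ‖x‖⁻¹ • x

lemma measurable_radial : Measurable (radial : EuclideanSpace ℝ (Fin d) → _) := by
  unfold radial; fun_prop

/-- The punctured open unit ball. -/
def puncturedBall (d : ℕ) : Set (EuclideanSpace ℝ (Fin d)) := {x | 0 < ‖x‖ ∧ ‖x‖ < 1}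

lemma measurableSet_puncturedBall : MeasurableSet (puncturedBall d) :=
  (measurableSet_lt measurable_const measurable_norm).inter
    (measurableSet_lt measurable_norm measurable_const)

lemma betaMeasure_neg_one (d : ℕ) : betaMeasure d (-1) =
    (((volume : Measure (EuclideanSpace ℝ (Fin d))).toSphere Set.univ)⁻¹ * d) •
      Measure.map radial (volume.restrict (puncturedBall d)) := by
  rw [betaMeasure, if_pos rfl, sphereUnif, Measure.map_smul, mul_smul]
  congr 1
  ext T hT
  rw [Measure.map_apply measurable_subtype_coe hT,
    Measure.toSphere_apply' _ (measurable_subtype_coe hT), Measure.smul_apply,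
    Measure.map_apply measurable_radial hT, Measure.restrict_apply (measurable_radial hT),
    finrank_euclideanSpace_fin, smul_eq_mul]
  congr 2
  ext x
  simp only [mem_smul, mem_image, mem_preimage, mem_inter_iff, puncturedBall, mem_ofPred_eq]
  constructor
  · rintro ⟨r, hr, _, ⟨u, hu, rfl⟩, rfl⟩
    have hn : ‖r • (u : EuclideanSpace ℝ (Fin d))‖ = r := by
      rw [norm_smul, mem_sphere_zero_iff_norm.1 u.2, mul_one, Real.norm_of_nonneg hr.1.le]
    rw [radial, hn, smul_smul, inv_mul_cancel₀ hr.1.ne', one_smul]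
    exact ⟨hu, hr⟩
  · rintro ⟨hT, hx⟩
    refine ⟨‖x‖, hx, radial x, ⟨⟨radial x, ?_⟩, hT, rfl⟩, ?_⟩
    · rw [mem_sphere_zero_iff_norm, radial, norm_smul, norm_inv, norm_norm,
        inv_mul_cancel₀ hx.1.ne']
    · rw [radial, smul_smul, mul_inv_cancel₀ hx.1.ne', one_smul]

lemma rotInvariant_betaMeasure_neg_one : RotInvariant (betaMeasure d (-1)) := by
  intro L
  have hL : Measurable L := L.continuous.measurable
  rw [betaMeasure_neg_one, Measure.map_smul]
  congr 1
  have h1 : L ∘ radial = radial ∘ L := by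
    ext1 x
    simp [radial]
  have h2 : L ⁻¹' puncturedBall d = puncturedBall d := by
    ext x; simp [puncturedBall]
  rw [Measure.map_map hL measurable_radial, h1, ← Measure.map_map measurable_radial hL]
  congr 1
  have := L.measurePreserving.restrict_preimage measurableSet_puncturedBall (s := puncturedBall d)
  rw [h2] at this
  exact this.map_eq

lemma isProbabilityMeasure_betaMeasure_neg_one (hd : 0 < d) :
    IsProbabilityMeasure (betaMeasure d (-1)) := by
  have : IsProbabilityMeasure (sphereUnif d) := ⟨sphereUnif_univ hd⟩
  rw [betaMeasure, if_pos rfl]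
  exact Measure.isProbabilityMeasure_map measurable_subtype_coe.aemeasurable

variable {V : Type*} [NormedAddCommGroup V] [InnerProductSpace ℝ V] [FiniteDimensional ℝ V]
  [MeasureSpace V] [BorelSpace V] [(volume : Measure V).IsAddHaarMeasure]

lemma exists_unit_orthogonal (hV : finrank ℝ V + 1 = d) (U : V →ₗᵢ[ℝ] EuclideanSpace ℝ (Fin d)) :
    ∃ e : EuclideanSpace ℝ (Fin d), ‖e‖ = 1 ∧ ∀ p, inner ℝ (U p) e = 0 := by
  obtain ⟨f, hf, hU, -⟩ := exists_orthogonal_family U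
  have h0 : 0 < finrank ℝ (EuclideanSpace ℝ (Fin d)) - finrank ℝ V := by
    rw [finrank_euclideanSpace_fin]; omega
  have hne := hf.ne_zero ⟨0, h0⟩
  refine ⟨‖f ⟨0, h0⟩‖⁻¹ • f ⟨0, h0⟩, ?_, fun p => ?_⟩
  · rw [norm_smul, norm_inv, norm_norm, inv_mul_cancel₀ (norm_ne_zero_iff.2 hne)]
  · rw [inner_smul_right, hU, mul_zero]

lemma exists_map_coproj_radial (hV : finrank ℝ V + 1 = d)
    (U : V →ₗᵢ[ℝ] EuclideanSpace ℝ (Fin d)) :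
    ∃ C : ℝ≥0∞, Measure.map (coproj U) (Measure.map radial (volume.restrict (puncturedBall d))) =
      C • nu 1 ((d : ℝ) - 2) V := by
  obtain ⟨e, he, hU⟩ := exists_unit_orthogonal hV U
  have hli : LinearIndependent ℝ fun _ : Unit => e := by
    rw [linearIndependent_unique_iff]
    rintro h; simp [h] at he
  refine ⟨sliceFactor V (fun _ : Unit => e) * (2 * ∫⁻ r in Ioi (0 : ℝ),
    (if r < 1 then ENNReal.ofReal (r ^ finrank ℝ V) else 0)), ?_⟩
  refine Measure.ext_of_lintegral _ fun F hF => ?_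
  have hm := measurable_coproj U
  have hU' : ∀ p (i : Unit), inner ℝ (U p) ((fun _ : Unit => e) i) = 0 := fun p _ => hU p
  have hexp : ((d : ℝ) - 2 - finrank ℝ V) / 2 = -1 / 2 := by
    rw [← hV]; push_cast; ring
  let H : V → ℝ → ℝ≥0∞ := fun p r => if 0 < r ∧ r < 1 then F (r⁻¹ • p) else 0
  have hH : Measurable (Function.uncurry H) := by
    refine Measurable.ite ?_ ?_ measurable_const
    · exact (measurableSet_lt measurable_const measurable_snd).inter
        (measurableSet_lt measurable_snd measurable_const)
    · exact hF.comp (by fun_prop)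
  have hFm : Measurable fun x => F (coproj U x) := hF.comp hm
  have hFr : Measurable fun x => F (coproj U (radial x)) := hFm.comp measurable_radial
  rw [lintegral_map hF hm, lintegral_map hFm measurable_radial,
    ← lintegral_indicator measurableSet_puncturedBall, lintegral_slice hli hU' (by simpa using hV)
      (hFr.indicator measurableSet_puncturedBall),
    lintegral_smul_measure, smul_eq_mul, mul_assoc]
  congr 1
  have h1 : ∀ p : V, ∫⁻ c : Unit → ℝ, (puncturedBall d).indicator
      (fun x => F (coproj U (radial x))) (U p + ∑ i, c i • e) =
      2 * ∫⁻ r in Ioi 0, H p r * profile 1 (-1 / 2) (‖r⁻¹ • p‖ ^ 2) := by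
    intro p
    rw [← (volume_preserving_funUnique Unit ℝ).symm.lintegral_comp_emb
      (MeasurableEquiv.funUnique Unit ℝ).symm.measurableEmbedding]
    have hnorm : ∀ c : ℝ, ‖U p + ∑ _i : Unit, c • e‖ = √(‖p‖ ^ 2 + c ^ 2) := fun c => by
      rw [← Real.sqrt_sq (norm_nonneg _), norm_sq_slice hU' p fun _ => c]
      simp [norm_smul, he]
    have h2 : ∀ c : ℝ, (puncturedBall d).indicator (fun x => F (coproj U (radial x)))
        (U p + ∑ _i : Unit, c • e) = H p √(‖p‖ ^ 2 + c ^ 2) := by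
      intro c
      simp only [indicator_apply, puncturedBall, mem_ofPred_eq, H, hnorm, radial, map_smul]
      rw [coproj_slice hU' p fun _ => c]
    simp only [MeasurableEquiv.funUnique_symm_apply, uniqueElim_const]
    simp only [h2]
    rw [lintegral_sqrt_add_sq (norm_nonneg p)]
    congr 1
    refine setLIntegral_congr_fun measurableSet_Ioi fun r (hr : 0 < r) => ?_
    simp only [norm_smul, norm_inv, Real.norm_of_nonneg hr.le]
  have hm3 : Measurable (Function.uncurry fun (p : V) (r : ℝ) =>
      H p r * profile 1 (-1 / 2) (‖r⁻¹ • p‖ ^ 2)) :=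
    hH.mul (Measurable.profile (f := fun a : V × ℝ => ‖a.2⁻¹ • a.1‖ ^ 2) (by fun_prop) _)
  simp only [h1]
  rw [lintegral_const_mul' _ _ (by simp), mul_assoc]
  congr 1
  rw [lintegral_lintegral_swap hm3.aemeasurable, nu,
    lintegral_withDensity_eq_lintegral_mul _ (by fun_prop) hF, ← lintegral_mul_const]
  swap
  · exact Measurable.ite measurableSet_Iio (by fun_prop) measurable_const
  refine setLIntegral_congr_fun measurableSet_Ioi fun r (hr : 0 < r) => ?_
  rw [lintegral_comp_smul_pos volume hr]
  simp only [H, smul_smul, inv_mul_cancel₀ hr.ne', one_smul, hr, true_and, Pi.mul_apply, hexp]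
  split_ifs
  · congr 1
    exact lintegral_congr fun x => mul_comm _ _
  · simp

lemma map_coproj_betaMeasure_neg_one (hd : 0 < d) (hV : finrank ℝ V + 1 = d)
    (U : V →ₗᵢ[ℝ] EuclideanSpace ℝ (Fin d)) :
    Normable 1 ((d : ℝ) - 2) V ∧
      Measure.map (coproj U) (betaMeasure d (-1)) = pn 1 ((d : ℝ) - 2) V := by
  have := isProbabilityMeasure_betaMeasure_neg_one hd
  have : IsProbabilityMeasure (Measure.map (coproj U) (betaMeasure d (-1))) :=
    Measure.isProbabilityMeasure_map (measurable_coproj U).aemeasurable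
  obtain ⟨C, hC⟩ := exists_map_coproj_radial hV U
  refine pn_eq_of_nu_map (C :=
    ((volume : Measure (EuclideanSpace ℝ (Fin d))).toSphere Set.univ)⁻¹ * d * C) ?_
  rw [betaMeasure_neg_one, Measure.map_smul, hC, smul_smul]

lemma exists_isometry_mem_range (hd : 2 ≤ d) (hV : finrank ℝ V + 1 = d)
    (v : EuclideanSpace ℝ (Fin d)) :
    ∃ U : V →ₗᵢ[ℝ] EuclideanSpace ℝ (Fin d), ∃ w, U w = v := by
  have h1 : (ℝ ∙ v)ᗮ ≠ ⊥ := by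
    intro h
    have h2 := Submodule.finrank_add_finrank_orthogonal (ℝ ∙ v)
    rw [h, finrank_bot, finrank_euclideanSpace_fin] at h2
    have h3 := finrank_span_le_card (R := ℝ) ({v} : Set (EuclideanSpace ℝ (Fin d)))
    simp at h3
    omega
  obtain ⟨e, he, he0⟩ := Submodule.exists_mem_ne_zero_of_ne_bot h1
  have hli : LinearIndependent ℝ fun _ : Unit => e := by
    rw [linearIndependent_unique_iff]; exact he0
  have hdim : finrank ℝ V + Fintype.card Unit = finrank ℝ (EuclideanSpace ℝ (Fin d)) := by
    simpa using hV
  obtain ⟨U, hU⟩ := exists_isometry_orthogonal (V := V) hli hdim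
  obtain ⟨⟨p, c⟩, hpc⟩ := (sliceMap_bijective hli hU hdim).2 v
  rw [sliceMap_apply] at hpc
  refine ⟨U, p, ?_⟩
  have h4 : inner ℝ v e = 0 := Submodule.mem_orthogonal_singleton_iff_inner_right.1 he
  rw [← hpc, inner_add_left, hU p ()] at h4
  simp [inner_smul_left, he0] at h4
  rw [← hpc]
  simp [h4]

lemma nullOnHyperplanes_betaMeasure_neg_one (hd : 2 ≤ d) :
    NullOnHyperplanes (betaMeasure d (-1)) := by
  intro A hA
  rcases (A : Set (EuclideanSpace ℝ (Fin d))).eq_empty_or_nonempty with h0 | h0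
  · rw [h0, measure_empty]
  have hdir : A.direction ≠ ⊤ := by
    rwa [ne_eq, AffineSubspace.direction_eq_top_iff_of_nonempty h0]
  have h1 : A.directionᗮ ≠ ⊥ := fun h => hdir (Submodule.orthogonal_eq_bot_iff.1 h)
  obtain ⟨v, hv, hv0⟩ := Submodule.exists_mem_ne_zero_of_ne_bot h1
  have hV : finrank ℝ (EuclideanSpace ℝ (Fin (d - 1))) + 1 = d := by
    rw [finrank_euclideanSpace_fin]; omega
  obtain ⟨U, w, rfl⟩ := exists_isometry_mem_range (V := EuclideanSpace ℝ (Fin (d - 1))) hd hV v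
  have hw : w ≠ 0 := by rintro rfl; simp at hv0
  obtain ⟨hn, hmap⟩ := map_coproj_betaMeasure_neg_one (by omega) hV U
  set A' := A.map (coproj U).toAffineMap
  have hA' : A' ≠ ⊤ := by
    intro h
    have h2 : w ∈ A'.direction := by rw [h, AffineSubspace.direction_top]; trivial
    rw [AffineSubspace.map_direction] at h2
    obtain ⟨x, hx, hxw⟩ := h2
    have h3 : inner ℝ x (U w) = 0 := (Submodule.mem_orthogonal _ _).1 hv x hx
    have h4 : inner ℝ (coproj U x) w = 0 := by
      rw [coproj, LinearMap.adjoint_inner_left]; exact h3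
    have h5 : coproj U x = w := hxw
    rw [h5, inner_self_eq_zero] at h4
    exact hw h4
  have h6 : pn 1 ((d : ℝ) - 2) (EuclideanSpace ℝ (Fin (d - 1))) A' = 0 :=
    (nullOnHyperplanes_addHaar volume).of_ac hn.pn_ac A' hA'
  rw [← hmap, Measure.map_apply (measurable_coproj U)
    A'.closed_of_finiteDimensional.measurableSet] at h6
  refine measure_mono_null (fun x hx => ?_) h6
  exact AffineSubspace.mem_map_of_mem _ hx

lemma angleLaw_betaMeasure_neg_one (hd : 2 ≤ d) :
    AngleLaw 1 (2 * (-1) + d) (betaMeasure d (-1)) := by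
  have := isProbabilityMeasure_betaMeasure_neg_one (d := d) (by omega)
  have ha : (2 * (-1) + d : ℝ) = d - 2 := by ring
  rw [ha]
  have hV : finrank ℝ (EuclideanSpace ℝ (Fin (d - 1))) + 1 = d := by
    rw [finrank_euclideanSpace_fin]; omega
  obtain ⟨U, -⟩ := exists_isometry_mem_range (V := EuclideanSpace ℝ (Fin (d - 1))) hd hV 0
  refine ⟨inferInstance, rotInvariant_betaMeasure_neg_one, nullOnHyperplanes_betaMeasure_neg_one hd,
    (map_coproj_betaMeasure_neg_one (by omega) hV U).1, fun U => ?_⟩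
  rw [measure_univ, one_smul]
  exact (map_coproj_betaMeasure_neg_one (by omega) hV U).2

lemma angleLaw_betaMeasure {β : ℝ} (hd : 0 < d) (hβ : -1 ≤ β) (h : d ≠ 1 ∨ β ≠ -1) :
    AngleLaw 1 (2 * β + d) (betaMeasure d β) := by
  rcases hβ.eq_or_lt with rfl | h1
  · exact angleLaw_betaMeasure_neg_one (by simp at h; omega)
  · exact angleLaw_betaMeasure_of_neg_one_lt hd h1

end Sphere

section Relations

variable {σ a₀ a : ℝ}

lemma leftProb_zero (h₀ : Normable σ a₀ ℝ) : leftProb σ a₀ a 0 = 1 := by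
  have := h₀.isProbabilityMeasure
  simp [leftProb]

lemma map_neg_pn (σ a : ℝ) : Measure.map (fun x : ℝ => -x) (pn σ a ℝ) = pn σ a ℝ := by
  rw [pn, Measure.map_smul]
  congr 1
  refine Measure.ext_of_lintegral _ fun F hF => ?_
  rw [lintegral_map hF measurable_neg, nu,
    lintegral_withDensity_eq_lintegral_mul _ (by fun_prop)
      (show Measurable fun x => F (-x) by fun_prop),
    lintegral_withDensity_eq_lintegral_mul _ (by fun_prop) hF]
  conv_rhs => rw [← (Measure.measurePreserving_neg (volume : Measure ℝ)).lintegral_comp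
    (by fun_prop)]
  simp

lemma leftProb_one (h₀ : Normable σ a₀ ℝ) (ha : Normable σ a ℝ) :
    2 * leftProb σ a₀ a 1 = 1 := by
  have := h₀.isProbabilityMeasure
  have := ha.isProbabilityMeasure
  have hm : Measurable fun t : ℝ => pn σ a ℝ (Iio t) :=
    (Monotone.measurable fun s t h => measure_mono (Iio_subset_Iio h))
  have h1 : ∫⁻ t, pn σ a ℝ (Iio t) ∂pn σ a₀ ℝ = ∫⁻ t, pn σ a ℝ (Iio (-t)) ∂pn σ a₀ ℝ := by
    conv_lhs => rw [← map_neg_pn σ a₀]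
    rw [lintegral_map hm measurable_neg]
  have h2 : ∀ t : ℝ, pn σ a ℝ (Iio t) + pn σ a ℝ (Iio (-t)) = 1 := by
    intro t
    have h3 : pn σ a ℝ (Iio (-t)) = pn σ a ℝ (Ioi t) := by
      conv_lhs => rw [← map_neg_pn σ a]
      rw [Measure.map_apply measurable_neg measurableSet_Iio]
      congr 1
      ext x; simp
    have h5 : pn σ a ℝ (Iic t) = pn σ a ℝ (Iio t) :=
      measure_congr (ha.pn_ac.ae_eq Iio_ae_eq_Iic).symm
    rw [h3, ← h5, ← compl_Iic, prob_add_prob_compl measurableSet_Iic]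
  rw [two_mul]
  simp only [leftProb, pow_one]
  nth_rw 2 [h1]
  rw [← lintegral_add_left hm]
  simp [h2]

lemma simplexProb_one (h₀ : Normable σ a₀ (EuclideanSpace ℝ (Fin 0)))
    (ha : Normable σ a (EuclideanSpace ℝ (Fin 0))) : simplexProb σ a₀ a 1 = 1 := by
  have hp : IsProbabilityMeasure (pn σ a₀ (EuclideanSpace ℝ (Fin (1 - 1)))) :=
    h₀.isProbabilityMeasure
  have hq : IsProbabilityMeasure (pn σ a (EuclideanSpace ℝ (Fin (1 - 1)))) :=
    ha.isProbabilityMeasure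
  have h1 : ∀ (p : EuclideanSpace ℝ (Fin (1 - 1))) (w : Fin 1 → EuclideanSpace ℝ (Fin (1 - 1))),
      StrictDep fun j => w j - p :=
    fun p w => ⟨fun _ => 1, Subsingleton.elim (α := EuclideanSpace ℝ (Fin 0)) _ _,
      fun _ => one_pos⟩
  simp only [simplexProb, h1, if_true, lintegral_const, measure_univ, mul_one]

/-- The relation between left probabilities and simplex probabilities, summed by cardinality. -/
theorem sum_choose_leftProb_simplexProb_eq_zero {N : ℕ} (hN : 1 ≤ N)
    (h₀ : Normable σ a₀ (EuclideanSpace ℝ (Fin (N - 1))))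
    (ha : Normable σ a (EuclideanSpace ℝ (Fin (N - 1))))
    (h₀' : Normable σ a₀ ℝ) (ha' : Normable σ a ℝ) :
    ∑ b ∈ Finset.range (N + 1), (-1 : ℝ) ^ (N - b) * N.choose b * (leftProb σ a₀ a b).toReal *
      (if b = N then 2 else (simplexProb σ (a₀ + b * a) a (N - b)).toReal) = 0 := by
  rcases hN.eq_or_lt with rfl | h2
  · have hL := leftProb_one h₀' ha'
    have hL' : (leftProb σ a₀ a 1).toReal * 2 = 1 := by
      have := congrArg ENNReal.toReal hL
      simpa [mul_comm] using this
    have hS := simplexProb_one h₀ ha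
    rw [Finset.sum_range_succ, Finset.sum_range_one]
    simp [hS, leftProb_zero h₀', hL']
  · have h := sum_leftProb_simplexProb_eq_zero (τ := Fin N) h₀ ha
      (by rw [finrank_euclideanSpace_fin, Fintype.card_fin]; omega)
      (by rw [finrank_euclideanSpace_fin]; omega)
    simp only [Fintype.card_fin] at h
    have hcard : ∀ B : Finset (Fin N), B = Finset.univ ↔ B.card = N := fun B => by
      rw [← Finset.card_eq_iff_eq_univ, Fintype.card_fin]
    simp only [hcard] at h
    have h3 := Finset.sum_powerset_apply_card (fun b => (-1 : ℝ) ^ (N - b) *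
      (leftProb σ a₀ a b).toReal *
      (if b = N then 2 else (simplexProb σ (a₀ + b * a) a (N - b)).toReal))
      (x := (Finset.univ : Finset (Fin N)))
    rw [Finset.powerset_univ, h, Finset.card_univ, Fintype.card_fin] at h3
    rw [h3]
    refine Finset.sum_congr rfl fun b _ => ?_
    rw [nsmul_eq_mul]
    ring

theorem AngleLaw.sum_eq_zero {d k : ℕ} (hk1 : 1 ≤ k) (hk2 : k ≤ d)
    {ρ : Measure (EuclideanSpace ℝ (Fin d))} (h : AngleLaw σ a ρ)
    (h₀ : Normable σ (a * k) (EuclideanSpace ℝ (Fin (d - k))))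
    (ha : Normable σ a (EuclideanSpace ℝ (Fin (d - k))))
    (h₀' : Normable σ (a * k) ℝ) (ha' : Normable σ a ℝ) (T : ℝ) :
    ∑ s ∈ Finset.range (d + 1 - k + 1),
      (-1 : ℝ) ^ s * ((d + 1).choose (d + 1 - s) * meanAngle ρ (d + 1 - s)) *
        ((d + 1 - s).choose k * (T * (leftProb σ (a * k) a (d + 1 - s - k)).toReal)) = 0 := by
  have := h.finite
  have hd : 0 < d := by omega
  have hN : d + 1 - k - 1 = d - k := by omega
  have key := sum_choose_leftProb_simplexProb_eq_zero (N := d + 1 - k) (by omega)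
    (by rw [hN]; exact h₀) (by rw [hN]; exact ha) h₀' ha'
  rw [← Finset.sum_range_reflect] at key
  have key2 := congrArg (fun x => ((d + 1).choose k * T * (ρ univ ^ (d + 1)).toReal / 2) * x) key
  simp only [mul_zero, Finset.mul_sum] at key2
  rw [← key2]
  refine Finset.sum_congr rfl fun s hs => ?_
  rw [Finset.mem_range] at hs
  obtain ⟨b, hb⟩ : ∃ b, d + 1 - k = b + s := ⟨d + 1 - k - s, by omega⟩
  have e1 : d + 1 - k + 1 - 1 - s = b := by omega
  have e2 : d + 1 - s = (b + (k - 1)) + 1 := by omega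
  have e3 : d + 1 - k - b = s := by omega
  have e4 : d + 1 - s - k = b := by omega
  have hch := Nat.choose_mul (n := d + 1) (k := d + 1 - s) (s := k) (by omega)
  have hch' : ((d + 1).choose (d + 1 - s) : ℝ) * (d + 1 - s).choose k =
      (d + 1).choose k * (d + 1 - k).choose b := by
    rw [e4] at hch; exact_mod_cast hch
  have hA : meanAngle ρ (d + 1 - s) = (ρ univ ^ (d + 1)).toReal *
      (if b = d + 1 - k then 2 else
        (simplexProb σ (a * k + b * a) a (d + 1 - k - b)).toReal) / 2 := by
    split_ifs with hbN
    · have : s = 0 := by omega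
      subst this
      rw [Nat.sub_zero, meanAngle_self hd h.rot h.null]
      ring
    · rw [e2, meanAngle_eq_simplexProb hd h.rot h.null h.normable h.proj (by omega), e3]
      have e5 : d - (b + (k - 1)) = s := by omega
      have e6 : a + ((b + (k - 1) : ℕ) : ℝ) * a = a * k + b * a := by
        rw [Nat.cast_add, Nat.cast_sub hk1]; push_cast; ring
      rw [e5, e6]
  rw [hA, e1, e3, e4]
  linear_combination ((-1 : ℝ) ^ s * T * (leftProb σ (a * k) a b).toReal *
    ((ρ univ ^ (d + 1)).toReal * (if b = d + 1 - k then 2 else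
        (simplexProb σ (a * k + b * a) a s).toReal) / 2)) * hch'

end Relations

end BetaAngles

open BetaAngles in
theorem dual_angle_sum_relations (n k : ℕ) (hn : 2 ≤ n) (hk1 : 1 ≤ k) (hk2 : k ≤ n - 1) :
    (∀ β : ℝ, -1 ≤ β →
      ∑ s ∈ Finset.range (n - k + 1),
        (-1 : ℝ) ^ s * Jb n (n - s) β * Ib (n - s) k (2 * β + n - 1) = 0) ∧
    (∀ β : ℝ, ((n : ℝ) - 1) / 2 < β →
      ∑ s ∈ Finset.range (n - k + 1),
        (-1 : ℝ) ^ s * Jtb n (n - s) β * Itb (n - s) k (2 * β - n + 1) = 0) := by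
  obtain ⟨d, rfl⟩ : ∃ d, n = d + 1 := ⟨n - 1, by omega⟩
  rw [Nat.add_sub_cancel] at hk2
  have hdk : (((d - k : ℕ) : ℝ)) ≤ (d : ℝ) - 1 := by
    rw [Nat.cast_sub hk2]
    have : (1 : ℝ) ≤ k := by exact_mod_cast hk1
    linarith
  have hk1' : (1 : ℝ) ≤ k := by exact_mod_cast hk1
  refine ⟨fun β hβ => ?_, fun β hβ => ?_⟩
  · by_cases hd : d ≠ 1 ∨ β ≠ -1
    · have e : 2 * β + ((d + 1 : ℕ) : ℝ) - 1 = 2 * β + d := by push_cast; ring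
      have hα : -1 < 2 * β + d ∧ (d : ℝ) - 3 < 2 * β + d ∧
          -1 < (2 * β + d) * k ∧ (d : ℝ) - 3 < (2 * β + d) * k := by
        rcases (hk1.trans hk2).eq_or_lt with rfl | hd2
        · obtain rfl : k = 1 := by omega
          have : -1 < β := hβ.lt_of_ne (Ne.symm (hd.resolve_left (by simp)))
          push_cast
          refine ⟨?_, ?_, ?_, ?_⟩ <;> linarith
        · have hd2' : (2 : ℝ) ≤ d := by exact_mod_cast hd2
          have : 2 * β + d ≤ (2 * β + d) * k := le_mul_of_one_le_right (by linarith) hk1'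
          refine ⟨?_, ?_, ?_, ?_⟩ <;> linarith
      obtain ⟨h1, h2, h3, h4⟩ := hα
      have hl := angleLaw_betaMeasure (d := d) (by omega) hβ hd
      have hn1 : ∀ x : ℝ, (d : ℝ) - 3 < x → Normable 1 x (EuclideanSpace ℝ (Fin (d - k))) :=
        fun x hx => normable_one (by rw [finrank_euclideanSpace_fin]; linarith)
      have hn2 : ∀ x : ℝ, -1 < x → Normable 1 x ℝ :=
        fun x hx => normable_one (by rw [Module.finrank_self]; push_cast; linarith)
      have := hl.sum_eq_zero hk1 hk2 (hn1 _ h4) (hn1 _ h2) (hn2 _ h3) (hn2 _ h1)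
        (c1 (((2 * β + d) * k - 1) / 2) * (cosMeasure ((2 * β + d) * k) Set.univ).toReal)
      rw [← this]
      refine Finset.sum_congr rfl fun s _ => ?_
      rw [e, Ib, I_eq_leftProb _ _ h1 h3]
      rfl
    · push Not at hd
      obtain ⟨rfl, rfl⟩ := hd
      obtain rfl : k = 1 := by omega
      have h0 : ∀ m, I m 1 (2 * (-1) + ((1 + 1 : ℕ) : ℝ) - 1) = 0 := fun m => by
        have : c1 (((2 * (-1) + ((1 + 1 : ℕ) : ℝ) - 1) * (1 : ℕ) - 1) / 2) = 0 := by
          rw [show (((2 * (-1) + ((1 + 1 : ℕ) : ℝ) - 1) * (1 : ℕ) - 1) / 2) = (-1 : ℝ) by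
            norm_num, c1]
          simp
        simp only [I, this, zero_mul, intervalIntegral.integral_zero]
      simp only [Ib, h0, mul_zero, Finset.sum_const_zero]
  · have hα : 0 < 2 * β - d := by push_cast at hβ; linarith
    have e : 2 * β - ((d + 1 : ℕ) : ℝ) + 1 = 2 * β - d := by push_cast; ring
    have hαk : 0 < (2 * β - d) * k := by positivity
    have hl := angleLaw_betaPrimeMeasure (d := d) (β := β) (by linarith)
    have hnk : -(2 * β - d) * k < 0 := by linarith
    have := hl.sum_eq_zero hk1 hk2 (normable_neg_one hnk) (normable_neg_one (by linarith))
      (normable_neg_one hnk) (normable_neg_one (by linarith))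
      (c1t (((2 * β - d) * k + 1) / 2) * (cosMeasure ((2 * β - d) * k - 1) Set.univ).toReal)
    rw [← this]
    refine Finset.sum_congr rfl fun s _ => ?_
    rw [e, Itb, It_eq_leftProb _ _ hα hαk, neg_mul]
    rfl
end
end

section
/- If α ≥ 1 is an odd integer, then for every n ∈ ℕ and every k ∈ {1,…,n} the number 𝐈_{n,k}(α) is rational. -/
open MeasureTheory Real

noncomputable section

theorem integral_cos_pow_add_two_half_period (N : ℕ) :
    ∫ x in (-(π / 2))..(π / 2), cos x ^ (N + 2) =
      ((N : ℝ) + 1) / (N + 2) * ∫ x in (-(π / 2))..(π / 2), cos x ^ N := by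
  rw [integral_cos_pow]
  simp

theorem c1_half_add_one (N : ℕ) :
    c1 ((((N + 2 : ℕ) : ℝ) - 1) / 2) = ((N : ℝ) + 2) / (N + 1) * c1 (((N : ℝ) - 1) / 2) := by
  have h₁ : (0 : ℝ) < N / 2 + 1 := by positivity
  have h₂ : (0 : ℝ) < N / 2 + 1 / 2 := by positivity
  have hΓ := (Real.Gamma_pos_of_pos h₂).ne'
  have e₁ : 3 / 2 + (((N + 2 : ℕ) : ℝ) - 1) / 2 = (N / 2 + 1) + 1 := by push_cast; ring
  have e₂ : (((N + 2 : ℕ) : ℝ) - 1) / 2 + 1 = (N / 2 + 1 / 2) + 1 := by push_cast; ring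
  have e₃ : 3 / 2 + ((N : ℝ) - 1) / 2 = N / 2 + 1 := by ring
  have e₄ : ((N : ℝ) - 1) / 2 + 1 = N / 2 + 1 / 2 := by ring
  rw [c1, c1, e₁, e₂, e₃, e₄, Real.Gamma_add_one h₁.ne', Real.Gamma_add_one h₂.ne']
  field_simp

/-- The density `c1 ((N - 1) / 2) * cos x ^ N` integrates to one. -/
theorem c1_mul_integral_cos_pow (N : ℕ) :
    c1 (((N : ℝ) - 1) / 2) * ∫ x in (-(π / 2))..(π / 2), cos x ^ N = 1 := by
  induction N using Nat.twoStepInduction with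
  | zero =>
    have e₁ : (3 / 2 + (((0 : ℕ) : ℝ) - 1) / 2) = 1 := by norm_num
    have e₂ : (((0 : ℕ) : ℝ) - 1) / 2 + 1 = 1 / 2 := by norm_num
    rw [c1, e₁, e₂, Real.Gamma_one, Real.Gamma_one_half_eq, Real.mul_self_sqrt pi_pos.le]
    simp [pi_ne_zero]
  | one =>
    have e₁ : (3 / 2 + (((1 : ℕ) : ℝ) - 1) / 2) = 1 / 2 + 1 := by norm_num
    have e₂ : (((1 : ℕ) : ℝ) - 1) / 2 + 1 = 1 := by norm_num
    have hπ : √π ≠ 0 := (sqrt_pos.2 pi_pos).ne'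
    rw [c1, e₁, e₂, Real.Gamma_add_one (by norm_num), Real.Gamma_one, Real.Gamma_one_half_eq]
    simp only [pow_one, integral_cos, sin_neg, sin_pi_div_two]
    field_simp
    norm_num
  | more N ih _ =>
    rw [c1_half_add_one, integral_cos_pow_add_two_half_period]
    refine Eq.trans ?_ ih
    have : (N : ℝ) + 1 ≠ 0 := by positivity
    have : (N : ℝ) + 2 ≠ 0 := by positivity
    field_simp

theorem exists_rat_integral_cos_pow_mul_sin_pow (j N : ℕ) :
    ∃ q : ℚ, ∫ x in (-(π / 2))..(π / 2), cos x ^ N * sin x ^ j =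
      q * ∫ x in (-(π / 2))..(π / 2), cos x ^ N := by
  induction j using Nat.twoStepInduction generalizing N with
  | zero => exact ⟨1, by simp⟩
  | one =>
    refine ⟨0, ?_⟩
    have h := integral_sin_pow_odd_mul_cos_pow (a := -(π / 2)) (b := π / 2) 0 N
    simpa [mul_comm] using h
  | more j ih _ =>
    obtain ⟨q, hq⟩ := ih N
    obtain ⟨r, hr⟩ := ih (N + 2)
    refine ⟨q - r * ((N + 1) / (N + 2)), ?_⟩
    have h : ∀ x : ℝ, cos x ^ N * sin x ^ (j + 2) =
        cos x ^ N * sin x ^ j - cos x ^ (N + 2) * sin x ^ j := fun x ↦ by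
      rw [pow_add (sin x), sin_sq]
      ring
    simp only [h]
    rw [intervalIntegral.integral_sub
      ((by fun_prop : Continuous _).intervalIntegrable _ _)
      ((by fun_prop : Continuous _).intervalIntegrable _ _),
      hq, hr, integral_cos_pow_add_two_half_period]
    push_cast
    ring

theorem exists_rat_c1_mul_integral_cos_pow_mul_aeval_sin (N : ℕ) (P : Polynomial ℚ) :
    ∃ q : ℚ, c1 (((N : ℝ) - 1) / 2) *
      ∫ x in (-(π / 2))..(π / 2), cos x ^ N * Polynomial.aeval (sin x) P = q := by
  induction P using Polynomial.induction_on' with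
  | add P Q hP hQ =>
    obtain ⟨q, hq⟩ := hP
    obtain ⟨r, hr⟩ := hQ
    refine ⟨q + r, ?_⟩
    simp only [map_add, mul_add]
    rw [intervalIntegral.integral_add
      ((by fun_prop : Continuous _).intervalIntegrable _ _)
      ((by fun_prop : Continuous _).intervalIntegrable _ _), mul_add, hq, hr]
    push_cast
    rfl
  | monomial j a =>
    obtain ⟨q, hq⟩ := exists_rat_integral_cos_pow_mul_sin_pow j N
    refine ⟨a * q, ?_⟩
    simp only [Polynomial.aeval_monomial, eq_ratCast, mul_left_comm _ (a : ℝ),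
      intervalIntegral.integral_const_mul, hq]
    rw [mul_left_comm _ (q : ℝ), c1_mul_integral_cos_pow]
    push_cast
    ring

theorem exists_aeval_sin_eq_integral_cos_pow_odd (m : ℕ) :
    ∃ P : Polynomial ℚ, ∀ x : ℝ,
      ∫ θ in (-(π / 2))..x, cos θ ^ (2 * m + 1) = Polynomial.aeval (sin x) P := by
  induction m with
  | zero => exact ⟨Polynomial.X + 1, fun x ↦ by simp⟩
  | succ m ih =>
    obtain ⟨P, hP⟩ := ih
    refine ⟨Polynomial.C (1 / (2 * m + 3) : ℚ) * (1 - Polynomial.X ^ 2) ^ (m + 1) * Polynomial.X +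
      Polynomial.C ((2 * m + 2) / (2 * m + 3) : ℚ) * P, fun x ↦ ?_⟩
    have hcos : cos x ^ (2 * m + 1 + 1) = (1 - sin x ^ 2) ^ (m + 1) := by
      rw [← cos_sq', ← pow_mul]
      ring
    rw [show 2 * (m + 1) + 1 = 2 * m + 1 + 2 by ring, integral_cos_pow, hP, hcos]
    simp only [cos_neg, cos_pi_div_two, map_add, map_mul, map_pow, map_sub, map_one,
      Polynomial.aeval_C, Polynomial.aeval_X, eq_ratCast]
    push_cast
    have : (2 * m + 1 + 2 : ℝ) ≠ 0 := by positivity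
    have : (2 * m + 3 : ℝ) ≠ 0 := by positivity
    field_simp
    ring

theorem exists_rat_c1_natCast (m : ℕ) : ∃ q : ℚ, c1 (m : ℝ) = q := by
  obtain ⟨P, hP⟩ := exists_aeval_sin_eq_integral_cos_pow_odd m
  have h := c1_mul_integral_cos_pow (2 * m + 1)
  rw [hP, sin_pi_div_two, show (((2 * m + 1 : ℕ) : ℝ) - 1) / 2 = m by push_cast; ring] at h
  refine ⟨(P.eval 1)⁻¹, ?_⟩
  have hP₁ : Polynomial.aeval (1 : ℝ) P = ((P.eval 1 : ℚ) : ℝ) := by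
    simpa using Polynomial.aeval_algebraMap_apply_eq_algebraMap_eval (A := ℝ) (1 : ℚ) P
  rw [hP₁] at h
  rw [eq_inv_of_mul_eq_one_left h, Rat.cast_inv]

theorem Ib_rational_of_odd (α : ℕ) (hα1 : 1 ≤ α) (hα2 : Odd α) (n k : ℕ) (hk1 : 1 ≤ k)
    (hk2 : k ≤ n) :
    ∃ q : ℚ, Ib n k (α : ℝ) = (q : ℝ) := by
  obtain ⟨m, rfl⟩ := hα2
  obtain ⟨P, hP⟩ := exists_aeval_sin_eq_integral_cos_pow_odd m
  obtain ⟨c, hc⟩ := exists_rat_c1_natCast m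
  obtain ⟨q, hq⟩ := exists_rat_c1_mul_integral_cos_pow_mul_aeval_sin ((2 * m + 1) * k)
    ((Polynomial.C c * P) ^ (n - k))
  refine ⟨n.choose k * q, ?_⟩
  rw [Ib, I, show (((2 * m + 1 : ℕ) : ℝ) - 1) / 2 = m by push_cast; ring, hc, ← Nat.cast_mul]
  simp only [rpow_natCast, intervalIntegral.integral_const_mul, hP, mul_assoc] at hq ⊢
  simp only [map_pow, map_mul, Polynomial.aeval_C, eq_ratCast] at hq
  rw [hq]
  push_cast
  rfl

end
end

section
/- If α ≥ 0 is an even integer, then for every n ∈ ℕ and every k ∈ {1,…,n} there exist rational numbers r_0, r_2, r_4, … such that 𝐈_{n,k}(α) = r_0 + r_2·π^{−2} + r_4·π^{−4} + … + r_{n−k}·π^{−(n−k)} if n−k is even, and 𝐈_{n,k}(α) = r_0 + r_2·π^{−2} + r_4·π^{−4} + … + r_{n−k−1}·π^{−(n−k−1)} if n−k is odd. -/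
open MeasureTheory Real

noncomputable section

/-- The rational span of the odd powers `π, π³, …` with exponent at most `d + 1`. -/
def oddPiSpan (d : ℕ) : Submodule ℚ ℝ :=
  Submodule.span ℚ {y | ∃ b : ℕ, 2 * b ≤ d ∧ y = π ^ (2 * b + 1)}

/-- The rational span of the functions `x ↦ x ^ i * cos (2 * l * x + s * (π / 2))` with `i ≤ d`. -/
def quasiTrig (d : ℕ) : Submodule ℚ (ℝ → ℝ) :=
  Submodule.span ℚ {f | ∃ i : ℕ, i ≤ d ∧ ∃ l s : ℤ,
    f = fun x => x ^ i * cos (2 * l * x + s * (π / 2))}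

/-- The rational span of `1, π⁻², …, π ^ (-2 * N)`. -/
def evenInvPiSpan (N : ℕ) : Submodule ℚ ℝ :=
  Submodule.span ℚ ((fun j : ℕ => π ^ (-(2 * (j : ℤ)))) '' (Finset.range (N + 1) : Set ℕ))

lemma exists_rat_cos_int_mul_pi_div_two (z : ℤ) : ∃ q : ℚ, cos (z * (π / 2)) = q := by
  obtain ⟨k, rfl | rfl⟩ := Int.even_or_odd' z
  · refine ⟨(-1) ^ k, ?_⟩
    rw [show ((2 * k : ℤ) : ℝ) * (π / 2) = k * π by push_cast; ring, cos_int_mul_pi]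
    push_cast
    rfl
  · refine ⟨0, ?_⟩
    rw [show ((2 * k + 1 : ℤ) : ℝ) * (π / 2) = k * π + π / 2 by push_cast; ring, cos_add_pi_div_two,
      sin_int_mul_pi]
    simp

lemma rat_mul_pow_sub_mem_oddPiSpan {d i : ℕ} (hi : i ≤ d + 1) (q : ℚ) :
    (q : ℝ) * ((π / 2) ^ i - (-(π / 2)) ^ i) ∈ oddPiSpan d := by
  rcases Nat.even_or_odd i with h | h
  · simp [h.neg_pow]
  · obtain ⟨b, rfl⟩ := h
    have hodd : Odd (2 * b + 1) := ⟨b, rfl⟩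
    have hmem : π ^ (2 * b + 1) ∈ oddPiSpan d :=
      Submodule.subset_span ⟨b, by omega, rfl⟩
    have := (oddPiSpan d).smul_mem (q * 2 / 2 ^ (2 * b + 1)) hmem
    convert this using 1
    rw [hodd.neg_pow, Rat.smul_def, div_pow]
    push_cast
    ring

lemma hasDerivAt_cos_shift_div {l : ℤ} (hl : l ≠ 0) (s : ℤ) (x : ℝ) :
    HasDerivAt (fun x : ℝ => cos (2 * l * x + (s - 1 : ℤ) * (π / 2)) / (2 * l))
      (cos (2 * l * x + s * (π / 2))) x := by
  have hl' : (l : ℝ) ≠ 0 := by exact_mod_cast hl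
  have hlin : HasDerivAt (fun x : ℝ => 2 * l * x + (s - 1 : ℤ) * (π / 2)) (2 * l) x := by
    simpa using ((hasDerivAt_id x).const_mul (2 * (l : ℝ))).add_const ((s - 1 : ℤ) * (π / 2))
  refine (hlin.cos.div_const (2 * (l : ℝ))).congr_deriv ?_
  rw [show 2 * l * x + (s - 1 : ℤ) * (π / 2) = 2 * l * x + s * (π / 2) - π / 2 by
    push_cast; ring, sin_sub_pi_div_two]
  field_simp

lemma integral_pow_mul_cos_mem_oddPiSpan {d i : ℕ} (hi : i ≤ d) (l s : ℤ) :
    ∫ x in (-(π / 2))..(π / 2), x ^ i * cos (2 * l * x + s * (π / 2)) ∈ oddPiSpan d := by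
  by_cases hl : l = 0
  · subst hl
    obtain ⟨q, hq⟩ := exists_rat_cos_int_mul_pi_div_two s
    simp only [Int.cast_zero, mul_zero, zero_mul, zero_add, hq]
    rw [intervalIntegral.integral_mul_const, integral_pow]
    convert rat_mul_pow_sub_mem_oddPiSpan (d := d) (i := i + 1) (by omega) (q / (i + 1)) using 1
    push_cast
    ring
  induction i generalizing s with
  | zero =>
    simp only [pow_zero, one_mul]
    rw [intervalIntegral.integral_eq_sub_of_hasDerivAt
      (fun x _ => hasDerivAt_cos_shift_div hl s x)
      (Continuous.intervalIntegrable (by fun_prop) _ _)]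
    have h : cos (2 * l * (π / 2) + (s - 1 : ℤ) * (π / 2)) =
        cos (2 * l * (-(π / 2)) + (s - 1 : ℤ) * (π / 2)) := by
      rw [← cos_add_int_mul_two_pi (2 * l * (-(π / 2)) + (s - 1 : ℤ) * (π / 2)) l]
      ring_nf
    rw [h, sub_self]
    exact zero_mem _
  | succ i ih =>
    rw [intervalIntegral.integral_mul_deriv_eq_deriv_mul (fun x _ => hasDerivAt_pow (i + 1) x)
      (fun x _ => hasDerivAt_cos_shift_div hl s x)
      (Continuous.intervalIntegrable (by fun_prop) _ _)
      (Continuous.intervalIntegrable (by fun_prop) _ _)]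
    obtain ⟨q, hq⟩ := exists_rat_cos_int_mul_pi_div_two (2 * l + (s - 1))
    have h₁ : cos (2 * l * (π / 2) + (s - 1 : ℤ) * (π / 2)) = q := by
      rw [← hq]
      push_cast
      ring_nf
    have h₂ : cos (2 * l * (-(π / 2)) + (s - 1 : ℤ) * (π / 2)) = q := by
      rw [← h₁, ← cos_add_int_mul_two_pi (2 * l * (-(π / 2)) + (s - 1 : ℤ) * (π / 2)) l]
      ring_nf
    rw [h₁, h₂]
    refine sub_mem ?_ ?_
    · convert rat_mul_pow_sub_mem_oddPiSpan (d := d) (i := i + 1) (by omega) (q / (2 * l)) using 1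
      push_cast
      ring
    · convert (oddPiSpan d).smul_mem ((i + 1) / (2 * l) : ℚ) (ih (by omega) (s - 1)) using 1
      rw [Rat.smul_def, ← intervalIntegral.integral_const_mul]
      refine intervalIntegral.integral_congr fun x _ => ?_
      simp only [Nat.add_sub_cancel]
      push_cast
      ring

lemma continuous_of_mem_quasiTrig {d : ℕ} {f : ℝ → ℝ} (hf : f ∈ quasiTrig d) : Continuous f := by
  induction hf using Submodule.span_induction with
  | mem f hf =>
    obtain ⟨i, -, l, s, rfl⟩ := hf
    fun_prop
  | zero => exact continuous_zero
  | add f g _ _ hf hg => exact hf.add hg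
  | smul q f _ hf => exact hf.const_smul q

lemma integral_mem_oddPiSpan {d : ℕ} {f : ℝ → ℝ} (hf : f ∈ quasiTrig d) :
    ∫ x in (-(π / 2))..(π / 2), f x ∈ oddPiSpan d := by
  induction hf using Submodule.span_induction with
  | mem f hf =>
    obtain ⟨i, hi, l, s, rfl⟩ := hf
    exact integral_pow_mul_cos_mem_oddPiSpan hi l s
  | zero => simp
  | add f g hf hg ihf ihg =>
    simp only [Pi.add_apply]
    rw [intervalIntegral.integral_add ((continuous_of_mem_quasiTrig hf).intervalIntegrable _ _)
      ((continuous_of_mem_quasiTrig hg).intervalIntegrable _ _)]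
    exact add_mem ihf ihg
  | smul q f _ ih =>
    simp only [Pi.smul_apply, Rat.smul_def]
    rw [intervalIntegral.integral_const_mul, ← Rat.smul_def]
    exact Submodule.smul_mem _ _ ih

lemma quasiTrig_mul_le (d e : ℕ) : quasiTrig d * quasiTrig e ≤ quasiTrig (d + e) := by
  rw [quasiTrig, quasiTrig, Submodule.span_mul_span, Submodule.span_le]
  rintro _ ⟨_, ⟨i, hi, l, s, rfl⟩, _, ⟨j, hj, m, t, rfl⟩, rfl⟩
  have key : ((fun x => x ^ i * cos (2 * l * x + s * (π / 2))) *
        fun x => x ^ j * cos (2 * m * x + t * (π / 2)) : ℝ → ℝ) =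
      (1 / 2 : ℚ) • (fun x => x ^ (i + j) * cos (2 * (l + m : ℤ) * x + (s + t : ℤ) * (π / 2))) +
      (1 / 2 : ℚ) • (fun x => x ^ (i + j) * cos (2 * (l - m : ℤ) * x + (s - t : ℤ) * (π / 2))) := by
    ext x
    simp only [Pi.add_apply, Pi.mul_apply, Pi.smul_apply, Rat.smul_def]
    push_cast
    rw [show 2 * ((l : ℝ) + m) * x + (s + t) * (π / 2) =
        (2 * l * x + s * (π / 2)) + (2 * m * x + t * (π / 2)) by ring,
      show 2 * ((l : ℝ) - m) * x + (s - t) * (π / 2) =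
        (2 * l * x + s * (π / 2)) - (2 * m * x + t * (π / 2)) by ring,
      cos_add (2 * l * x + s * (π / 2)), cos_sub (2 * l * x + s * (π / 2))]
    ring
  change (_ * _ : ℝ → ℝ) ∈ quasiTrig (d + e)
  rw [key]
  exact add_mem (Submodule.smul_mem _ _ (Submodule.subset_span ⟨i + j, by omega, _, _, rfl⟩))
    (Submodule.smul_mem _ _ (Submodule.subset_span ⟨i + j, by omega, _, _, rfl⟩))

lemma mul_mem_quasiTrig {d e : ℕ} {f g : ℝ → ℝ} (hf : f ∈ quasiTrig d) (hg : g ∈ quasiTrig e) :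
    f * g ∈ quasiTrig (d + e) :=
  quasiTrig_mul_le d e (Submodule.mul_mem_mul hf hg)

lemma one_mem_quasiTrig (d : ℕ) : (1 : ℝ → ℝ) ∈ quasiTrig d :=
  Submodule.subset_span ⟨0, by omega, 0, 0, by ext; simp⟩

lemma pow_mem_quasiTrig {d : ℕ} {f : ℝ → ℝ} (hf : f ∈ quasiTrig d) (N : ℕ) :
    f ^ N ∈ quasiTrig (d * N) := by
  induction N with
  | zero => exact one_mem_quasiTrig 0
  | succ N ih => exact mul_mem_quasiTrig ih hf

lemma cos_pow_mem_quasiTrig (m : ℕ) : (fun x => cos x ^ (2 * m)) ∈ quasiTrig 0 := by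
  have h : (fun x => cos x ^ 2) ∈ quasiTrig 0 := by
    have h₁ : (fun x => x ^ 0 * cos (2 * (1 : ℤ) * x + (0 : ℤ) * (π / 2))) ∈ quasiTrig 0 :=
      Submodule.subset_span ⟨0, le_rfl, _, _, rfl⟩
    convert (quasiTrig 0).smul_mem (1 / 2 : ℚ) (add_mem (one_mem_quasiTrig 0) h₁) using 1
    ext x
    simp only [cos_sq, Pi.smul_apply, Pi.add_apply, Pi.one_apply, Rat.smul_def]
    push_cast
    ring_nf
  have hm := pow_mem_quasiTrig h m
  rw [zero_mul] at hm
  convert hm using 1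
  ext x
  simp [pow_mul]

lemma integral_mem_quasiTrig {f : ℝ → ℝ} (hf : f ∈ quasiTrig 0) :
    (fun x => ∫ t in (0 : ℝ)..x, f t) ∈ quasiTrig 1 := by
  induction hf using Submodule.span_induction with
  | mem f hf =>
    obtain ⟨i, hi, l, s, rfl⟩ := hf
    obtain rfl : i = 0 := by omega
    by_cases hl : l = 0
    · subst hl
      refine Submodule.subset_span ⟨1, le_rfl, 0, s, ?_⟩
      ext x
      simp
    · obtain ⟨q, hq⟩ := exists_rat_cos_int_mul_pi_div_two (s - 1)
      have h₁ : (fun x => x ^ 0 * cos (2 * l * x + (s - 1 : ℤ) * (π / 2))) ∈ quasiTrig 1 :=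
        Submodule.subset_span ⟨0, by omega, _, _, rfl⟩
      convert (quasiTrig 1).smul_mem (1 / (2 * l) : ℚ)
        (sub_mem h₁ ((quasiTrig 1).smul_mem q (one_mem_quasiTrig 1))) using 1
      ext x
      simp only [pow_zero, one_mul]
      rw [intervalIntegral.integral_eq_sub_of_hasDerivAt
        (fun t _ => hasDerivAt_cos_shift_div hl s t)
        (Continuous.intervalIntegrable (by fun_prop) _ _)]
      simp only [mul_zero, zero_add, hq, Pi.smul_apply, Pi.sub_apply, Pi.one_apply, Rat.smul_def]
      push_cast
      ring
  | zero =>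
    simp only [Pi.zero_apply, intervalIntegral.integral_zero]
    exact zero_mem _
  | add f g hf hg ihf ihg =>
    convert add_mem ihf ihg using 1
    ext x
    exact intervalIntegral.integral_add ((continuous_of_mem_quasiTrig hf).intervalIntegrable _ _)
      ((continuous_of_mem_quasiTrig hg).intervalIntegrable _ _)
  | smul q f _ ih =>
    convert (quasiTrig 1).smul_mem q ih using 1
    ext x
    simp only [Pi.smul_apply, Rat.smul_def, intervalIntegral.integral_const_mul]

lemma div_pi_pow_mem_evenInvPiSpan {N t : ℕ} (ht : t ≤ N) {x : ℝ} (hx : x ∈ oddPiSpan (2 * t)) :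
    x / π ^ (2 * t + 1) ∈ evenInvPiSpan N := by
  induction hx using Submodule.span_induction with
  | mem x hx =>
    obtain ⟨b, hb, rfl⟩ := hx
    refine Submodule.subset_span ⟨t - b, by simp; omega, ?_⟩
    simp only
    rw [← zpow_natCast, ← zpow_natCast, ← zpow_sub₀ pi_ne_zero]
    congr 1
    push_cast [Nat.cast_sub (show b ≤ t by omega)]
    ring
  | zero => simp
  | add x y _ _ hx hy =>
    rw [add_div]
    exact add_mem hx hy
  | smul q x _ hx =>
    rw [Rat.smul_def, mul_div_assoc, ← Rat.smul_def]
    exact Submodule.smul_mem _ _ hx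

lemma exists_rat_c1 (m : ℕ) : ∃ q : ℚ, c1 ((2 * m - 1) / 2) = q / π := by
  refine ⟨m.factorial * 2 ^ m / Nat.doubleFactorial (2 * m - 1), ?_⟩
  rw [c1, show (3 / 2 + (2 * (m : ℝ) - 1) / 2) = m + 1 by ring,
    show ((2 * (m : ℝ) - 1) / 2 + 1) = m + 1 / 2 by ring, Gamma_nat_eq_factorial,
    Gamma_nat_add_half]
  have h : (Nat.doubleFactorial (2 * m - 1) : ℝ) ≠ 0 := by
    exact_mod_cast (Nat.doubleFactorial_pos _).ne'
  have hs : √π * √π = π := mul_self_sqrt pi_pos.le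
  have hs0 : √π ≠ 0 := (sqrt_pos.2 pi_pos).ne'
  push_cast
  rw [div_eq_div_iff (by positivity) pi_ne_zero]
  field_simp
  rw [sq, hs]

lemma integral_eq_zero_of_odd {f : ℝ → ℝ} (hf : ∀ x, f (-x) = -f x) (a : ℝ) :
    ∫ x in (-a)..a, f x = 0 := by
  have h := intervalIntegral.integral_comp_neg (a := -a) (b := a) f
  simp only [hf, intervalIntegral.integral_neg, neg_neg] at h
  linarith

lemma exists_rat_integral_cos_pow (m : ℕ) :
    ∃ q : ℚ, ∫ x in (-(π / 2))..0, cos x ^ (2 * m) = q * π := by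
  have hint : ∀ a b : ℝ, IntervalIntegrable (fun x => cos x ^ (2 * m)) volume a b :=
    fun a b => Continuous.intervalIntegrable (by fun_prop) _ _
  have hmem : ∫ x in (-(π / 2))..(π / 2), cos x ^ (2 * m) ∈ oddPiSpan 0 :=
    integral_mem_oddPiSpan (cos_pow_mem_quasiTrig m)
  have hset : {y | ∃ b : ℕ, 2 * b ≤ 0 ∧ y = π ^ (2 * b + 1)} = {π} := by
    ext y
    simp
  rw [oddPiSpan, hset, Submodule.mem_span_singleton] at hmem
  obtain ⟨q, hq⟩ := hmem
  have h := intervalIntegral.integral_comp_neg (a := -(π / 2)) (b := 0)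
    (fun x => cos x ^ (2 * m))
  simp only [cos_neg, neg_neg, neg_zero] at h
  have hadd := intervalIntegral.integral_add_adjacent_intervals (hint (-(π / 2)) 0)
    (hint 0 (π / 2))
  refine ⟨q / 2, ?_⟩
  rw [Rat.smul_def] at hq
  push_cast
  linarith

lemma Ib_mem_evenInvPiSpan (m n k : ℕ) :
    Ib n k ((2 * m : ℕ) : ℝ) ∈ evenInvPiSpan ((n - k) / 2) := by
  obtain ⟨q, hq⟩ := exists_rat_c1 (m * k)
  obtain ⟨p, hp⟩ := exists_rat_c1 m
  obtain ⟨w, hw⟩ := exists_rat_integral_cos_pow m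
  set N := n - k with hN
  set h : ℝ → ℝ := fun x => ∫ t in (0 : ℝ)..x, cos t ^ (2 * m) with hh
  have hmem : h ∈ quasiTrig 1 := integral_mem_quasiTrig (cos_pow_mem_quasiTrig m)
  have hcont : Continuous h := continuous_of_mem_quasiTrig hmem
  have hodd : ∀ x, h (-x) = -h x := fun x => by
    have := intervalIntegral.integral_comp_neg (a := 0) (b := x) (fun x => cos x ^ (2 * m))
    simp only [cos_neg, neg_zero] at this
    rw [hh]
    simp only
    rw [this, ← intervalIntegral.integral_symm]
  have hinner : ∀ φ, ∫ θ in (-(π / 2))..φ, c1 ((((2 * m : ℕ) : ℝ) - 1) / 2) *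
      cos θ ^ ((2 * m : ℕ) : ℝ) = p / π * h φ + p * w := fun φ => by
    simp only [rpow_natCast]
    rw [intervalIntegral.integral_const_mul,
      ← intervalIntegral.integral_add_adjacent_intervals (b := 0)
        (Continuous.intervalIntegrable (by fun_prop) _ _)
        (Continuous.intervalIntegrable (by fun_prop) _ _), hw]
    push_cast
    rw [hp]
    field_simp
    ring
  have hI : I n k ((2 * m : ℕ) : ℝ) = ∑ j ∈ Finset.range (N + 1),
      (q * p ^ j * (p * w) ^ (N - j) * N.choose j : ℚ) •
        ((∫ φ in (-(π / 2))..(π / 2), cos φ ^ (2 * (m * k)) * h φ ^ j) / π ^ (j + 1)) := by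
    rw [I]
    simp only [hinner]
    have hpow : ((2 * m : ℕ) : ℝ) * k = ((2 * (m * k) : ℕ) : ℝ) := by push_cast; ring
    have hc : c1 ((((2 * m : ℕ) : ℝ) * k - 1) / 2) = q / π := by
      rw [← hq]
      push_cast
      ring_nf
    simp only [hc]
    simp only [hpow, rpow_natCast, ← hN]
    simp only [add_pow, Finset.mul_sum]
    rw [intervalIntegral.integral_finsetSum
      fun j _ => Continuous.intervalIntegrable (by fun_prop) _ _]
    refine Finset.sum_congr rfl fun j _ => ?_
    rw [Rat.smul_def, ← intervalIntegral.integral_div, ← intervalIntegral.integral_const_mul]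
    refine intervalIntegral.integral_congr fun x _ => ?_
    simp only [mul_pow, div_pow, pow_succ π j]
    push_cast
    field_simp
  rw [Ib, hI, ← Rat.cast_natCast, ← Rat.smul_def]
  refine Submodule.smul_mem _ _ (sum_mem fun j hj => Submodule.smul_mem _ _ ?_)
  rw [Finset.mem_range] at hj
  rcases Nat.even_or_odd j with hje | hjo
  · obtain ⟨t, rfl⟩ := hje.two_dvd
    refine div_pi_pow_mem_evenInvPiSpan (by omega) (integral_mem_oddPiSpan ?_)
    have := mul_mem_quasiTrig (cos_pow_mem_quasiTrig (m * k)) (pow_mem_quasiTrig hmem (2 * t))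
    rw [zero_add, one_mul] at this
    exact this
  · rw [integral_eq_zero_of_odd, zero_div]
    · exact zero_mem _
    · intro x
      rw [cos_neg, hodd, hjo.neg_pow]
      ring

lemma exists_rat_sum_of_mem_evenInvPiSpan {N : ℕ} {x : ℝ} (hx : x ∈ evenInvPiSpan N) :
    ∃ r : ℕ → ℚ, x = ∑ j ∈ Finset.range (N + 1), (r j : ℝ) * π ^ (-(2 * (j : ℤ))) := by
  rw [evenInvPiSpan, Submodule.mem_span_image_finset_iff_exists_fun'] at hx
  obtain ⟨r, rfl⟩ := hx
  exact ⟨r, by simp [Rat.smul_def]⟩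

theorem Ib_pi_expansion_of_even (α : ℕ) (hα : Even α) (n k : ℕ) (hk1 : 1 ≤ k)
    (hk2 : k ≤ n) :
    (Even (n - k) → ∃ r : ℕ → ℚ,
      Ib n k (α : ℝ) =
        ∑ j ∈ Finset.range ((n - k) / 2 + 1), (r j : ℝ) * Real.pi ^ (-(2 * (j : ℤ)))) ∧
    (¬ Even (n - k) → ∃ r : ℕ → ℚ,
      Ib n k (α : ℝ) =
        ∑ j ∈ Finset.range ((n - k - 1) / 2 + 1), (r j : ℝ) * Real.pi ^ (-(2 * (j : ℤ)))) := by
  obtain ⟨m, rfl⟩ := hα.two_dvd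
  have h := Ib_mem_evenInvPiSpan m n k
  refine ⟨fun _ => exists_rat_sum_of_mem_evenInvPiSpan h, fun hodd => ?_⟩
  rw [show (n - k - 1) / 2 = (n - k) / 2 by rw [Nat.not_even_iff] at hodd; omega]
  exact exists_rat_sum_of_mem_evenInvPiSpan h

end
end
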